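/- Under the standing assumptions, the measure μ is comparable to the 2-dimensional Hausdorff measure H²_q of the metric space (X,q): for every Borel set E ⊂ X, (1/(2π C_S² C_D⁴)) H²_q(E) ≤ μ(E) ≤ (C_W²/π) H²_q(E), where C_S = 16 C_W C_D^{28+16⌈log₂ λ⌉} and H²_q is normalized so that it coincides with Lebesgue measure when q is the Euclidean metric on ℝ². -/

import Mathlib

open Metric MeasureTheory Set Filter Topology UniformSpace ENNReal
open scoped NNReal

noncomputable section

/-- The set `B_{xy} = B(x, d(x,y)) ∪ B(y, d(x,y))`. -/
def pairBall {X : Type*} [MetricSpace X] (x y : X) : Set X :=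
  Metric.ball x (dist x y) ∪ Metric.ball y (dist x y)

/-- A `δ`-chain from `x` to `y`: a finite sequence `z 0 = x, …, z m = y` with
consecutive distances at most `δ`. -/
def IsDeltaChain {X : Type*} [MetricSpace X] (δ : ℝ) (x y : X) (z : ℕ → X) (m : ℕ) : Prop :=
  z 0 = x ∧ z m = y ∧ ∀ j < m, dist (z j) (z (j + 1)) ≤ δ

/-- `q^δ_{μ,s}(x,y)`: infimum of `∑ μ(B_{x_j x_{j-1}})^{1/s}` over `δ`-chains from `x` to `y`. -/
def qDelta {X : Type*} [MetricSpace X] [MeasurableSpace X]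
    (μ : Measure X) (s δ : ℝ) (x y : X) : ℝ≥0∞ :=
  ⨅ (m : ℕ) (z : ℕ → X) (_ : IsDeltaChain δ x y z m),
    ∑ j ∈ Finset.range m, μ (pairBall (z j) (z (j + 1))) ^ (1 / s)

/-- `q_{μ,s}(x,y) = limsup_{δ → 0⁺} q^δ_{μ,s}(x,y)`. -/
def qmu {X : Type*} [MetricSpace X] [MeasurableSpace X]
    (μ : Measure X) (s : ℝ) (x y : X) : ℝ≥0∞ :=
  Filter.limsup (fun δ => qDelta μ s δ x y) (nhdsWithin (0 : ℝ) (Set.Ioi 0))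

/-- `μ` is a doubling measure with constant `CD`: balls have positive finite measure and
`μ(B(x,2r)) ≤ CD · μ(B(x,r))`. -/
def IsDoublingWith {X : Type*} [MetricSpace X] [MeasurableSpace X]
    (μ : Measure X) (CD : ℝ≥0) : Prop :=
  (∀ (x : X) (r : ℝ), 0 < r → 0 < μ (Metric.ball x r) ∧ μ (Metric.ball x r) < ⊤) ∧
    ∀ (x : X) (r : ℝ), 0 < r → μ (Metric.ball x (2 * r)) ≤ CD * μ (Metric.ball x r)

/-- `μ` is a `CW`-weak metric doubling measure of dimension `s`:
`μ(B_{xy})^{1/s} ≤ CW · q_{μ,s}(x,y)` for all `x, y`. -/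
def IsWMDM {X : Type*} [MetricSpace X] [MeasurableSpace X]
    (μ : Measure X) (s : ℝ) (CW : ℝ≥0) : Prop :=
  ∀ x y : X, μ (pairBall x y) ^ (1 / s) ≤ CW * qmu μ s x y

/-- A continuum is a compact connected set. -/
def IsContinuum {X : Type*} [TopologicalSpace X] (K : Set X) : Prop :=
  IsCompact K ∧ IsConnected K

/-- `X` is `λ`-linearly locally connected. -/
def IsLLC (X : Type*) [MetricSpace X] (lam : ℝ) : Prop :=
  ∀ (x : X) (r : ℝ), 0 < r →
    (∀ y ∈ Metric.ball x r, ∀ z ∈ Metric.ball x r,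
      ∃ K : Set X, IsContinuum K ∧ K ⊆ Metric.ball x (lam * r) ∧ y ∈ K ∧ z ∈ K) ∧
    (∀ y z : X, y ∉ Metric.ball x r → z ∉ Metric.ball x r →
      ∃ K : Set X, IsContinuum K ∧ K ⊆ (Metric.ball x (r / lam))ᶜ ∧ y ∈ K ∧ z ∈ K)

/-- The sphere `S²`, with the metric inherited from `ℝ³`. -/
abbrev Sphere2 : Set (EuclideanSpace ℝ (Fin 3)) := Metric.sphere 0 1

/-- A circle domain in `S²`: an open connected set each of whose complementary
connected components is a point or a round closed disk (a closed metric ball). -/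
def IsCircleDomainS2 (Ω : Set ↥Sphere2) : Prop :=
  IsOpen Ω ∧ IsConnected Ω ∧ ∀ p ∈ Ωᶜ,
    connectedComponentIn Ωᶜ p = {p} ∨
      ∃ (c : ↥Sphere2) (ρ : ℝ), 0 < ρ ∧ connectedComponentIn Ωᶜ p = Metric.closedBall c ρ

/-- A circle domain in the plane. -/
def IsCircleDomainC (Ω : Set ℂ) : Prop :=
  IsOpen Ω ∧ IsConnected Ω ∧ ∀ p ∈ Ωᶜ,
    connectedComponentIn Ωᶜ p = {p} ∨
      ∃ (c : ℂ) (ρ : ℝ), 0 < ρ ∧ connectedComponentIn Ωᶜ p = Metric.closedBall c ρ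

/-- The residual set `X̄ ∖ X` inside the completion of `X`. -/
def resid (X : Type*) [MetricSpace X] : Set (Completion X) :=
  (Set.range ((↑) : X → Completion X))ᶜ

/-- The collection of connected components of `X̄ ∖ X`. -/
def residComps (X : Type*) [MetricSpace X] : Set (Set (Completion X)) :=
  {C | ∃ p ∈ resid X, C = connectedComponentIn (resid X) p}

/-- Distance between two sets. -/
def setSetDist {Z : Type*} [MetricSpace Z] (A B : Set Z) : ℝ :=
  sInf (Set.image2 dist A B)

/-- `f` is `η`-quasisymmetric, for a homeomorphism `η` of `[0,∞)`. -/
def IsQSWith {X Y : Type*} [MetricSpace X] [MetricSpace Y]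
    (η : ℝ≥0 ≃ₜ ℝ≥0) (f : X → Y) : Prop :=
  ∀ x y z : X, x ≠ z →
    nndist (f x) (f y) ≤ η (nndist x y / nndist x z) * nndist (f x) (f z)

/-- `ℓ = ⌈log₂ λ⌉`. -/
def ellOf (lam : ℝ) : ℕ := (Int.ceil (Real.logb 2 lam)).toNat

/-- The constant `C_S = 16 C_W C_D^{28+16⌈log₂ λ⌉}`. -/
def CSconst (lam : ℝ) (CD CW : ℝ≥0) : ℝ≥0∞ :=
  16 * (CW : ℝ≥0∞) * (CD : ℝ≥0∞) ^ (28 + 16 * ellOf lam)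

/-- `K` separates `A` and `B`: `A` and `B` lie in different components of the complement of `K`. -/
def SeparatesSets {X : Type*} [TopologicalSpace X] (K A B : Set X) : Prop :=
  A ⊆ Kᶜ ∧ B ⊆ Kᶜ ∧
    ∀ p ∈ A, ∀ p' ∈ B, connectedComponentIn Kᶜ p ≠ connectedComponentIn Kᶜ p'

/-- A topological disk: a set homeomorphic to an open disk in the plane. -/
def IsTopDisk {X : Type*} [TopologicalSpace X] (U : Set X) : Prop :=
  Nonempty (↥U ≃ₜ ↥(Metric.ball (0 : ℂ) 1))

/-- Lower line integral `∫_γ ρ ds` over `γ : [a,b] → Y`, as a supremum of lower sums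
over partitions of `[a,b]`. -/
def lowerLineIntegral {Y : Type*} [PseudoEMetricSpace Y]
    (ρ : Y → ℝ≥0∞) (γ : ℝ → Y) (a b : ℝ) : ℝ≥0∞ :=
  ⨆ (n : ℕ) (t : ℕ → ℝ) (_ : t 0 = a) (_ : t n = b) (_ : ∀ j < n, t j ≤ t (j + 1)),
    ∑ j ∈ Finset.range n,
      (⨅ u ∈ Set.Icc (t j) (t (j + 1)), ρ (γ u)) * edist (γ (t j)) (γ (t (j + 1)))

/-- `γ` (with parameter interval `[0,1]`) is locally rectifiable on the open interval `(0,1)`. -/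
def LocRectifiableOn {Y : Type*} [PseudoEMetricSpace Y] (γ : ℝ → Y) : Prop :=
  ∀ c d : ℝ, 0 < c → c ≤ d → d < 1 → eVariationOn γ (Set.Icc c d) < ⊤

/-- The line integral of `ρ` over the open part of `γ`. -/
def openLineIntegral {Y : Type*} [PseudoEMetricSpace Y] (ρ : Y → ℝ≥0∞) (γ : ℝ → Y) : ℝ≥0∞ :=
  ⨆ (c : ℝ) (d : ℝ) (_ : 0 < c) (_ : c ≤ d) (_ : d < 1), lowerLineIntegral ρ γ c d

/-- `ρ` is admissible for the path family `Γ`. -/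
def IsAdmissible {Y : Type*} [PseudoEMetricSpace Y] (Γ : Set (ℝ → Y)) (ρ : Y → ℝ≥0∞) : Prop :=
  ∀ γ ∈ Γ, LocRectifiableOn γ → 1 ≤ openLineIntegral ρ γ

def borelSpaceBorel (Y : Type*) [TopologicalSpace Y] : @BorelSpace Y _ (borel Y) :=
  @BorelSpace.mk Y _ (borel Y) rfl

/-- The Hausdorff 2-measure of a metric space, normalized to coincide with Lebesgue measure
in the Euclidean plane. -/
def hausdorff2 (Y : Type*) [EMetricSpace Y] : @Measure Y (borel Y) :=
  ENNReal.ofReal (Real.pi / 4) •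
    @Measure.hausdorffMeasure Y _ (borel Y) (borelSpaceBorel Y) 2

/-- The conformal modulus of a path family in a metric space, with respect to the
(normalized) Hausdorff 2-measure. -/
def modulusH2 {Y : Type*} [EMetricSpace Y] (Γ : Set (ℝ → Y)) : ℝ≥0∞ :=
  ⨅ (ρ : Y → ℝ≥0∞) (_ : @Measurable Y ℝ≥0∞ (borel Y) _ ρ) (_ : IsAdmissible Γ ρ),
    @MeasureTheory.lintegral Y (borel Y) (hausdorff2 Y) fun y => ρ y ^ 2

/-- The conformal modulus of a path family in the plane, with respect to Lebesgue area measure. -/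
def modulusC (Γ : Set (ℝ → ℂ)) : ℝ≥0∞ :=
  ⨅ (ρ : ℂ → ℝ≥0∞) (_ : Measurable ρ) (_ : IsAdmissible Γ ρ), ∫⁻ z, ρ z ^ 2

/-- A homeomorphism between metric spaces is `K`-quasiconformal if it distorts moduli of
path families by a factor of at most `K` in both directions. -/
def IsQCWith {Y Z : Type*} [EMetricSpace Y] [EMetricSpace Z] (K : ℝ≥0∞) (f : Y ≃ₜ Z) : Prop :=
  ∀ Γ : Set (ℝ → Y),
    modulusH2 ((fun γ => (f : Y → Z) ∘ γ) '' Γ) ≤ K * modulusH2 Γ ∧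
      modulusH2 Γ ≤ K * modulusH2 ((fun γ => (f : Y → Z) ∘ γ) '' Γ)

/-- The family `Γ(A,B;G)` of paths joining `A` and `B` in `G` (parameter interval `[0,1]`). -/
def joinPaths (A B G : Set ℂ) : Set (ℝ → ℂ) :=
  {γ | ContinuousOn γ (Set.Icc 0 1) ∧ γ 0 ∈ A ∧ γ 1 ∈ B ∧
    γ 0 ∈ closure G ∧ γ 1 ∈ closure G ∧ ∀ u ∈ Set.Ioo (0 : ℝ) 1, γ u ∈ G}

/-- The constant `α = 2^{−2−2M−π²C_W²C_D^{1+log₂ C_X}/(8 log 2)}`. -/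
def alphaConst (M : ℕ) (CD CW : ℝ≥0) (CX : ℝ) : ℝ :=
  (2 : ℝ) ^ (-2 - 2 * (M : ℝ) -
    Real.pi ^ 2 * (CW : ℝ) ^ 2 * (CD : ℝ) ^ ((1 : ℝ) + Real.logb 2 CX) / (8 * Real.log 2))

section
theorem int_const {W : Type*} [TopologicalSpace W] {S : Set W} (hS : IsPreconnected S) {h : W → ℝ}
    (hc : ContinuousOn h S) (hi : ∀ x ∈ S, ((h x : ℝ) : UnitAddCircle) = 0) {a b : W}
    (ha : a ∈ S) (hb : b ∈ S) : h a = h b := by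
  have : DiscreteTopology (range ((↑) : ℤ → ℝ)) := by
    have := Int.isClosedEmbedding_coe_real.isEmbedding.toHomeomorph
    exact this.symm.isEmbedding.discreteTopology
  refine hS.constant_of_mapsTo (T := range ((↑) : ℤ → ℝ)) ⟨this⟩ hc (fun x hx => ?_) ha hb
  obtain ⟨n, hn⟩ := (AddCircle.coe_eq_zero_iff (1:ℝ)).1 (hi x hx)
  exact ⟨n, by simpa using hn⟩

def HasLifts (W : Type*) [TopologicalSpace W] : Prop :=
  ∀ g : W → UnitAddCircle, Continuous g → ∃ θ : W → ℝ, Continuous θ ∧ ∀ w, (θ w : UnitAddCircle) = g w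

theorem janiszewski {W : Type*} [TopologicalSpace W] [NormalSpace W] [LocallyConnectedSpace W]
    (hL : HasLifts W) {W1 W2 K1 K2 : Set W} (h1 : IsOpen W1) (h2 : IsOpen W2) (hU : W1 ∪ W2 = univ)
    (hK1 : IsPreconnected K1) (hK2 : IsPreconnected K2) (hs1 : K1 ⊆ W1) (hs2 : K2 ⊆ W2)
    {x y : W} (hx1 : x ∈ K1) (hx2 : x ∈ K2) (hy1 : y ∈ K1) (hy2 : y ∈ K2) :
    y ∈ connectedComponentIn (W1 ∩ W2) x := by
  classical
  by_contra hy
  set A := connectedComponentIn (W1 ∩ W2) x with hA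
  have hxm : x ∈ W1 ∩ W2 := ⟨hs1 hx1, hs2 hx2⟩
  have hAo : IsOpen A := (h1.inter h2).connectedComponentIn
  have hxA : x ∈ A := mem_connectedComponentIn hxm
  have hfr : ∀ a ∈ frontier A, a ∉ W1 ∩ W2 := by
    intro a ha haW
    have haA : a ∉ A := fun h => by
      rw [hAo.frontier_eq] at ha; exact ha.2 h
    have : IsPreconnected (insert a A) :=
      isPreconnected_connectedComponentIn.subset_closure (subset_insert _ _)
        (insert_subset (frontier_subset_closure ha) subset_closure)
    exact haA (this.subset_connectedComponentIn (mem_insert_of_mem _ hxA)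
      (insert_subset haW (connectedComponentIn_subset _ _)) (mem_insert _ _))
  obtain ⟨φ, hφ0, hφ1, -⟩ := exists_continuous_zero_one_of_isClosed h1.isClosed_compl h2.isClosed_compl
    (by rw [disjoint_compl_left_iff_subset]; intro a ha; by_contra h
        rcases hU.ge (mem_univ a) with h' | h'
        exacts [h h', ha h'])
  have z1 : ((1:ℝ) : UnitAddCircle) = 0 := AddCircle.coe_period 1
  have z0 : ((0:ℝ) : UnitAddCircle) = 0 := rfl
  have hφ0' : ∀ a, a ∉ W1 → φ a = 0 := fun a h => hφ0 h
  have hφ1' : ∀ a, a ∉ W2 → φ a = 1 := fun a h => hφ1 h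
  obtain ⟨θ, hθ, hθe⟩ := hL (A.piecewise (fun w => ((φ w : ℝ) : UnitAddCircle)) (fun _ => 0))
    (by
      refine Continuous.piecewise (fun a ha => ?_) (by
        exact (AddCircle.continuous_mk' 1).comp φ.continuous) continuous_const
      have := hfr a ha
      by_cases h : a ∈ W1
      · rw [hφ1' a (fun h' => this ⟨h, h'⟩), z1]
      · rw [hφ0' a h, z0])
  have key : ∀ (c : ℝ) (V K : Set W), ((c : ℝ) : UnitAddCircle) = 0 → (∀ a ∈ V ∩ frontier A, φ a = c) →
      IsPreconnected K → K ⊆ V → x ∈ K → y ∈ K → θ x - φ x = θ y - c := by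
    intro c V K hc hV hK hKV hx hyK
    have := int_const (h := fun w => θ w - A.piecewise φ (fun _ => c) w) hK
      ((hθ.continuousOn).sub (ContinuousOn.mono (s := V) (ContinuousOn.piecewise hV φ.continuous.continuousOn
        continuousOn_const) hKV)) (fun w hw => ?_) hx hyK
    · simpa [hxA, hy] using this
    · push_cast [AddCircle.coe_sub]
      rw [hθe]
      by_cases h : w ∈ A <;> simp [h, hc]
  have e1 := key 1 W1 K1 z1 (fun a ha => hφ1' a (fun h => hfr a ha.2 ⟨ha.1, h⟩)) hK1 hs1 hx1 hy1
  have e2 := key 0 W2 K2 z0 (fun a ha => hφ0' a (fun h => hfr a ha.2 ⟨h, ha.1⟩)) hK2 hs2 hx2 hy2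
  linarith

theorem lift_vec {E : Type*} [NormedAddCommGroup E] [NormedSpace ℝ E] (g : E → UnitAddCircle) (hg : Continuous g) :
    ∃ θ : E → ℝ, Continuous θ ∧ ∀ w, (θ w : UnitAddCircle) = g w := by
  obtain ⟨e0, he0⟩ := QuotientAddGroup.mk_surjective (g 0)
  obtain ⟨F, ⟨-, hF⟩, -⟩ := (AddCircle.isCoveringMap_coe (1:ℝ)).existsUnique_continuousMap_lifts ⟨g, hg⟩ 0 e0 he0
  exact ⟨F, F.continuous, fun w => congrFun hF w⟩

theorem lift_sphere : HasLifts ↥Sphere2 := by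
  intro g hg
  have hf : Module.finrank ℝ (EuclideanSpace ℝ (Fin 3)) = 2 + 1 := by simp
  have aux : ∀ v : ↥Sphere2, ∃ θ : ↥Sphere2 → ℝ, ContinuousOn θ {v}ᶜ ∧ ∀ w ∈ ({v}ᶜ : Set ↥Sphere2),
      (θ w : UnitAddCircle) = g w := by
    intro v
    have hv : ‖(v : EuclideanSpace ℝ (Fin 3))‖ = 1 := by simp
    let s := stereographic hv
    have hsrc : s.source = {v}ᶜ := stereographic_source hv
    obtain ⟨θ, hθ, h⟩ := lift_vec (g ∘ s.symm) (hg.comp (continuous_stereoInvFun hv))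
    refine ⟨θ ∘ s, hθ.comp_continuousOn (hsrc ▸ s.continuousOn), fun w hw => ?_⟩
    simp only [Function.comp, h]
    rw [s.left_inv (hsrc ▸ hw)]
  have hn : ∃ N : ↥Sphere2, True := ⟨⟨EuclideanSpace.single 0 1, by simp⟩, trivial⟩
  obtain ⟨N, -⟩ := hn
  have hNS : -N ≠ N := by
    intro h; have := congrArg Subtype.val h
    have h1 : ‖(N : EuclideanSpace ℝ (Fin 3))‖ = 1 := by simp
    simp only [coe_neg_sphere] at this
    rw [neg_eq_iff_add_eq_zero, ← two_smul ℝ] at this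
    simp at this; simp [this] at h1
  obtain ⟨a, ha, hae⟩ := aux N
  obtain ⟨b, hb, hbe⟩ := aux (-N)
  have hpre : IsPreconnected (({N}ᶜ ∩ {-N}ᶜ : Set ↥Sphere2)) := by
    have hv : ‖(N : EuclideanSpace ℝ (Fin 3))‖ = 1 := by simp
    let s := stereographic hv
    have hsrc : s.source = {N}ᶜ := stereographic_source hv
    have hr : 1 < Module.rank ℝ (ℝ ∙ (N : EuclideanSpace ℝ (Fin 3)))ᗮ := by
      have h2 : Module.finrank ℝ (ℝ ∙ (N : EuclideanSpace ℝ (Fin 3)))ᗮ = 2 :=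
        have : Fact (Module.finrank ℝ (EuclideanSpace ℝ (Fin 3)) = 2 + 1) := ⟨hf⟩
        Submodule.finrank_orthogonal_span_singleton (by intro h; simp [h] at hv)
      rw [← Module.finrank_eq_rank, h2]; norm_num
    have hc := (isConnected_compl_singleton_of_one_lt_rank hr (s (-N))).isPreconnected.image s.symm
      ((continuous_stereoInvFun hv).continuousOn)
    convert hc using 1
    have hm : -N ∈ s.source := hsrc ▸ hNS
    ext w; constructor
    · rintro ⟨h1, h2⟩
      have h1' : w ∈ s.source := hsrc ▸ h1
      exact ⟨s w, fun h => h2 (s.injOn h1' hm h), s.left_inv h1'⟩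
    · rintro ⟨u, hu, rfl⟩
      have hu' : u ∈ s.target := by simp [s]
      refine ⟨by rw [← hsrc]; exact s.map_target hu', fun h => hu ?_⟩
      rw [mem_singleton_iff] at h ⊢
      rw [← h, s.right_inv hu']
  have hcst : ∃ n : ℝ, ((n : ℝ) : UnitAddCircle) = 0 ∧ ∀ w ∈ ({N}ᶜ ∩ {-N}ᶜ : Set ↥Sphere2), a w = b w + n := by
    have hi : ∀ w ∈ ({N}ᶜ ∩ {-N}ᶜ : Set ↥Sphere2), ((a w - b w : ℝ) : UnitAddCircle) = 0 := fun w hw => by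
      rw [AddCircle.coe_sub, hae w hw.1, hbe w hw.2, sub_self]
    by_cases hne : ({N}ᶜ ∩ {-N}ᶜ : Set ↥Sphere2).Nonempty
    · obtain ⟨w0, h0⟩ := hne
      refine ⟨a w0 - b w0, hi w0 h0, fun w hw => ?_⟩
      have := int_const hpre ((ha.mono inter_subset_left).sub (hb.mono inter_subset_right)) hi hw h0
      simp only [Pi.sub_apply] at this
      linarith
    · exact ⟨0, rfl, fun w hw => (hne ⟨w, hw⟩).elim⟩
  obtain ⟨n, hn0, hn⟩ := hcst
  classical
  refine ⟨fun w => if w = N then b w + n else a w, ?_, fun w => ?_⟩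
  · rw [continuous_iff_continuousAt]
    intro w
    by_cases hw : w = N
    · have hm : ({-N}ᶜ : Set ↥Sphere2) ∈ 𝓝 w := isOpen_compl_singleton.mem_nhds (by
        rw [hw]; exact fun h => hNS h.symm)
      refine ((hb.continuousAt hm).add (continuousAt_const (y := n))).congr ?_
      filter_upwards [hm] with z hz
      by_cases hz' : z = N
      · simp [hz']
      · simp only [hz', if_false]; exact (hn z ⟨hz', hz⟩).symm
    · have hm : ({N}ᶜ : Set ↥Sphere2) ∈ 𝓝 w := isOpen_compl_singleton.mem_nhds hw
      refine (ha.continuousAt hm).congr ?_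
      filter_upwards [hm] with z hz
      simp only [show z ≠ N from hz, if_false]
  · by_cases hw : w = N
    · simp only [hw, if_true]
      rw [AddCircle.coe_add, hn0, add_zero]; exact hbe N (fun h => hNS h.symm)
    · simp only [hw, if_false]; exact hae w hw

instance : LocallyConnectedSpace ↥Sphere2 := by
  have : Fact (Module.finrank ℝ (EuclideanSpace ℝ (Fin 3)) = 2 + 1) := ⟨by simp⟩
  exact ChartedSpace.locallyConnectedSpace (EuclideanSpace ℝ (Fin 2)) ↥Sphere2

/-- Janiszewski in a planar space. -/
theorem jan {X : Type*} [TopologicalSpace X]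
    (hhom : ∃ Ω₀ : Set ↥Sphere2, IsOpen Ω₀ ∧ Nonempty (X ≃ₜ ↥Ω₀)) {Z1 Z2 K1 K2 : Set X}
    (h1 : IsCompact Z1) (h2 : IsClosed Z2) (hd : Disjoint Z1 Z2)
    (hK1 : IsPreconnected K1) (hK2 : IsPreconnected K2) (hs1 : Disjoint K1 Z1) (hs2 : Disjoint K2 Z2)
    {x y : X} (hx1 : x ∈ K1) (hx2 : x ∈ K2) (hy1 : y ∈ K1) (hy2 : y ∈ K2) :
    ∃ K : Set X, IsPreconnected K ∧ x ∈ K ∧ y ∈ K ∧ Disjoint K (Z1 ∪ Z2) := by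
  obtain ⟨Ω, hΩ, ⟨ψ⟩⟩ := hhom
  let i : X → ↥Sphere2 := fun x => (ψ x : ↥Sphere2)
  have hi : IsOpenEmbedding i := hΩ.isOpenEmbedding_subtypeVal.comp ψ.isOpenEmbedding
  have hW2 : IsOpen (i '' Z2ᶜ) := hi.isOpenMap _ h2.isOpen_compl
  have hW1 : IsOpen (i '' Z1)ᶜ := (h1.image hi.continuous).isClosed.isOpen_compl
  have hdis : ∀ {K Z : Set X}, Disjoint K Z → K ⊆ Zᶜ := fun h => subset_compl_iff_disjoint_right.2 h
  have hj := janiszewski lift_sphere hW1 hW2 (by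
      rw [eq_univ_iff_forall]; intro w
      by_cases hw : w ∈ i '' Z1
      · right; exact image_mono (hdis hd) hw
      · left; exact hw)
    (hK1.image i hi.continuous.continuousOn) (hK2.image i hi.continuous.continuousOn)
    (by rintro _ ⟨k, hk, rfl⟩ ⟨z, hz, hzk⟩
        rw [hi.injective hzk] at hz; exact hdis hs1 hk hz)
    (image_mono (hdis hs2))
    (mem_image_of_mem i hx1) (mem_image_of_mem i hx2) (mem_image_of_mem i hy1) (mem_image_of_mem i hy2)
  set C := connectedComponentIn ((i '' Z1)ᶜ ∩ i '' Z2ᶜ) (i x)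
  have hCs : C ⊆ (i '' Z1)ᶜ ∩ i '' Z2ᶜ := connectedComponentIn_subset _ _
  have hx : i x ∈ C := mem_connectedComponentIn ⟨fun ⟨z, hz, hzk⟩ => by
    rw [hi.injective hzk] at hz; exact hdis hs1 hx1 hz, mem_image_of_mem i (hdis hs2 hx2)⟩
  refine ⟨i ⁻¹' C, isPreconnected_connectedComponentIn.preimage_of_isOpenMap hi.injective hi.isOpenMap
    (fun w hw => ?_), hx, hj, ?_⟩
  · obtain ⟨z, -, h⟩ := (hCs hw).2; exact ⟨z, h⟩
  · rw [Set.disjoint_left]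
    rintro w hw (h | h)
    · exact (hCs hw).1 ⟨w, h, rfl⟩
    · obtain ⟨z, hz, hzw⟩ := (hCs hw).2
      rw [hi.injective hzw] at hz; exact hz h

end

section
def chainClass {X : Type*} [MetricSpace X] (F : Set X) (σ : ℝ) (z : X) : Set X :=
  {w | Relation.ReflTransGen (fun a b => b ∈ F ∧ dist a b ≤ σ) z w}

section
variable {X : Type*} [MetricSpace X] {F : Set X} {σ : ℝ}

theorem chainClass_step {z w w' : X} (h : w ∈ chainClass F σ z) (hw : w' ∈ F) (hd : dist w w' ≤ σ) :
    w' ∈ chainClass F σ z := Relation.ReflTransGen.tail h ⟨hw, hd⟩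

theorem chainClass_sub {z : X} (hz : z ∈ F) : chainClass F σ z ⊆ F := by
  intro w hw
  induction hw with
  | refl => exact hz
  | tail _ h _ => exact h.1

theorem chainUnion_closed (hF : IsClosed F) (hσ : 0 < σ) {s : Set X} (hs : s ⊆ F) :
    IsClosed (⋃ z ∈ s, chainClass F σ z) := by
  refine isClosed_of_closure_subset fun w hw => ?_
  have hsub : (⋃ z ∈ s, chainClass F σ z) ⊆ F := iUnion₂_subset fun z hz => chainClass_sub (hs hz)
  obtain ⟨v, hv, hd⟩ := Metric.mem_closure_iff.1 hw σ hσ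
  simp only [mem_iUnion] at hv ⊢
  obtain ⟨z, hz, hv⟩ := hv
  exact ⟨z, hz, chainClass_step hv (closure_minimal hsub hF hw) (by rw [dist_comm]; exact hd.le)⟩

theorem chainUnion_diff_closed (hF : IsClosed F) (hσ : 0 < σ) (s : Set X) :
    IsClosed (F \ ⋃ z ∈ s, chainClass F σ z) := by
  refine isClosed_of_closure_subset fun w hw => ⟨closure_minimal sdiff_subset hF hw, fun h => ?_⟩
  obtain ⟨v, hv, hd⟩ := Metric.mem_closure_iff.1 hw σ hσ
  simp only [mem_iUnion] at h
  obtain ⟨z, hz, h⟩ := h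
  exact hv.2 (mem_iUnion₂.2 ⟨z, hz, chainClass_step h hv.1 hd.le⟩)

theorem lemmaS (hhom : ∃ Ω₀ : Set ↥Sphere2, IsOpen Ω₀ ∧ Nonempty (X ≃ₜ ↥Ω₀)) {V J : Set X} {x y : X}
    (hx : x ∈ interior V) (hy : y ∈ interior Vᶜ) (hJ : IsCompact J) (hJc : IsPreconnected J)
    (hxJ : x ∈ J) (hyJ : y ∈ J) (hσ : 0 < σ) :
    ∃ z ∈ J ∩ frontier V, ∀ K C : Set X, IsPreconnected K → x ∈ K → y ∈ K → IsCompact C →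
      chainClass (frontier V) σ z ⊆ C → (chainClass (frontier V) σ z ∩ K).Nonempty := by
  classical
  by_contra! hcon
  set F := frontier V
  have hF : IsClosed F := isClosed_frontier
  obtain ⟨t, ht, hcov⟩ := (hJ.inter_right hF).elim_nhds_subcover (fun z => ball z σ)
    (fun z _ => ball_mem_nhds z hσ)
  have main : ∀ s : Finset X, s ⊆ t → ∃ K : Set X, IsPreconnected K ∧ x ∈ K ∧ y ∈ K ∧
      Disjoint K ((F \ ⋃ z ∈ (t : Set X), chainClass F σ z) ∪ ⋃ z ∈ (s : Set X), chainClass F σ z) := by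
    intro s
    induction s using Finset.induction_on with
    | empty =>
      intro _
      refine ⟨J, hJc, hxJ, hyJ, ?_⟩
      rw [Set.disjoint_left]; intro w hw h
      simp only [Finset.coe_empty, mem_empty_iff_false, iUnion_of_empty, iUnion_empty, union_empty] at h
      refine h.2 ?_
      obtain ⟨z, hz, hwz⟩ := mem_iUnion₂.1 (hcov ⟨hw, h.1⟩)
      exact mem_iUnion₂.2 ⟨z, hz, chainClass_step Relation.ReflTransGen.refl h.1
        (by rw [dist_comm]; exact (mem_ball.1 hwz).le)⟩
    | insert a s ha ih =>
      intro hst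
      have hat : a ∈ t := hst (Finset.mem_insert_self _ _)
      have hst' : s ⊆ t := fun z hz => hst (Finset.mem_insert_of_mem hz)
      obtain ⟨K2, hK2, hx2, hy2, hd2⟩ := ih hst'
      obtain ⟨K1, C, hK1, hx1, hy1, hC, hsC, hd1⟩ := hcon a (ht a hat)
      set Us := ⋃ z ∈ (s : Set X), chainClass F σ z
      have hcl : IsClosed (chainClass F σ a) := by
        have := chainUnion_closed (σ := σ) hF hσ (s := {a}) (by simpa using (ht a hat).2)
        simpa using this
      obtain ⟨K, hK, hxK, hyK, hdK⟩ := jan hhom (Z1 := chainClass F σ a ∩ (F \ Us))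
        (Z2 := (F \ ⋃ z ∈ (t : Set X), chainClass F σ z) ∪ Us) (K1 := K1) (K2 := K2) (x := x) (y := y)
        ((hC.of_isClosed_subset hcl hsC).inter_right (chainUnion_diff_closed hF hσ _))
        ((chainUnion_diff_closed hF hσ _).union (chainUnion_closed hF hσ (fun z hz => (ht z (hst' hz)).2)))
        (by
          rw [Set.disjoint_left]; rintro w ⟨h1, h2⟩ (h3 | h3)
          · exact h3.2 (mem_iUnion₂.2 ⟨a, hat, h1⟩)
          · exact h2.2 h3) hK1 hK2
        (by rw [Set.disjoint_left]; intro w h1 h2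
            exact (Set.eq_empty_iff_forall_notMem.1 hd1 w) ⟨h2.1, h1⟩)
        hd2 hx1 hx2 hy1 hy2
      refine ⟨K, hK, hxK, hyK, hdK.mono_right ?_⟩
      rintro w (h | h)
      · exact Or.inr (Or.inl h)
      · rw [Finset.coe_insert, biUnion_insert] at h
        by_cases hw : w ∈ Us
        · exact Or.inr (Or.inr hw)
        · rcases h with h | h
          · exact Or.inl ⟨h, chainClass_sub (ht a hat).2 h, hw⟩
          · exact (hw h).elim
  obtain ⟨K, hK, hxK, hyK, hd⟩ := main t subset_rfl
  have hne : (K ∩ F).Nonempty := by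
    by_contra hne
    obtain ⟨w, -, h1, h2⟩ := hK (interior V) (interior Vᶜ) isOpen_interior isOpen_interior (by
      rw [← compl_frontier_eq_union_interior]
      exact fun w hw h => hne ⟨w, hw, h⟩) ⟨x, hxK, hx⟩ ⟨y, hyK, hy⟩
    exact interior_subset h2 (interior_subset h1)
  obtain ⟨w, hwK, hwF⟩ := hne
  refine Set.disjoint_left.1 hd hwK ?_
  by_cases h : w ∈ ⋃ z ∈ (t : Set X), chainClass F σ z
  exacts [Or.inr h, Or.inl ⟨hwF, h⟩]
end

end

section
set_option linter.unusedSectionVars false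
set_option linter.unusedSimpArgs false

section
variable {X : Type*} [MetricSpace X] [MeasurableSpace X]

def fr (μ : Measure X) (x y : X) : ℝ := √(μ.real (pairBall x y))
def mb (μ : Measure X) (x : X) (r : ℝ) : ℝ := μ.real (ball x r)
def qd (μ : Measure X) (δ : ℝ) (x y : X) : ℝ := (qDelta μ 2 δ x y).toReal

structure Hyp (μ : Measure X) (lam CD CW : ℝ) (Q : X → X → ℝ) : Prop where
  bor : BorelSpace X
  fin : IsFiniteMeasure μ
  hlam : 1 ≤ lam
  llc : IsLLC X lam
  hom : ∃ Ω₀ : Set ↥Sphere2, IsOpen Ω₀ ∧ Nonempty (X ≃ₜ ↥Ω₀)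
  lc : LocallyCompactSpace X
  conn : PreconnectedSpace X
  nontriv : Nontrivial X
  sc : SecondCountableTopology X
  pos : ∀ x r, 0 < r → 0 < mb μ x r
  dbl : ∀ x r, 0 < r → mb μ x (2 * r) ≤ CD * mb μ x r
  qsymm : ∀ x y, Q x y = Q y x
  qtri : ∀ x y z, Q x z ≤ Q x y + Q y z
  qzero : ∀ x y, Q x y = 0 ↔ x = y
  qfin : ∀ δ > 0, ∀ x y, qDelta μ 2 δ x y ≠ ⊤
  qle : ∀ δ > 0, ∀ x y, qd μ δ x y ≤ Q x y
  qsup : ∀ x y c, c < Q x y → ∃ δ > 0, c < qd μ δ x y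
  wm : ∀ x y, fr μ x y ≤ CW * Q x y

theorem pairBall_comm (x y : X) : pairBall x y = pairBall y x := by
  simp only [pairBall, dist_comm x y, union_comm]

theorem fr_comm (μ : Measure X) (x y : X) : fr μ x y = fr μ y x := by rw [fr, pairBall_comm, fr]
theorem fr_nonneg (μ : Measure X) (x y : X) : 0 ≤ fr μ x y := Real.sqrt_nonneg _
theorem fr_self (μ : Measure X) (x : X) : fr μ x x = 0 := by simp [fr, pairBall]
theorem qd_nonneg (μ : Measure X) (δ : ℝ) (x y : X) : 0 ≤ qd μ δ x y := toReal_nonneg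
theorem mb_nonneg (μ : Measure X) (x : X) (r : ℝ) : 0 ≤ mb μ x r := measureReal_nonneg

theorem frE {μ : Measure X} [IsFiniteMeasure μ] (x y : X) :
    μ (pairBall x y) ^ (1 / (2:ℝ)) = ENNReal.ofReal (fr μ x y) := by
  rw [fr, Real.sqrt_eq_rpow, ← ENNReal.ofReal_rpow_of_nonneg measureReal_nonneg (by norm_num),
    ofReal_measureReal]

theorem IsDeltaChain.symm {δ : ℝ} {x y : X} {z : ℕ → X} {m : ℕ} (h : IsDeltaChain δ x y z m) :
    IsDeltaChain δ y x (fun j => z (m - j)) m := by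
  refine ⟨by simpa using h.2.1, by simpa using h.1, fun j hj => ?_⟩
  have := h.2.2 (m - (j + 1)) (by omega)
  rw [show m - (j + 1) + 1 = m - j by omega] at this
  rwa [dist_comm]

theorem qDelta_le_sum (μ : Measure X) {δ : ℝ} {x y : X} {z : ℕ → X} {m : ℕ} (h : IsDeltaChain δ x y z m) :
    qDelta μ 2 δ x y ≤ ∑ j ∈ Finset.range m, μ (pairBall (z j) (z (j + 1))) ^ (1 / (2:ℝ)) :=
  (iInf_le _ m).trans ((iInf_le _ z).trans (iInf_le _ h))

theorem qDelta_le_symm (μ : Measure X) (δ : ℝ) (x y : X) : qDelta μ 2 δ y x ≤ qDelta μ 2 δ x y := by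
  refine le_iInf fun m => le_iInf fun z => le_iInf fun h => ?_
  refine (qDelta_le_sum μ h.symm).trans (le_of_eq ?_)
  rw [← Finset.sum_range_reflect]
  refine Finset.sum_congr rfl fun j hj => ?_
  have := Finset.mem_range.1 hj
  rw [show m - (m - 1 - j) = j + 1 by omega, show m - (m - 1 - j + 1) = j by omega, pairBall_comm]

theorem qd_comm (μ : Measure X) (δ : ℝ) (x y : X) : qd μ δ x y = qd μ δ y x := by
  rw [qd, qd, le_antisymm (qDelta_le_symm μ δ y x) (qDelta_le_symm μ δ x y)]

theorem qDelta_tri (μ : Measure X) (δ : ℝ) (x y w : X) :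
    qDelta μ 2 δ x w ≤ qDelta μ 2 δ x y + qDelta μ 2 δ y w := by
  rw [qDelta.eq_1 μ 2 δ x y, qDelta.eq_1 μ 2 δ y w]
  simp only [ENNReal.iInf_add, ENNReal.add_iInf]
  refine le_iInf fun n => le_iInf fun v => le_iInf fun k => le_iInf fun m => le_iInf fun z => le_iInf fun h => ?_
  refine (qDelta_le_sum μ (z := fun j => if j < m then z j else v (j - m)) (m := m + n) ⟨?_, ?_, ?_⟩).trans
    (le_of_eq ?_)
  · by_cases hm : 0 < m
    · simp [hm, h.1]
    · have : m = 0 := by omega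
      subst this; simp [k.1, h.1.symm.trans h.2.1]
  · simp [k.2.1]
  · intro j hj
    rcases lt_trichotomy (j + 1) m with h1 | h1 | h1
    · simp only [h1, show j < m by omega, if_true]; exact h.2.2 j (by omega)
    · beta_reduce
      rw [if_pos (by omega), if_neg (by omega), show j + 1 - m = 0 by omega, k.1, ← h.2.1, ← h1]
      exact h.2.2 j (by omega)
    · simp only [show ¬ j < m by omega, show ¬ (j + 1 < m) by omega, if_false]
      rw [show j + 1 - m = (j - m) + 1 by omega]; exact k.2.2 _ (by omega)
  · rw [Finset.sum_range_add]
    congr 1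
    · refine Finset.sum_congr rfl fun j hj => ?_
      have hj := Finset.mem_range.1 hj
      by_cases h1 : j + 1 < m
      · simp only [hj, h1, if_true]
      · simp only [hj, h1, if_true, if_false]
        have : j + 1 = m := by omega
        rw [this, Nat.sub_self, k.1, h.2.1]
    · refine Finset.sum_congr rfl fun j hj => ?_
      simp only [show ¬ m + j < m by omega, show ¬ m + j + 1 < m by omega, if_false]
      rw [show m + j - m = j by omega, show m + j + 1 - m = j + 1 by omega]

theorem qDelta_anti (μ : Measure X) {δ δ' : ℝ} (h : δ ≤ δ') (x y : X) : qDelta μ 2 δ' x y ≤ qDelta μ 2 δ x y := by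
  refine le_iInf fun m => le_iInf fun z => le_iInf fun hz => ?_
  exact qDelta_le_sum μ ⟨hz.1, hz.2.1, fun j hj => (hz.2.2 j hj).trans h⟩

namespace Hyp
variable {μ : Measure X} {lam CD CW : ℝ} {Q : X → X → ℝ} (H : Hyp μ lam CD CW Q)
include H

theorem qd_tri {δ : ℝ} (hδ : 0 < δ) (x y w : X) : qd μ δ x w ≤ qd μ δ x y + qd μ δ y w := by
  rw [qd, qd, qd, ← toReal_add (H.qfin δ hδ _ _) (H.qfin δ hδ _ _)]
  exact toReal_mono (add_ne_top.2 ⟨H.qfin δ hδ _ _, H.qfin δ hδ _ _⟩) (qDelta_tri μ δ x y w)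

theorem qd_anti {δ δ' : ℝ} (hδ : 0 < δ) (h : δ ≤ δ') (x y : X) : qd μ δ' x y ≤ qd μ δ x y :=
  toReal_mono (H.qfin δ hδ _ _) (qDelta_anti μ h x y)

theorem qd_le_sum {δ : ℝ} {x y : X} {z : ℕ → X} {m : ℕ} (h : IsDeltaChain δ x y z m) :
    qd μ δ x y ≤ ∑ j ∈ Finset.range m, fr μ (z j) (z (j + 1)) := by
  have := H.fin
  refine toReal_le_of_le_ofReal (Finset.sum_nonneg fun j _ => fr_nonneg _ _ _) ?_
  rw [ofReal_sum_of_nonneg fun j _ => fr_nonneg _ _ _]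
  refine (qDelta_le_sum μ h).trans (le_of_eq ?_)
  exact Finset.sum_congr rfl fun j _ => frE _ _

theorem qd_le_fr {δ : ℝ} {x y : X} (h : dist x y ≤ δ) : qd μ δ x y ≤ fr μ x y := by
  have := H.qd_le_sum (x := x) (y := y) (δ := δ) (z := fun j => if j = 0 then x else y) (m := 1)
    ⟨by simp, by simp, fun j hj => by simp_all⟩
  simpa using this

theorem qd_self {δ : ℝ} (hδ : 0 < δ) (x : X) : qd μ δ x x = 0 :=
  le_antisymm ((H.qd_le_fr (by simpa using hδ.le)).trans (fr_self μ x).le) (qd_nonneg _ _ _ _)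

theorem exists_chain {δ c : ℝ} (hδ : 0 < δ) {x y : X} (h : qd μ δ x y < c) :
    ∃ z m, IsDeltaChain δ x y z m ∧ ∑ j ∈ Finset.range m, fr μ (z j) (z (j + 1)) < c := by
  have := H.fin
  have hc : 0 < c := (qd_nonneg _ _ _ _).trans_lt h
  have : qDelta μ 2 δ x y < ENNReal.ofReal c := (lt_ofReal_iff_toReal_lt (H.qfin δ hδ _ _)).2 h
  simp only [qDelta, iInf_lt_iff] at this
  obtain ⟨m, z, hz, hs⟩ := this
  refine ⟨z, m, hz, ?_⟩
  rw [Finset.sum_congr rfl fun j _ => frE (z j) (z (j + 1)), ← ofReal_sum_of_nonneg fun j _ => fr_nonneg _ _ _] at hs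
  exact (ofReal_lt_ofReal_iff hc).1 hs

theorem qd_lip {δ : ℝ} (hδ : 0 < δ) {a b : X} (h : dist a b ≤ δ) (x : X) :
    |qd μ δ x a - qd μ δ x b| ≤ fr μ a b := by
  have h1 := H.qd_tri hδ x a b
  have h2 := H.qd_tri hδ x b a
  have h3 := H.qd_le_fr h
  have h4 := H.qd_le_fr (x := b) (y := a) (δ := δ) (by rwa [dist_comm])
  rw [fr_comm] at h4
  rw [abs_le]; constructor <;> linarith

theorem qnn (x y : X) : 0 ≤ Q x y := (qd_nonneg μ 1 x y).trans (H.qle 1 one_pos x y)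

theorem mb_mono (x : X) {r s : ℝ} (h : r ≤ s) : mb μ x r ≤ mb μ x s :=
  have := H.fin
  measureReal_mono (ball_subset_ball h)

theorem mb_le {x y : X} {r s : ℝ} (h : r + dist x y ≤ s) : mb μ x r ≤ mb μ y s :=
  have := H.fin
  measureReal_mono (ball_subset_ball' h)

theorem CD_pos : 0 < CD := by
  obtain ⟨x⟩ : Nonempty X := H.nontriv.to_nonempty
  have h1 := H.dbl x 1 one_pos
  have h2 := H.pos x 1 one_pos
  have h3 := H.pos x (2*1) (by norm_num)
  by_contra h
  nlinarith

theorem dbl_pow (x : X) {r : ℝ} (hr : 0 < r) (n : ℕ) : mb μ x (2 ^ n * r) ≤ CD ^ n * mb μ x r := by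
  induction n with
  | zero => simp
  | succ n ih =>
    rw [pow_succ, pow_succ, mul_comm (2 ^ n) 2, mul_assoc]
    refine (H.dbl x _ (by positivity)).trans ?_
    nlinarith [H.CD_pos]

theorem mb_le_pow {x y : X} {r s : ℝ} (hs : 0 < s) (n : ℕ) (h : r + dist x y ≤ 2 ^ n * s) :
    mb μ x r ≤ CD ^ n * mb μ y s := (H.mb_le h).trans (H.dbl_pow y hs n)

theorem fr_sq_le (x y : X) : fr μ x y ^ 2 ≤ CD * mb μ x (dist x y) := by
  have := H.fin
  rw [fr, Real.sq_sqrt measureReal_nonneg]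
  rcases (dist_nonneg (x := x) (y := y)).eq_or_lt with h | h
  · simp [pairBall, ← h, mb]
  · refine (measureReal_mono ?_).trans (H.dbl x _ h)
    refine union_subset (ball_subset_ball (by linarith)) (ball_subset_ball' (by rw [dist_comm y x]; linarith))

theorem mb_le_fr (x y : X) : mb μ x (dist x y) ≤ fr μ x y ^ 2 := by
  have := H.fin
  rw [fr, Real.sq_sqrt measureReal_nonneg]
  exact measureReal_mono subset_union_left

theorem CD_one : 1 ≤ CD := by
  obtain ⟨x⟩ : Nonempty X := H.nontriv.to_nonempty
  have h1 := H.dbl x 1 one_pos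
  have h2 := H.pos x 1 one_pos
  have h3 := H.mb_mono x (show (1:ℝ) ≤ 2 * 1 by norm_num)
  by_contra h
  nlinarith

theorem fr_sq_le_of {x y : X} {r : ℝ} (hr : dist x y ≤ r) : fr μ x y ^ 2 ≤ CD * mb μ x r :=
  (H.fr_sq_le x y).trans (mul_le_mul_of_nonneg_left (H.mb_mono x hr) H.CD_pos.le)

theorem exists_dist {x y : X} {r : ℝ} (h0 : 0 ≤ r) (h : r ≤ dist x y) : ∃ z, dist x z = r := by
  have := H.conn
  obtain ⟨z, -, hz⟩ := isPreconnected_univ.intermediate_value (mem_univ x) (mem_univ y)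
    (f := fun z => dist x z) (by fun_prop) ⟨by simpa using h0, h⟩
  exact ⟨z, hz⟩

theorem rev_dbl {x y : X} {r : ℝ} (hr : 0 < r) (h : 3 / 2 * r ≤ dist x y) :
    mb μ x r ≤ (1 - 1 / CD ^ 3) * mb μ x (2 * r) := by
  have := H.fin
  have := H.bor
  obtain ⟨z, hz⟩ := H.exists_dist (by positivity) h
  have h1 : mb μ x r + mb μ z (r / 2) ≤ mb μ x (2 * r) := by
    rw [mb, mb, ← measureReal_union ?_ measurableSet_ball]
    · refine measureReal_mono (union_subset (ball_subset_ball (by linarith)) (ball_subset_ball' ?_))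
      rw [dist_comm z x, hz]; linarith
    · exact ball_disjoint_ball (by rw [hz]; linarith)
  have h2 := H.mb_le_pow (x := x) (y := z) (r := 2 * r) (s := r / 2) (by positivity) 3 (by rw [hz]; linarith)
  have h3 := H.CD_pos
  have h4 : mb μ x (2 * r) / CD ^ 3 ≤ mb μ z (r / 2) := by rw [div_le_iff₀ (by positivity)]; linarith
  have : (1 - 1 / CD ^ 3) * mb μ x (2 * r) = mb μ x (2 * r) - mb μ x (2 * r) / CD ^ 3 := by ring
  linarith

theorem CD_four : 2 ≤ CD ^ 4 := by
  obtain ⟨x, y, hxy⟩ := H.nontriv.exists_pair_ne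
  have hd : 0 < dist x y := dist_pos.2 hxy
  have h1 := H.rev_dbl (x := x) (y := y) (r := dist x y / 2) (by positivity) (by linarith)
  have h2 := H.dbl x (dist x y / 2) (by positivity)
  have h3 := H.pos x (dist x y / 2) (by positivity)
  have h4 := H.CD_one
  have h5 : 1 ≤ (1 - 1 / CD ^ 3) * CD := by
    have h7 : (1 : ℝ) ≤ CD ^ 3 := one_le_pow₀ h4
    have h6 : 0 ≤ 1 - 1 / CD ^ 3 := by rw [sub_nonneg, div_le_one (by positivity)]; exact h7
    have := mul_le_mul_of_nonneg_left h2 h6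
    by_contra hc
    nlinarith
  have h7 : (1 : ℝ) ≤ CD ^ 3 := one_le_pow₀ h4
  have : (1 - 1 / CD ^ 3) * CD * CD ^ 3 = CD ^ 4 - CD := by field_simp
  nlinarith

theorem exists_far : ∃ D0 > 0, ∀ x : X, ∃ y, D0 ≤ dist x y := by
  obtain ⟨a, b, hab⟩ := H.nontriv.exists_pair_ne
  refine ⟨dist a b / 2, by have := dist_pos.2 hab; positivity, fun x => ?_⟩
  by_contra! h
  have := dist_triangle_left a b x
  linarith [h a, h b]

theorem mb_tendsto (x : X) : Tendsto (fun r => mb μ x r) (𝓝[>] 0) (𝓝 0) := by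
  have := H.fin
  obtain ⟨D0, hD0, hfar⟩ := H.exists_far
  obtain ⟨y, hy⟩ := hfar x
  set κ := 1 - 1 / CD ^ 3
  have hk0 : 0 ≤ κ := by
    have h7 : (1 : ℝ) ≤ CD ^ 3 := one_le_pow₀ H.CD_one
    rw [sub_nonneg, div_le_one (by positivity)]; exact h7
  have hk1 : κ < 1 := by have := H.CD_pos; simp only [κ]; linarith [show 0 < 1 / CD ^ 3 by positivity]
  have hpow : ∀ n : ℕ, mb μ x (D0 / 2 / 2 ^ n) ≤ κ ^ n * mb μ x (D0 / 2) := by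
    intro n
    induction n with
    | zero => simp
    | succ n ih =>
      have h1 := H.rev_dbl (x := x) (y := y) (r := D0 / 2 / 2 ^ (n + 1)) (by positivity) (by
        refine le_trans ?_ hy
        have : D0 / 2 / 2 ^ (n + 1) ≤ D0 / 2 := div_le_self (by positivity) (one_le_pow₀ (by norm_num))
        linarith)
      rw [show 2 * (D0 / 2 / 2 ^ (n + 1)) = D0 / 2 / 2 ^ n by rw [pow_succ]; field_simp] at h1
      rw [pow_succ' κ]
      calc _ ≤ _ := h1
        _ ≤ κ * (κ ^ n * mb μ x (D0 / 2)) := mul_le_mul_of_nonneg_left ih hk0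
        _ = _ := by ring
  have ht : Tendsto (fun n : ℕ => κ ^ n * mb μ x (D0 / 2)) atTop (𝓝 0) := by
    simpa using (tendsto_pow_atTop_nhds_zero_of_lt_one hk0 hk1).mul_const (mb μ x (D0 / 2))
  rw [Metric.tendsto_nhdsWithin_nhds]
  intro ε hε
  obtain ⟨n, hn⟩ := (ht.eventually (gt_mem_nhds hε)).exists
  refine ⟨D0 / 2 / 2 ^ n, by positivity, fun r hr hd => ?_⟩
  rw [Real.dist_eq, sub_zero, abs_of_nonneg (mb_nonneg _ _ _)]
  rw [Real.dist_eq, sub_zero, abs_of_pos hr] at hd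
  exact ((H.mb_mono x hd.le).trans (hpow n)).trans_lt hn

theorem exists_mb_lt (x : X) {ε : ℝ} (hε : 0 < ε) : ∃ r > 0, mb μ x r < ε := by
  obtain ⟨r, hr, h⟩ := (((H.mb_tendsto x).eventually (gt_mem_nhds hε)).and self_mem_nhdsWithin).exists
  exact ⟨r, h, hr⟩

end Hyp
end

end

section
set_option linter.unusedSectionVars false

theorem exists_net {X : Type*} [MetricSpace X] {K : Set X} (hK : IsCompact K) {r : ℝ} (hr : 0 < r) :
    ∃ s : Finset X, ↑s ⊆ K ∧ (∀ a ∈ K, ∃ x ∈ s, dist a x < r) ∧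
      (s : Set X).Pairwise fun x y => r / 2 ≤ dist x y := by
  classical
  obtain ⟨t, ht, hcov⟩ := hK.elim_nhds_subcover (fun z => Metric.ball z (r / 2))
    (fun z _ => ball_mem_nhds z (by positivity))
  have : ∀ t : Finset X, ∃ s ⊆ t, (∀ a ∈ t, ∃ x ∈ s, dist a x < r / 2) ∧
      (s : Set X).Pairwise fun x y => r / 2 ≤ dist x y := by
    intro t
    induction t using Finset.induction_on with
    | empty => exact ⟨∅, subset_rfl, by simp, by simp⟩
    | insert a t _ ih =>
      obtain ⟨s, hs, h1, h2⟩ := ih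
      by_cases h : ∃ x ∈ s, dist a x < r / 2
      · exact ⟨s, hs.trans (Finset.subset_insert _ _), by simpa [h] using h1, h2⟩
      · push Not at h
        refine ⟨insert a s, Finset.insert_subset_insert _ hs, ?_, ?_⟩
        · intro b hb
          rcases Finset.mem_insert.1 hb with rfl | hb
          · exact ⟨b, by simp, by simpa using hr⟩
          · obtain ⟨x, hx, hd⟩ := h1 b hb
            exact ⟨x, by simp [hx], hd⟩
        · rw [Finset.coe_insert]
          refine h2.insert fun b hb _ => ⟨h b hb, by rw [dist_comm]; exact h b hb⟩
  obtain ⟨s, hs, h1, h2⟩ := this t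
  refine ⟨s, fun x hx => ht x (hs hx), fun a ha => ?_, h2⟩
  obtain ⟨b, hb, hab⟩ := mem_iUnion₂.1 (hcov ha)
  obtain ⟨x, hx, hd⟩ := h1 b hb
  exact ⟨x, hx, by linarith [dist_triangle a b x, mem_ball.1 hab]⟩

namespace Hyp
variable {X : Type*} [MetricSpace X] [MeasurableSpace X]
variable {μ : Measure X} {lam CD CW : ℝ} {Q : X → X → ℝ} (H : Hyp μ lam CD CW Q)
include H

theorem net_sum {N : Set X} {r : ℝ} (hr : 0 < r) {s : Finset X}
    (hN : ∀ x ∈ s, ball x r ⊆ N) (hs : (s : Set X).Pairwise fun x y => r / 2 ≤ dist x y) :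
    ∑ x ∈ s, mb μ x r ≤ CD ^ 2 * μ.real N := by
  have := H.fin
  have := H.bor
  calc ∑ x ∈ s, mb μ x r ≤ ∑ x ∈ s, CD ^ 2 * mb μ x (r / 4) := Finset.sum_le_sum fun x _ => by
        simpa [show (2:ℝ) ^ 2 * (r / 4) = r by ring] using H.dbl_pow x (r := r / 4) (by positivity) 2
    _ = CD ^ 2 * μ.real (⋃ x ∈ s, Metric.ball x (r / 4)) := by
        rw [← Finset.mul_sum, measureReal_biUnion_finset ?_ (fun _ _ => measurableSet_ball)]
        · rfl
        · intro x hx y hy hxy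
          exact ball_disjoint_ball (by linarith [hs hx hy hxy])
    _ ≤ _ := by
        gcongr
        · exact (measure_ne_top μ N)
        · exact iUnion₂_subset fun x hx => (ball_subset_ball (by linarith)).trans (hN x hx)

theorem fr_le_of {x y : X} {r : ℝ} (n : ℕ) (hr : 0 < r) (h : dist x y ≤ 2 ^ n * r) :
    fr μ x y ≤ √(CD ^ (n + 1) * mb μ x r) := by
  refine Real.le_sqrt_of_sq_le ((H.fr_sq_le_of h).trans ?_)
  rw [pow_succ', mul_assoc]
  exact mul_le_mul_of_nonneg_left (H.dbl_pow x hr n) H.CD_pos.le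

theorem coarea {Kc N : Set X} (hK : IsCompact Kc) {δ : ℝ} (hδ : 0 < δ) (hN : ∀ x ∈ Kc, ball x δ ⊆ N)
    {u : X → ℝ} (hu : ∀ a b, dist a b ≤ δ → |u a - u b| ≤ fr μ a b) {l t0 t1 : ℝ} (hl : 0 ≤ l)
    (h : ∀ t ∈ Ioo t0 t1, ∃ (n : ℕ) (z : ℕ → X), (∀ j ≤ n, z j ∈ frontier {a | u a ≤ t} ∧ z j ∈ Kc) ∧
      (∀ j < n, dist (z j) (z (j + 1)) ≤ δ / 4) ∧ l ≤ qd μ δ (z 0) (z n)) :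
    l * (t1 - t0) ≤ 4 * CD ^ 4 * μ.real N := by
  classical
  have := H.fin
  have hCD := H.CD_one
  rcases le_total t1 t0 with h01 | h01
  · have : 0 ≤ 4 * CD ^ 4 * μ.real N := by positivity
    nlinarith
  set d := δ / 4 with hd
  have hd0 : 0 < d := by positivity
  obtain ⟨s, hsK, hcov, hsep⟩ := exists_net hK hd0
  set w : X → ℝ := fun x => √(CD ^ 2 * mb μ x d) with hw
  have hw0 : ∀ x, 0 ≤ w x := fun x => Real.sqrt_nonneg _
  have hfr : ∀ x b, dist x b ≤ 2 * d → fr μ x b ≤ w x := fun x b hb => by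
    simpa using H.fr_le_of 1 hd0 (by simpa using hb)
  have step : ∀ t ∈ Ioo t0 t1, l ≤ ∑ x ∈ s, indicator (Icc (u x - w x) (u x + w x)) (fun _ => 2 * w x) t := by
    intro t ht
    obtain ⟨n, z, hz, hzd, hlz⟩ := h t ht
    set φ := fun a => qd μ δ (z 0) a
    have hφ : ∀ x b, dist x b ≤ 2 * d → |φ x - φ b| ≤ w x := fun x b hb =>
      (H.qd_lip hδ (by linarith) _).trans (hfr x b hb)
    have hux : ∀ x b, dist x b ≤ 2 * d → |u x - u b| ≤ w x := fun x b hb =>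
      (hu x b (by linarith)).trans (hfr x b hb)
    set S := s.filter (fun x => t ∈ Icc (u x - w x) (u x + w x))
    have hcovz : ∀ j ≤ n, ∃ x ∈ S, dist (z j) x < d := by
      intro j hj
      obtain ⟨x, hx, hxz⟩ := hcov (z j) (hz j hj).2
      refine ⟨x, Finset.mem_filter.2 ⟨hx, ?_⟩, hxz⟩
      have hfz := (hz j hj).1
      have hnb : ball x d ∈ 𝓝 (z j) := isOpen_ball.mem_nhds hxz
      rw [frontier_eq_closure_inter_closure] at hfz
      obtain ⟨a, haB, ha⟩ := mem_closure_iff_nhds.1 hfz.1 _ hnb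
      obtain ⟨b, hbB, hb⟩ := mem_closure_iff_nhds.1 hfz.2 _ hnb
      have h1 := abs_le.1 (hux x a (by rw [dist_comm]; linarith [mem_ball.1 haB]))
      have h2 := abs_le.1 (hux x b (by rw [dist_comm]; linarith [mem_ball.1 hbB]))
      simp only [mem_ofPred_eq, mem_compl_iff, not_le] at ha hb
      constructor <;> linarith
    have hsub : Icc 0 (φ (z n)) ⊆ ⋃ x ∈ S, Icc (φ x - w x) (φ x + w x) := by
      intro c hc
      have hex : ∃ j, j ≤ n ∧ c ≤ φ (z j) := ⟨n, le_rfl, hc.2⟩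
      obtain ⟨hjn, hj⟩ := Nat.find_spec hex
      set j := Nat.find hex
      rcases Nat.eq_zero_or_pos j with h0 | h0
      · obtain ⟨x, hx, hxz⟩ := hcovz 0 (Nat.zero_le _)
        have hc0 : c = φ (z 0) := le_antisymm (h0 ▸ hj) (by
          simp only [φ, H.qd_self hδ]; exact hc.1)
        have := abs_le.1 (hφ x (z 0) (by rw [dist_comm]; linarith))
        exact mem_iUnion₂.2 ⟨x, hx, by constructor <;> linarith⟩
      · have hm := Nat.find_min hex (show j - 1 < j by omega)
        push Not at hm
        have hm := hm (by omega)
        obtain ⟨x, hx, hxz⟩ := hcovz (j - 1) (by omega)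
        have e1 := abs_le.1 (hφ x (z (j - 1)) (by rw [dist_comm]; linarith))
        have e2 := abs_le.1 (hφ x (z j) (by
          have := hzd (j - 1) (by omega)
          rw [show j - 1 + 1 = j by omega] at this
          linarith [dist_triangle_left x (z j) (z (j - 1))]))
        exact mem_iUnion₂.2 ⟨x, hx, by constructor <;> linarith⟩
    have hvol : ENNReal.ofReal (φ (z n)) ≤ ENNReal.ofReal (∑ x ∈ S, 2 * w x) := by
      have h1 := (measure_mono (μ := volume) hsub).trans (measure_biUnion_finset_le _ _)
      rw [Real.volume_Icc, sub_zero] at h1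
      refine h1.trans (le_of_eq ?_)
      rw [ofReal_sum_of_nonneg fun x _ => by have := hw0 x; positivity]
      refine Finset.sum_congr rfl fun x _ => ?_
      rw [Real.volume_Icc]; congr 1; ring
    have h2 := (ofReal_le_ofReal_iff (Finset.sum_nonneg fun x _ => by have := hw0 x; positivity)).1 hvol
    refine hlz.trans (h2.trans (le_of_eq ?_))
    rw [Finset.sum_filter]
    refine Finset.sum_congr rfl fun x _ => ?_
    rw [indicator_apply]
  have hint : ENNReal.ofReal (l * (t1 - t0)) ≤ ENNReal.ofReal (∑ x ∈ s, (2 * w x) * (2 * w x)) := by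
    calc ENNReal.ofReal (l * (t1 - t0)) = ∫⁻ t in Ioo t0 t1, ENNReal.ofReal l := by
          rw [setLIntegral_const, Real.volume_Ioo, ofReal_mul hl]
      _ ≤ ∫⁻ t in Ioo t0 t1, ∑ x ∈ s, indicator (Icc (u x - w x) (u x + w x))
            (fun _ => ENNReal.ofReal (2 * w x)) t := by
          refine setLIntegral_mono' measurableSet_Ioo fun t ht => ?_
          refine (ofReal_le_ofReal (step t ht)).trans ?_
          rw [ofReal_sum_of_nonneg fun x _ => indicator_nonneg (fun _ _ => by have := hw0 x; positivity) _]
          refine Finset.sum_le_sum fun x _ => ?_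
          by_cases hx : t ∈ Icc (u x - w x) (u x + w x)
          · rw [indicator_of_mem hx, indicator_of_mem hx]
          · rw [indicator_of_notMem hx, indicator_of_notMem hx]; simp
      _ ≤ ∫⁻ t, ∑ x ∈ s, indicator (Icc (u x - w x) (u x + w x))
            (fun _ => ENNReal.ofReal (2 * w x)) t := setLIntegral_le_lintegral _ _
      _ = ∑ x ∈ s, ENNReal.ofReal ((2 * w x) * (2 * w x)) := by
          rw [lintegral_finsetSum _ fun x _ => measurable_const.indicator measurableSet_Icc]
          refine Finset.sum_congr rfl fun x _ => ?_
          rw [lintegral_indicator_const measurableSet_Icc, Real.volume_Icc,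
            ← ofReal_mul (by have := hw0 x; positivity)]
          congr 1; ring
      _ = _ := by rw [ofReal_sum_of_nonneg fun x _ => by have := hw0 x; positivity]
  have h3 := (ofReal_le_ofReal_iff (Finset.sum_nonneg fun x _ => by have := hw0 x; positivity)).1 hint
  refine h3.trans ?_
  have h4 := H.net_sum (N := N) hd0 (fun x hx => (ball_subset_ball (by linarith)).trans (hN x (hsK hx))) hsep
  calc ∑ x ∈ s, (2 * w x) * (2 * w x) = 4 * CD ^ 2 * ∑ x ∈ s, mb μ x d := by
        rw [Finset.mul_sum]
        refine Finset.sum_congr rfl fun x _ => ?_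
        have := Real.mul_self_sqrt (show 0 ≤ CD ^ 2 * mb μ x d by have := mb_nonneg μ x d; positivity)
        simp only [hw]; linarith
    _ ≤ 4 * CD ^ 2 * (CD ^ 2 * μ.real N) := by gcongr
    _ = _ := by ring
end Hyp

end

section
set_option linter.unusedSectionVars false

namespace Hyp
variable {X : Type*} [MetricSpace X] [MeasurableSpace X]
variable {μ : Measure X} {lam CD CW : ℝ} {Q : X → X → ℝ} (H : Hyp μ lam CD CW Q)
include H

theorem fr_small (x : X) {η : ℝ} (hη : 0 < η) : ∃ r > 0, ∀ a, dist a x < r → fr μ x a < η := by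
  obtain ⟨r, hr, h⟩ := H.exists_mb_lt x (ε := η ^ 2 / CD) (by have := H.CD_pos; positivity)
  refine ⟨r, hr, fun a ha => ?_⟩
  refine lt_of_pow_lt_pow_left₀ 2 hη.le ((H.fr_sq_le_of (r := r) (by rw [dist_comm]; exact ha.le)).trans_lt ?_)
  rw [lt_div_iff₀ H.CD_pos] at h; linarith

theorem mb_unif {K : Set X} (hK : IsCompact K) {η : ℝ} (hη : 0 < η) : ∃ r > 0, ∀ x ∈ K, mb μ x r < η := by
  choose r hr h using fun x => H.exists_mb_lt (x := x) hη
  obtain ⟨ε, hε, hL⟩ := lebesgue_number_lemma_of_metric hK (c := fun x => Metric.ball x (r x / 2))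
    (fun _ => isOpen_ball) (fun x _ => mem_iUnion.2 ⟨x, mem_ball_self (half_pos (hr x))⟩)
  refine ⟨ε, hε, fun x hx => ?_⟩
  obtain ⟨i, hi⟩ := hL x hx
  have := H.fin
  exact (measureReal_mono (hi.trans (ball_subset_ball (by linarith [hr i])))).trans_lt (h i)

theorem CW_pos : 0 < CW := by
  obtain ⟨a, b, hab⟩ := H.nontriv.exists_pair_ne
  have h1 := H.wm a b
  have h2 := H.mb_le_fr a b
  have h3 := H.pos a _ (dist_pos.2 hab)
  have h4 := H.qnn a b
  by_contra h
  have : fr μ a b ≤ 0 := h1.trans (by nlinarith)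
  have := le_antisymm this (fr_nonneg _ _ _)
  rw [this] at h2; norm_num at h2; linarith

theorem dini {K : Set X} (hK : IsCompact K) {s : ℝ} (hs : 0 < s) :
    ∃ δ0 > 0, ∀ δ > 0, δ ≤ δ0 → ∀ z ∈ K, ∀ z' ∈ K, s ≤ dist z z' →
      √(mb μ z (s / 2)) ≤ 2 * CW * qd μ δ z z' := by
  have hCW := H.CW_pos
  have key : ∀ p : X × X, s ≤ dist p.1 p.2 → ∃ δ1 > 0, ∃ U ∈ 𝓝 p, ∀ q ∈ U, ∀ δ > 0, δ ≤ δ1 →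
      √(mb μ q.1 (s / 2)) ≤ 2 * CW * qd μ δ q.1 q.2 := by
    rintro ⟨z, z'⟩ hp
    simp only at hp
    have hm := H.pos z s hs
    have hfr : √(mb μ z s) ≤ fr μ z z' := by
      rw [← Real.sqrt_sq (fr_nonneg μ z z')]
      exact Real.sqrt_le_sqrt ((H.mb_mono z hp).trans (H.mb_le_fr z z'))
    have hwm := H.wm z z'
    set g := √(mb μ z s)
    have hg : 0 < g := Real.sqrt_pos.2 hm
    obtain ⟨δ1, hδ1, hlt⟩ := H.qsup z z' (3 / 4 * g / CW) (by rw [div_lt_iff₀ hCW]; linarith)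
    rw [div_lt_iff₀ hCW] at hlt
    obtain ⟨r, hr, h1⟩ := H.fr_small z (η := g / CW / 8) (by positivity)
    obtain ⟨r', hr', h2⟩ := H.fr_small z' (η := g / CW / 8) (by positivity)
    refine ⟨δ1, hδ1, Metric.ball z (min (min r (s / 2)) δ1) ×ˢ Metric.ball z' (min r' δ1),
      prod_mem_nhds (ball_mem_nhds _ (by positivity)) (ball_mem_nhds _ (by positivity)), ?_⟩
    rintro ⟨a, b⟩ ⟨ha, hb⟩ δ hδ hδ'
    simp only [mem_ball, lt_min_iff] at ha hb
    have e1 := H.qd_lip hδ1 (a := b) (b := z') hb.2.le z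
    have e2 := H.qd_lip hδ1 (a := a) (b := z) ha.2.le b
    have e3 := h1 a ha.1.1
    have e4 := h2 b hb.1
    rw [fr_comm] at e1 e2
    rw [qd_comm μ δ1 b a, qd_comm μ δ1 b z] at e2
    have e5 := H.qd_anti hδ hδ' a b
    have e6 : √(mb μ a (s / 2)) ≤ g := Real.sqrt_le_sqrt (H.mb_le (by linarith [ha.1.2]))
    have e7 : qd μ δ1 z z' - g / CW / 4 ≤ qd μ δ a b := by
      linarith [(abs_le.1 e1).1, (abs_le.1 e2).1, (abs_le.1 e1).2, (abs_le.1 e2).2]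
    have e8 : g / CW * CW = g := by field_simp
    nlinarith
  choose! d hd U hU h using key
  have hS : IsCompact ((K ×ˢ K) ∩ {p : X × X | s ≤ dist p.1 p.2}) :=
    (hK.prod hK).inter_right (isClosed_le continuous_const (by fun_prop))
  obtain ⟨t, ht, hcov⟩ := hS.elim_nhds_subcover U fun p hp => hU p hp.2
  have : ∃ δ0 > 0, ∀ p ∈ t, δ0 ≤ d p := by
    rcases t.eq_empty_or_nonempty with rfl | hne
    · exact ⟨1, one_pos, by simp⟩
    · obtain ⟨p, hp, hm⟩ := t.exists_min_image d hne
      exact ⟨d p, hd p (ht p hp).2, hm⟩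
  obtain ⟨δ0, h0, hm⟩ := this
  refine ⟨δ0, h0, fun δ hδ hδ0 z hz z' hz' hs => ?_⟩
  obtain ⟨p, hp, hpU⟩ := mem_iUnion₂.1 (hcov (show (z, z') ∈ _ from ⟨⟨hz, hz'⟩, hs⟩))
  exact h p (ht p hp).2 _ hpU δ hδ (hδ0.trans (hm p hp))

theorem cont_of {u : X → ℝ} {δ : ℝ} (hδ : 0 < δ) (hu : ∀ a b, dist a b ≤ δ → |u a - u b| ≤ fr μ a b) :
    Continuous u := by
  rw [continuous_iff_continuousAt]
  intro x
  rw [Metric.continuousAt_iff]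
  intro η hη
  obtain ⟨r, hr, h⟩ := H.fr_small x hη
  refine ⟨min r δ, by positivity, fun a ha => ?_⟩
  rw [lt_min_iff] at ha
  rw [dist_comm, Real.dist_eq]
  exact (hu x a (by rw [dist_comm]; exact ha.2.le)).trans_lt (h a ha.1)

theorem lemmaM {Kc N J : Set X} (hK : IsCompact Kc) {δ : ℝ} (hδ : 0 < δ) (hN : ∀ x ∈ Kc, Metric.ball x δ ⊆ N)
    {u : X → ℝ} (hu : ∀ a b, dist a b ≤ δ → |u a - u b| ≤ fr μ a b) {l t0 t1 s : ℝ} (hl : 0 ≤ l) (hs : 0 < s)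
    {x y : X} (hx : u x ≤ t0) (hy : t1 ≤ u y) (hJ : IsContinuum J) (hxJ : x ∈ J) (hyJ : y ∈ J)
    (h : ∀ t ∈ Ioo t0 t1, ∀ z ∈ J, u z = t → closedBall z s ⊆ Kc ∧
      ∃ K, IsPreconnected K ∧ x ∈ K ∧ y ∈ K ∧ ∀ a ∈ K, dist a z ≤ s → u a ≠ t)
    (hlq : ∀ z ∈ Kc, ∀ z' ∈ Kc, s / 2 ≤ dist z z' → l ≤ qd μ δ z z') :
    l * (t1 - t0) ≤ 4 * CD ^ 4 * μ.real N := by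
  have huc := H.cont_of hδ hu
  refine H.coarea hK hδ hN hu hl fun t ht => ?_
  have hfr : ∀ a ∈ frontier {a | u a ≤ t}, u a = t := fun a ha =>
    frontier_le_subset_eq huc continuous_const ha
  have hσ : 0 < min (δ / 4) (s / 2) := by positivity
  obtain ⟨z, ⟨hzJ, hzF⟩, hz⟩ := lemmaS H.hom (V := {a | u a ≤ t}) (x := x) (y := y)
    (mem_interior.2 ⟨{a | u a < t}, fun a ha => (show u a < t from ha).le, isOpen_lt huc continuous_const, hx.trans_lt ht.1⟩)
    (mem_interior.2 ⟨{a | t < u a}, fun a ha => by simpa using ha, isOpen_lt continuous_const huc, ht.2.trans_le hy⟩)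
    hJ.1 hJ.2.isPreconnected hxJ hyJ hσ
  set σ := min (δ / 4) (s / 2)
  set F := frontier {a | u a ≤ t}
  obtain ⟨hzK, K, hKp, hxK, hyK, hKz⟩ := h t ht z hzJ (hfr z hzF)
  have hout : ∃ w ∈ chainClass F σ z, w ∉ closedBall z s := by
    by_contra! hcon
    obtain ⟨w, hw, hwK⟩ := hz K _ hKp hxK hyK (hK.of_isClosed_subset isClosed_closedBall hzK) hcon
    exact hKz w hwK (hcon w hw) (hfr w (chainClass_sub hzF hw))
  obtain ⟨w, hw, hws⟩ := hout
  have main : ∀ w, w ∈ chainClass F σ z → (∃ (n : ℕ) (z' : ℕ → X), z' 0 = z ∧ z' n = w ∧ (∀ j ≤ n, z' j ∈ F ∧ dist (z' j) z ≤ s / 2) ∧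
      ∀ j < n, dist (z' j) (z' (j + 1)) ≤ σ) ∨ ∃ (n : ℕ) (z' : ℕ → X), z' 0 = z ∧ (∀ j ≤ n, z' j ∈ F ∧ dist (z' j) z ≤ s) ∧
      (∀ j < n, dist (z' j) (z' (j + 1)) ≤ σ) ∧ s / 2 ≤ dist z (z' n) := by
    intro w hw
    induction hw with
    | refl => exact Or.inl ⟨0, fun _ => z, rfl, rfl, fun j _ => ⟨hzF, by rw [dist_self]; positivity⟩, by simp⟩
    | @tail b c _ hbc ih =>
      rcases ih with ⟨n, z', h0, hn, h1, h2⟩ | ih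
      · have hcs : dist c z ≤ s := by
          have h3 := (h1 n le_rfl).2
          rw [hn] at h3
          linarith [dist_triangle_left c z b, hbc.2, min_le_right (δ / 4) (s / 2)]
        have g0 : (fun j => if j ≤ n then z' j else c) 0 = z := by simp [h0]
        have g2 : ∀ j < n + 1, dist ((fun j => if j ≤ n then z' j else c) j)
            ((fun j => if j ≤ n then z' j else c) (j + 1)) ≤ σ := by
          intro j hj
          rcases Nat.lt_succ_iff_lt_or_eq.1 hj with hj | rfl
          · simp only [hj.le, show j + 1 ≤ n from hj, if_true]; exact h2 j hj
          · simp [hn, hbc.2]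
        by_cases hc : dist c z ≤ s / 2
        · refine Or.inl ⟨n + 1, fun j => if j ≤ n then z' j else c, g0, by simp, fun j hj => ?_, g2⟩
          by_cases hjn : j ≤ n
          · simp only [hjn, if_true]; exact h1 j hjn
          · simp only [hjn, if_false]; exact ⟨hbc.1, hc⟩
        · refine Or.inr ⟨n + 1, fun j => if j ≤ n then z' j else c, g0, fun j hj => ?_, g2, ?_⟩
          · by_cases hjn : j ≤ n
            · simp only [hjn, if_true]; exact ⟨(h1 j hjn).1, by linarith [(h1 j hjn).2]⟩
            · simp only [hjn, if_false]; exact ⟨hbc.1, hcs⟩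
          · simp only [show ¬ (n + 1 ≤ n) by omega, if_false]
            rw [dist_comm]; exact (not_le.1 hc).le
      · exact Or.inr ih
  have fin : ∃ (n : ℕ) (z' : ℕ → X), z' 0 = z ∧ (∀ j ≤ n, z' j ∈ F ∧ dist (z' j) z ≤ s) ∧
      (∀ j < n, dist (z' j) (z' (j + 1)) ≤ σ) ∧ s / 2 ≤ dist z (z' n) := by
    rcases main w hw with ⟨n, z', h0, hn, h1, h2⟩ | h
    · have := (h1 n le_rfl).2
      rw [hn] at this
      exact absurd (mem_closedBall.2 (by linarith)) hws
    · exact h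
  obtain ⟨n, z', h0, h1, h2, h3⟩ := fin
  refine ⟨n, z', fun j hj => ⟨(h1 j hj).1, hzK (h1 j hj).2⟩,
    fun j hj => (h2 j hj).trans (min_le_left _ _), ?_⟩
  rw [h0]
  exact hlq z (hzK (mem_closedBall_self hs.le)) _ (hzK (h1 n le_rfl).2) h3

theorem lemmaL {Kc N J A A' : Set X} (hK : IsCompact Kc) {δ : ℝ} (hδ : 0 < δ) (hN : ∀ x ∈ Kc, Metric.ball x δ ⊆ N)
    {l ρ c : ℝ} (hl : 0 < l) (hρ : 0 < ρ) {x y w : X} (hA : IsPreconnected A) (hx : x ∈ A) (hw : w ∈ A)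
    (hxw : ρ ≤ dist x w) (hy : y ∈ A') (hJ : IsContinuum J) (hxJ : x ∈ J) (hyJ : y ∈ J)
    (h : ∀ z ∈ J, z ∉ A' → closedBall z (ρ / (4 * lam)) ⊆ Kc ∧
      ∃ K ⊆ A', IsPreconnected K ∧ y ∈ K ∧ ∃ a ∈ K, ρ / 2 ≤ dist a z)
    (hlq : ∀ z ∈ Kc, ∀ z' ∈ Kc, ρ / (8 * lam) ≤ dist z z' → l ≤ qd μ δ z z')
    (hc : 4 * CD ^ 4 * μ.real N < l * c) : ∃ a ∈ A, ∃ a' ∈ A', qd μ δ a a' < c := by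
  by_contra! hcon
  have hlam := H.hlam
  have hc0 : 0 < c := by
    have := H.CD_pos
    have : 0 ≤ 4 * CD ^ 4 * μ.real N := by positivity
    by_contra h'
    nlinarith
  have : Nonempty A := ⟨⟨x, hx⟩⟩
  set u : X → ℝ := fun b => ⨅ a : A, qd μ δ a b with hu
  have hbd : ∀ b, BddBelow (range fun a : A => qd μ δ a b) := fun b =>
    ⟨0, by rintro _ ⟨a, rfl⟩; exact qd_nonneg _ _ _ _⟩
  have hul : ∀ a b, dist a b ≤ δ → |u a - u b| ≤ fr μ a b := by
    have hul1 : ∀ a b, dist a b ≤ δ → u a - u b ≤ fr μ a b := by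
      intro a b hab
      rw [sub_le_iff_le_add', ← sub_le_iff_le_add]
      refine le_ciInf fun i => ?_
      have h1 := H.qd_lip hδ hab (i : X)
      have h2 := ciInf_le (hbd a) i
      simp only [hu]
      linarith [(abs_le.1 h1).2]
    intro a b hab
    rw [abs_le]
    have := hul1 b a (by rwa [dist_comm])
    rw [fr_comm] at this
    exact ⟨by linarith, hul1 a b hab⟩
  have huA : ∀ a ∈ A, u a ≤ 0 := fun a ha => (ciInf_le (hbd a) ⟨a, ha⟩).trans (H.qd_self hδ a).le
  have huA' : ∀ a ∈ A', c ≤ u a := fun a ha => le_ciInf fun i => hcon i i.2 a ha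
  have := H.lemmaM hK hδ hN hul (l := l) (t0 := 0) (t1 := c) (s := ρ / (4 * lam)) hl.le (by positivity)
    (huA x hx) (huA' y hy) hJ hxJ hyJ ?_ ?_
  · simp only [sub_zero] at this; linarith
  · intro t ht z hz hzt
    have hzA' : z ∉ A' := fun hh => by linarith [huA' z hh, ht.2]
    obtain ⟨h1, K', hK'A, hK', hyK', a', ha', hza'⟩ := h z hz hzA'
    refine ⟨h1, ?_⟩
    obtain ⟨a, ha, hza⟩ : ∃ a ∈ A, ρ / 2 ≤ dist a z := by
      by_contra! hh
      linarith [hh x hx, hh w hw, dist_triangle_right x w z]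
    obtain ⟨K0, hK0, hK0s, haK, ha'K⟩ := (H.llc z (ρ / 2) (by positivity)).2 a a' (by simpa using hza) (by simpa using hza')
    refine ⟨A ∪ (K0 ∪ K'), ?_, Or.inl hx, Or.inr (Or.inr hyK'), ?_⟩
    · exact hA.union a ha (Or.inl haK) (hK0.2.isPreconnected.union a' ha'K ha' hK')
    · rintro b (hb | hb | hb) hbz
      · exact ((huA b hb).trans_lt ht.1).ne
      · have := hK0s hb
        simp only [mem_compl_iff, mem_ball, not_lt] at this
        have h5 : ρ / 2 / lam ≤ ρ / (4 * lam) := this.trans hbz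
        have h6 : ρ / (4 * lam) < ρ / 2 / lam := by
          rw [div_div]; exact div_lt_div_of_pos_left hρ (by positivity) (by linarith)
        linarith
      · exact (ht.2.trans_le (huA' b (hK'A hb))).ne'
  · intro z hz z' hz' hd
    refine hlq z hz z' hz' (le_trans (le_of_eq ?_) hd)
    field_simp; norm_num
end Hyp

end

section
set_option linter.unusedSectionVars false

namespace Hyp
variable {X : Type*} [MetricSpace X] [MeasurableSpace X]
variable {μ : Measure X} {lam CD CW : ℝ} {Q : X → X → ℝ} (H : Hyp μ lam CD CW Q)
include H

theorem sqrt_mb_le {x z : X} {r s : ℝ} (hs : 0 < s) (n : ℕ) (h : r + dist x z ≤ 2 ^ (2 * n) * s) :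
    √(mb μ x r) ≤ CD ^ n * √(mb μ z s) := by
  have := H.CD_pos
  rw [Real.sqrt_le_left (by positivity), mul_pow, Real.sq_sqrt (mb_nonneg _ _ _), ← pow_mul, mul_comm n]
  exact H.mb_le_pow hs _ h

theorem lemmaL' {Kc : Set X} (hK : IsCompact Kc) {ρ r : ℝ} (hρ : 0 < ρ) (hr : 0 < r) {x : X} (n : ℕ)
    (h1 : ∀ z ∈ Kc, r + dist x z ≤ 2 ^ (2 * n) * (ρ / (16 * lam))) (h2 : ∀ z ∈ Kc, ρ + dist z x ≤ r) :
    ∃ δ0 > 0, ∀ δ > 0, δ ≤ δ0 → ∀ (J A A' : Set X) (y w : X), IsPreconnected A → x ∈ A → w ∈ A →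
    ρ ≤ dist x w → y ∈ A' → IsContinuum J → x ∈ J → y ∈ J →
    (∀ z ∈ J, z ∉ A' → closedBall z (ρ / (4 * lam)) ⊆ Kc ∧
      ∃ K ⊆ A', IsPreconnected K ∧ y ∈ K ∧ ∃ a ∈ K, ρ / 2 ≤ dist a z) →
    ∃ a ∈ A, ∃ a' ∈ A', qd μ δ a a' < 16 * CW * CD ^ (4 + n) * √(mb μ x r) := by
  have hlam := H.hlam
  have hCW := H.CW_pos
  have hCD := H.CD_pos
  obtain ⟨δ0, h0, hd⟩ := H.dini hK (s := ρ / (8 * lam)) (by positivity)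
  refine ⟨min δ0 ρ, by positivity, fun δ hδ hδ' J A A' y w hA hx hw hxw hy hJ hxJ hyJ h => ?_⟩
  have hm := Real.sqrt_pos.2 (H.pos x r hr)
  refine H.lemmaL hK hδ (N := Metric.ball x r) (l := √(mb μ x r) / (2 * CW * CD ^ n)) ?_ (by positivity) hρ hA hx hw hxw hy hJ
    hxJ hyJ h ?_ ?_
  · intro z hz
    exact ball_subset_ball' (by linarith [h2 z hz, hδ'.trans (min_le_right _ _)])
  · intro z hz z' hz' hs
    have e1 := hd δ hδ (hδ'.trans (min_le_left _ _)) z hz z' hz' hs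
    have e2 := H.sqrt_mb_le (x := x) (z := z) (r := r) (s := ρ / (8 * lam) / 2) (by positivity) n (by
      convert h1 z hz using 2; field_simp; norm_num)
    rw [div_le_iff₀ (by positivity)]
    calc _ ≤ _ := e2
      _ ≤ CD ^ n * (2 * CW * qd μ δ z z') := by gcongr
      _ = _ := by ring
  · have e : √(mb μ x r) * √(mb μ x r) = μ.real (Metric.ball x r) := Real.mul_self_sqrt (mb_nonneg _ _ _)
    have : √(mb μ x r) / (2 * CW * CD ^ n) * (16 * CW * CD ^ (4 + n) * √(mb μ x r)) =
        8 * CD ^ 4 * μ.real (Metric.ball x r) := by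
      rw [← e, pow_add]; field_simp; norm_num
    rw [this]
    have h5 : 0 < μ.real (Metric.ball x r) := H.pos x r hr
    have : 0 < CD ^ 4 * μ.real (Metric.ball x r) := by positivity
    linarith

theorem llc1 (x : X) {r : ℝ} (hr : 0 < r) {y z : X} (hy : dist y x < r) (hz : dist z x < r) :
    ∃ K : Set X, IsContinuum K ∧ (∀ a ∈ K, dist a x < lam * r) ∧ y ∈ K ∧ z ∈ K := by
  obtain ⟨K, h1, h2, h3⟩ := (H.llc x r hr).1 y hy z hz
  exact ⟨K, h1, fun a ha => h2 ha, h3⟩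

theorem growth {l : ℕ} (hl : lam ≤ 2 ^ l) {x y0 : X} {ε : ℝ} (hε : 0 < ε) (k : ℕ)
    (hK : IsCompact (closedBall x (6 * (2 ^ k * ε)))) (hy0 : 6 * (2 ^ k * ε) ≤ dist x y0) :
    ∃ δ0 > 0, ∀ δ > 0, δ ≤ δ0 → ∃ A w, IsPreconnected A ∧ x ∈ A ∧ w ∈ A ∧ 2 ^ k * ε ≤ dist x w ∧
      ∀ a ∈ A, ∃ b ∈ closedBall x (2 * lam * ε),
        qd μ δ b a < 32 * CW * CD ^ (11 + l) * √(mb μ x (4 * (2 ^ k * ε))) := by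
  have hlam := H.hlam
  have hCW := H.CW_pos
  have hCD := H.CD_pos
  have hCD1 := H.CD_one
  induction k with
  | zero =>
    refine ⟨1, one_pos, fun δ hδ _ => ?_⟩
    obtain ⟨w, hw⟩ := H.exists_dist (x := x) (y := y0) hε.le (by norm_num at hy0; linarith)
    obtain ⟨K, hKc, hKs, hxK, hwK⟩ := H.llc1 x (r := 2 * ε) (by positivity) (y := x) (z := w) (by simpa using hε)
      (by rw [dist_comm, hw]; linarith)
    refine ⟨K, w, hKc.2.isPreconnected, hxK, hwK, by simp [hw], fun a ha => ⟨a, ?_, ?_⟩⟩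
    · rw [mem_closedBall]; linarith [hKs a ha]
    · rw [H.qd_self hδ]
      have := Real.sqrt_pos.2 (H.pos x (4 * (2 ^ 0 * ε)) (by positivity))
      positivity
  | succ k ih =>
    have hρ : 0 < 2 ^ k * ε := by positivity
    rw [show 2 ^ (k + 1) * ε = 2 * (2 ^ k * ε) by rw [pow_succ]; ring] at *
    set ρ := 2 ^ k * ε
    obtain ⟨δ1, hδ1, ih⟩ := ih (hK.of_isClosed_subset isClosed_closedBall (closedBall_subset_closedBall (by linarith)))
      (by linarith)
    have hKc : IsCompact (closedBall x (3 * ρ)) :=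
      hK.of_isClosed_subset isClosed_closedBall (closedBall_subset_closedBall (by linarith))
    obtain ⟨δ2, hδ2, hL⟩ := H.lemmaL' hKc hρ (r := 4 * ρ) (by positivity) (x := x) (4 + l) (by
        intro z hz
        rw [mem_closedBall, dist_comm] at hz
        have : 2 ^ (2 * (4 + l)) * (ρ / (16 * lam)) = 16 * ρ * (2 ^ l * (2 ^ l / lam)) := by
          rw [pow_mul', pow_add, pow_two]; field_simp; norm_num
        rw [this]
        have h3 : 1 ≤ (2:ℝ) ^ l / lam := by rw [le_div_iff₀ (by positivity)]; linarith
        have h4 : (1:ℝ) ≤ 2 ^ l := one_le_pow₀ (by norm_num)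
        nlinarith [one_le_mul_of_one_le_of_one_le h4 h3])
      (by intro z hz; rw [mem_closedBall] at hz; linarith)
    have hgap : (2 * CD ^ 3 + 1) * √(mb μ x (4 * ρ)) < 2 * CD ^ 3 * √(mb μ x (4 * (2 * ρ))) := by
      refine lt_of_pow_lt_pow_left₀ 2 (by positivity) ?_
      rw [mul_pow, mul_pow _ (√_), Real.sq_sqrt (mb_nonneg _ _ _), Real.sq_sqrt (mb_nonneg _ _ _)]
      have e1 := H.rev_dbl (x := x) (y := y0) (r := 4 * ρ) (by positivity) (by linarith)
      rw [show 2 * (4 * ρ) = 4 * (2 * ρ) by ring] at e1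
      have e2 := H.pos x (4 * (2 * ρ)) (by positivity)
      have ha : 0 < CD ^ 3 := by positivity
      set a := CD ^ 3
      calc _ ≤ (2 * a + 1) ^ 2 * ((1 - 1 / a) * mb μ x (4 * (2 * ρ))) := by gcongr
        _ = ((2 * a) ^ 2 - 3 - 1 / a) * mb μ x (4 * (2 * ρ)) := by field_simp; ring
        _ < _ := by
          have : 0 < 1 / a := by positivity
          apply mul_lt_mul_of_pos_right _ e2; linarith
    set c1 := 16 * CW * CD ^ (8 + l) with hc1
    have hc1p : 0 < c1 := by positivity
    set η := c1 * (2 * CD ^ 3 * √(mb μ x (4 * (2 * ρ))) - (2 * CD ^ 3 + 1) * √(mb μ x (4 * ρ)))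
    have hη : 0 < η := mul_pos hc1p (by linarith)
    obtain ⟨δ3, hδ3, hsm⟩ := H.mb_unif hKc (η := η ^ 2 / CD) (by positivity)
    refine ⟨min (min δ1 δ2) δ3, by positivity, fun δ hδ hδ' => ?_⟩
    simp only [le_min_iff] at hδ'
    obtain ⟨A, w, hA, hxA, hwA, hxw, hAr⟩ := ih δ hδ hδ'.1.1
    obtain ⟨J, hJ, -, hxJ, hyJ⟩ := H.llc1 x (r := dist y0 x + 1) (by positivity) (y := x) (z := y0)
      (by rw [dist_self]; positivity) (by linarith)
    set d := δ / (2 * lam) with hd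
    have hdp : 0 < d := by positivity
    have hdδ : 2 * lam * d = δ := by rw [hd]; field_simp
    obtain ⟨a, haA, b, hb, hab⟩ := hL d hdp (by nlinarith) J A {b | 2 * ρ ≤ dist x b} y0 w hA hxA hwA hxw
      (show 2 * ρ ≤ dist x y0 by linarith) hJ hxJ hyJ (by
        intro z _ hz
        have hz : dist x z < 2 * ρ := not_le.1 hz
        refine ⟨?_, {y0}, by simpa using (by linarith), isPreconnected_singleton, rfl, y0, rfl, ?_⟩
        · refine closedBall_subset_closedBall' ?_
          have : ρ / (4 * lam) ≤ ρ := div_le_self hρ.le (by linarith)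
          rw [dist_comm]; linarith
        · linarith [dist_triangle_right x y0 z])
    have hb : 2 * ρ ≤ dist x b := hb
    rw [show 4 + (4 + l) = 8 + l by ring] at hab
    obtain ⟨z, m, ⟨hz0, hzm, hzd⟩, hsum⟩ := H.exists_chain hdp hab
    classical
    have hex : ∃ j, 2 * ρ ≤ dist x (z j) := ⟨m, by rwa [hzm]⟩
    have hjm : Nat.find hex ≤ m := Nat.find_min' hex (by rwa [hzm])
    have hgood : ∀ j ≤ Nat.find hex, ∃ A', IsPreconnected A' ∧ x ∈ A' ∧ z j ∈ A' ∧
        ∀ a ∈ A', ∃ b ∈ closedBall x (2 * lam * ε),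
          qd μ δ b a < 32 * CW * CD ^ (11 + l) * √(mb μ x (4 * (2 * ρ))) := by
      have hcc : 32 * CW * CD ^ (11 + l) * √(mb μ x (4 * ρ)) + c1 * √(mb μ x (4 * ρ)) + η =
          32 * CW * CD ^ (11 + l) * √(mb μ x (4 * (2 * ρ))) := by
        simp only [η, hc1, show 11 + l = (8 + l) + 3 by ring, pow_add _ (8 + l) 3]; ring
      intro j
      induction j with
      | zero =>
        intro _
        refine ⟨A, hA, hxA, by rwa [hz0], fun a ha => ?_⟩
        obtain ⟨b, hb, hba⟩ := hAr a ha
        have : 0 ≤ c1 * √(mb μ x (4 * ρ)) := by positivity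
        exact ⟨b, hb, by linarith⟩
      | succ j ihj =>
        intro hj
        obtain ⟨A', h1, h2, h3, h4⟩ := ihj (by omega)
        have hzj : dist x (z j) < 2 * ρ := not_le.1 (Nat.find_min hex (show j < _ by omega))
        obtain ⟨K, hKk, hKs, hK1, hK2⟩ := H.llc1 (z j) (r := 2 * d) (by positivity) (y := z j) (z := z (j + 1))
          (by rw [dist_self]; positivity) (by rw [dist_comm]; linarith [hzd j (by omega)])
        refine ⟨A' ∪ K, h1.union (z j) h3 hK1 hKk.2.isPreconnected, Or.inl h2, Or.inr hK2, ?_⟩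
        rintro p (hp | hp)
        · exact h4 p hp
        · obtain ⟨b, hb, hba⟩ := hAr a haA
          refine ⟨b, hb, ?_⟩
          have hpz : dist (z j) p ≤ δ := by rw [dist_comm]; linarith [hKs p hp]
          have e1 := H.qd_tri hδ b a p
          have e2 := H.qd_tri hδ a (z j) p
          have e3 := H.qd_le_fr hpz
          have e4 : qd μ δ a (z j) < c1 * √(mb μ x (4 * ρ)) := by
            refine (H.qd_anti hdp (by nlinarith) a (z j)).trans_lt (lt_of_le_of_lt ?_ hsum)
            refine (H.qd_le_sum (m := j) ⟨hz0, rfl, fun i hi => hzd i (by omega)⟩).trans ?_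
            exact Finset.sum_le_sum_of_subset_of_nonneg (Finset.range_mono (by omega)) fun _ _ _ => fr_nonneg _ _ _
          have e5 : fr μ (z j) p < η := by
            refine lt_of_pow_lt_pow_left₀ 2 hη.le ?_
            refine ((H.fr_sq_le_of (r := δ3) (by linarith)).trans_lt ?_)
            have := hsm (z j) (by rw [mem_closedBall, dist_comm]; linarith)
            rw [lt_div_iff₀ hCD] at this; linarith
          linarith
    obtain ⟨A', h1, h2, h3, h4⟩ := hgood _ le_rfl
    exact ⟨A', z (Nat.find hex), h1, h2, h3, Nat.find_spec hex, h4⟩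

theorem q_le {l : ℕ} (hl : lam ≤ 2 ^ l) {x y y0 y1 : X} (hxy : x ≠ y)
    (hK : IsCompact (closedBall x (6 * lam * dist x y))) (hK' : IsCompact (closedBall y (6 * dist x y)))
    (hy0 : 6 * dist x y ≤ dist x y0) (hy1 : 6 * dist x y ≤ dist y y1) :
    Q x y ≤ 16 * CW * CD ^ (25 + 2 * l) * √(mb μ x (dist x y)) := by
  have hlam := H.hlam
  have hCW := H.CW_pos
  have hCD := H.CD_pos
  have hCD1 := H.CD_one
  have hD : 0 < dist x y := dist_pos.2 hxy
  set D := dist x y with hDd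
  have hKc : IsCompact (closedBall x (3 * lam * D)) :=
    hK.of_isClosed_subset isClosed_closedBall (closedBall_subset_closedBall (by nlinarith))
  obtain ⟨δ2, hδ2, hL⟩ := H.lemmaL' hKc hD (r := 4 * lam * D) (by positivity) (x := x) (4 + l) (by
        intro z hz
        rw [mem_closedBall, dist_comm] at hz
        have : 2 ^ (2 * (4 + l)) * (D / (16 * lam)) = 16 * D * lam * (2 ^ l / lam * (2 ^ l / lam)) := by
          rw [pow_mul', pow_add, pow_two]; field_simp; norm_num
        rw [this]
        have h3 : 1 ≤ (2:ℝ) ^ l / lam := by rw [le_div_iff₀ (by positivity)]; linarith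
        nlinarith [one_le_mul_of_one_le_of_one_le h3 h3, mul_pos hD (zero_lt_one.trans_le hlam)])
      (by intro z hz; rw [mem_closedBall] at hz; nlinarith)
  obtain ⟨J, hJ, hJs, hxJ, hyJ⟩ := H.llc1 x (r := 2 * D) (by positivity) (y := x) (z := y)
      (by rw [dist_self]; positivity) (by rw [dist_comm]; linarith)
  have main : ∀ ε0 > 0, ∃ ε > 0, ε ≤ ε0 ∧ ∃ δ0 > 0, ∀ δ > 0, δ ≤ δ0 → ∃ b ∈ closedBall x (2 * lam * ε),
      ∃ b' ∈ closedBall y (2 * lam * ε), qd μ δ b b' ≤ 16 * CW * CD ^ (25 + 2 * l) * √(mb μ x D) := by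
    intro ε0 hε0
    obtain ⟨k, hk⟩ := exists_pow_lt_of_lt_one (show 0 < ε0 / D by positivity) (show (1/2:ℝ) < 1 by norm_num)
    have hkD : 2 ^ k * (D * (1 / 2) ^ k) = D := by
      rw [mul_left_comm, ← mul_pow]; norm_num
    refine ⟨D * (1/2) ^ k, by positivity, by rw [lt_div_iff₀ hD] at hk; linarith, ?_⟩
    set ε := D * (1/2) ^ k
    have hε : 0 < ε := by positivity
    obtain ⟨δ3, hδ3, g1⟩ := H.growth hl hε k (x := x) (y0 := y0)
      (hK.of_isClosed_subset isClosed_closedBall (closedBall_subset_closedBall (by rw [hkD]; nlinarith))) (by rwa [hkD])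
    obtain ⟨δ4, hδ4, g2⟩ := H.growth hl hε k (x := y) (y0 := y1) (by rwa [hkD]) (by rwa [hkD])
    rw [hkD] at g1 g2
    refine ⟨min δ2 (min δ3 δ4), by positivity, fun δ hδ hδ' => ?_⟩
    simp only [le_min_iff] at hδ'
    obtain ⟨A, w, hA, hxA, hwA, hxw, hAr⟩ := g1 δ hδ hδ'.2.1
    obtain ⟨A', w', hA', hyA, hwA', hyw, hAr'⟩ := g2 δ hδ hδ'.2.2
    obtain ⟨a, ha, a', ha', haa⟩ := hL δ hδ hδ'.1 J A A' y w hA hxA hwA hxw hyA hJ hxJ hyJ (by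
      intro z hz _
      refine ⟨closedBall_subset_closedBall' ?_, A', subset_rfl, hA', hyA, ?_⟩
      · have : D / (4 * lam) ≤ lam * D := (div_le_self hD.le (by linarith)).trans (by nlinarith)
        linarith [hJs z hz]
      · by_contra! hh
        linarith [hh y hyA, hh w' hwA', dist_triangle_right y w' z])
    obtain ⟨b, hb, hba⟩ := hAr a ha
    obtain ⟨b', hb', hba'⟩ := hAr' a' ha'
    refine ⟨b, hb, b', hb', ?_⟩
    have e1 := H.qd_tri hδ b a b'
    have e2 := H.qd_tri hδ a a' b'
    rw [qd_comm] at hba'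
    have f1 := H.sqrt_mb_le (x := x) (z := x) (r := 4 * D) hD 1 (by rw [dist_self]; norm_num)
    have f2 := H.sqrt_mb_le (x := y) (z := x) (r := 4 * D) hD 2 (by rw [dist_comm, ← hDd]; norm_num; linarith)
    have f3 := H.sqrt_mb_le (x := x) (z := x) (r := 4 * lam * D) hD (1 + l) (by
      rw [dist_self, add_zero]
      gcongr
      rw [mul_add, pow_add, mul_comm 2 l, pow_mul _ l, pow_two (_ ^ l), show (2:ℝ) ^ (2 * 1) = 4 by norm_num]
      have h4 : (1:ℝ) ≤ 2 ^ l := one_le_pow₀ (by norm_num)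
      nlinarith)
    set s := √(mb μ x D)
    have hs : 0 ≤ s := Real.sqrt_nonneg _
    have p1 : CD ^ (11 + l) * (CD ^ 1 * s) ≤ CD ^ (13 + 2 * l) * s := by
      rw [← mul_assoc, ← pow_add]; exact mul_le_mul_of_nonneg_right (pow_le_pow_right₀ hCD1 (by omega)) hs
    have p2 : CD ^ (11 + l) * (CD ^ 2 * s) ≤ CD ^ (13 + 2 * l) * s := by
      rw [← mul_assoc, ← pow_add]; exact mul_le_mul_of_nonneg_right (pow_le_pow_right₀ hCD1 (by omega)) hs
    have p3 : CD ^ (4 + (4 + l)) * (CD ^ (1 + l) * s) ≤ CD ^ (13 + 2 * l) * s := by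
      rw [← mul_assoc, ← pow_add]; exact mul_le_mul_of_nonneg_right (pow_le_pow_right₀ hCD1 (by omega)) hs
    have q1 : 32 * CW * CD ^ (11 + l) * √(mb μ x (4 * D)) ≤ 32 * CW * (CD ^ (13 + 2 * l) * s) := by
      rw [mul_assoc _ (_ ^ _)]; exact mul_le_mul_of_nonneg_left (le_trans (mul_le_mul_of_nonneg_left f1 (by positivity)) p1) (by positivity)
    have q2 : 32 * CW * CD ^ (11 + l) * √(mb μ y (4 * D)) ≤ 32 * CW * (CD ^ (13 + 2 * l) * s) := by
      rw [mul_assoc _ (_ ^ _)]; exact mul_le_mul_of_nonneg_left (le_trans (mul_le_mul_of_nonneg_left f2 (by positivity)) p2) (by positivity)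
    have q3 : 16 * CW * CD ^ (4 + (4 + l)) * √(mb μ x (4 * lam * D)) ≤ 16 * CW * (CD ^ (13 + 2 * l) * s) := by
      rw [mul_assoc _ (_ ^ _)]; exact mul_le_mul_of_nonneg_left (le_trans (mul_le_mul_of_nonneg_left f3 (by positivity)) p3) (by positivity)
    have h8 : 8 ≤ CD ^ 12 := by
      have := H.CD_four
      calc (8:ℝ) = 2 ^ 3 := by norm_num
        _ ≤ (CD ^ 4) ^ 3 := by gcongr
        _ = _ := by rw [← pow_mul]
    have q4 : 16 * CW * CD ^ (25 + 2 * l) * s = 16 * CD ^ 12 * (CW * (CD ^ (13 + 2 * l) * s)) := by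
      rw [show 25 + 2 * l = 12 + (13 + 2 * l) by ring, pow_add]; ring
    have q5 : 0 ≤ CW * (CD ^ (13 + 2 * l) * s) := by positivity
    rw [q4]
    nlinarith
  by_contra! hcon
  obtain ⟨δ, hδ, hlt⟩ := H.qsup x y _ hcon
  set C := 16 * CW * CD ^ (25 + 2 * l) * √(mb μ x D)
  have hg : 0 < qd μ δ x y - C := by linarith
  obtain ⟨r1, hr1, f1⟩ := H.fr_small x (η := (qd μ δ x y - C) / 2) (by linarith)
  obtain ⟨r2, hr2, f2⟩ := H.fr_small y (η := (qd μ δ x y - C) / 2) (by linarith)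
  obtain ⟨ε, hε, hε', δ0, hδ0, h⟩ := main (min (min r1 r2) δ / (4 * lam)) (by positivity)
  rw [le_div_iff₀ (by positivity)] at hε'
  obtain ⟨b, hb, b', hb', hbb⟩ := h (min δ δ0) (by positivity) (min_le_right _ _)
  rw [mem_closedBall] at hb hb'
  have m0 : min (min r1 r2) δ ≤ δ := min_le_right _ _
  have m1 : min (min r1 r2) δ ≤ r1 := (min_le_left _ _).trans (min_le_left _ _)
  have m2 : min (min r1 r2) δ ≤ r2 := (min_le_left _ _).trans (min_le_right _ _)
  have hle : 2 * lam * ε < ε * (4 * lam) := by nlinarith [mul_pos hε (zero_lt_one.trans_le hlam)]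
  have e1 := f1 b (by linarith)
  have e2 := f2 b' (by linarith)
  have e3 := H.qd_le_fr (x := x) (y := b) (δ := δ) (by rw [dist_comm]; linarith)
  have e4 := H.qd_le_fr (x := y) (y := b') (δ := δ) (by rw [dist_comm]; linarith)
  have e5 := H.qd_anti (δ := min δ δ0) (by positivity) (min_le_left _ _) b b'
  have e6 := H.qd_tri hδ x b y
  have e7 := H.qd_tri hδ b b' y
  rw [qd_comm μ δ y b'] at e4
  linarith
end Hyp

end

section
set_option linter.unusedSectionVars false

namespace Hyp
variable {X : Type*} [MetricSpace X] [MeasurableSpace X]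
variable {μ : Measure X} {lam CD CW : ℝ} {Q : X → X → ℝ} (H : Hyp μ lam CD CW Q)
include H

theorem q_loc {l : ℕ} (hl : lam ≤ 2 ^ l) (p : X) : ∃ R > 0, IsCompact (closedBall p R) ∧
    ∀ x ∈ Metric.ball p R, ∀ y ∈ Metric.ball p R,
      Q x y ≤ 16 * CW * CD ^ (25 + 2 * l) * √(mb μ x (dist x y)) := by
  have hlam := H.hlam
  obtain ⟨D0, hD0, hfar⟩ := H.exists_far
  have := H.lc
  obtain ⟨R1, hR1, hc⟩ := (nhds_basis_closedBall.mem_iff).1 (exists_compact_mem_nhds p).choose_spec.2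
  have hc := (exists_compact_mem_nhds p).choose_spec.1.of_isClosed_subset isClosed_closedBall hc
  have hR : 0 < min (R1 / (13 * lam)) (D0 / 12) := by positivity
  generalize hRR : min (R1 / (13 * lam)) (D0 / 12) = R at hR
  have h1 : R * (13 * lam) ≤ R1 := by
    rw [← le_div_iff₀ (by positivity), ← hRR]; exact min_le_left _ _
  have h2 : R ≤ D0 / 12 := by rw [← hRR]; exact min_le_right _ _
  have h3 : R ≤ R * lam := le_mul_of_one_le_right hR.le hlam
  refine ⟨R, hR, hc.of_isClosed_subset isClosed_closedBall (closedBall_subset_closedBall (by linarith)), fun x hx y hy => ?_⟩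
  rcases eq_or_ne x y with rfl | hxy
  · rw [(H.qzero _ _).2 rfl]
    have := H.CW_pos; have := H.CD_pos; positivity
  rw [Metric.mem_ball] at hx hy
  have hd : dist x y < 2 * R := by linarith [dist_triangle_right x y p]
  have hd' : dist x y * lam ≤ 2 * R * lam := mul_le_mul_of_nonneg_right hd.le (by linarith)
  obtain ⟨y0, hy0⟩ := hfar x
  obtain ⟨y1, hy1⟩ := hfar y
  refine H.q_le hl hxy ?_ ?_ (y0 := y0) (y1 := y1) (by linarith) (by linarith)
  · exact hc.of_isClosed_subset isClosed_closedBall (closedBall_subset_closedBall' (by linarith))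
  · exact hc.of_isClosed_subset isClosed_closedBall (closedBall_subset_closedBall' (by linarith))

theorem sqrt_mb_le_q (x y : X) {r : ℝ} (h : r ≤ dist x y) : √(mb μ x r) ≤ CW * Q x y :=
  (Real.sqrt_le_sqrt ((H.mb_mono x h).trans (H.mb_le_fr x y))).trans
    (by rw [Real.sqrt_sq (fr_nonneg _ _ _)]; exact H.wm x y)

variable {Y : Type*} [MetricSpace Y] {e : X ≃ Y} (hq : ∀ x y, dist (e x) (e y) = Q x y) {C1 : ℝ}
  (hC1 : 0 < C1) (hloc : ∀ p : X, ∃ R > 0, IsCompact (closedBall p R) ∧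
    ∀ x ∈ Metric.ball p R, ∀ y ∈ Metric.ball p R, Q x y ≤ C1 * √(mb μ x (dist x y)))
include hq

theorem symm_cont (x : X) {ε : ℝ} (hε : 0 < ε) : ∃ r > 0, ∀ y, Q x y < r → dist x y < ε := by
  have h := H.pos x ε hε
  have := H.CW_pos
  refine ⟨√(mb μ x ε) / CW, by positivity, fun y hy => ?_⟩
  by_contra! hc
  rw [lt_div_iff₀ this] at hy
  linarith [H.sqrt_mb_le_q x y hc]

include hloc hC1
theorem q_cont (x : X) {ε : ℝ} (hε : 0 < ε) : ∃ r > 0, ∀ y, dist x y < r → Q x y < ε := by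
  obtain ⟨R, hR, -, h⟩ := hloc x
  obtain ⟨r, hr, h'⟩ := H.exists_mb_lt x (ε := (ε / C1) ^ 2) (by positivity)
  refine ⟨min r R, lt_min hr hR, fun y hy => ?_⟩
  refine (h x (mem_ball_self hR) y (by rw [Metric.mem_ball, dist_comm]; exact hy.trans_le (min_le_right _ _))).trans_lt ?_
  have : √(mb μ x (dist x y)) < ε / C1 := by
    rw [Real.sqrt_lt' (by positivity)]
    exact (H.mb_mono x (hy.le.trans (min_le_left _ _))).trans_lt h'
  rw [lt_div_iff₀ hC1] at this; linarith

theorem homeo : Continuous e ∧ Continuous e.symm := by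
  constructor
  · refine Metric.continuous_iff.2 fun x ε hε => ?_
    obtain ⟨r, hr, h⟩ := H.q_cont hq hC1 hloc x hε
    exact ⟨r, hr, fun y hy => by rw [hq, H.qsymm]; exact h y (by rwa [dist_comm])⟩
  · refine Metric.continuous_iff.2 fun x ε hε => ?_
    obtain ⟨r, hr, h⟩ := H.symm_cont hq (e.symm x) hε
    refine ⟨r, hr, fun y hy => ?_⟩
    rw [dist_comm]; refine h _ ?_
    rw [← hq]; simpa [dist_comm] using hy

variable [MeasurableSpace Y] [BorelSpace Y]

theorem haus_compact {K : Set X} (hK : IsCompact K) :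
    μH[2] (e '' K) ≤ ENNReal.ofReal (4 * C1 ^ 2 * CD ^ 2) * μ K := by
  have := H.fin; have := H.bor
  choose R hR _ hloc using hloc
  obtain ⟨ρ, hρ, hL⟩ := lebesgue_number_lemma_of_metric hK (c := fun x => Metric.ball x (R x))
    (fun _ => isOpen_ball) (fun x _ => mem_iUnion.2 ⟨x, mem_ball_self (hR x)⟩)
  choose! s hsK hs1 hs2 using fun (r : ℝ) (hr : 0 < r) => exists_net hK hr
  have hdiam : ∀ r, 0 < r → r ≤ ρ → ∀ x ∈ K, ediam (e '' Metric.ball x r) ≤ ENNReal.ofReal (2 * (C1 * √(mb μ x r))) := by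
    intro r hr hrρ x hx
    have hb : ∀ y ∈ Metric.ball x r, Q x y ≤ C1 * √(mb μ x r) := fun y hy => by
      obtain ⟨i, hi⟩ := hL x hx
      refine (hloc i x (hi (mem_ball_self hρ)) y (hi (ball_subset_ball hrρ hy))).trans ?_
      gcongr
      exact H.mb_mono x (by rw [dist_comm]; exact (Metric.mem_ball.1 hy).le)
    refine ediam_le ?_
    rintro _ ⟨y, hy, rfl⟩ _ ⟨z, hz, rfl⟩
    rw [edist_dist, hq]
    refine ENNReal.ofReal_le_ofReal ?_
    linarith [H.qtri y x z, hb y hy, hb z hz, H.qsymm y x]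
  have h0 : ∀ᶠ r : ℝ in 𝓝[>] 0, 0 < r ∧ r ≤ ρ := by
    filter_upwards [Ioc_mem_nhdsGT hρ] with r hr using hr
  have key := Measure.hausdorffMeasure_le_liminf_sum (X := Y) 2 (e '' K) (l := 𝓝[>] (0:ℝ)) (ι := fun r => ↥(s r))
    (fun r => ⨆ i : ↥(s r), ediam (e '' Metric.ball (i : X) r)) ?_
    (fun r i => e '' Metric.ball (i : X) r) (.of_forall fun r i => le_iSup (fun i : ↥(s r) => ediam (e '' Metric.ball (i : X) r)) i) ?_
  · refine key.trans ?_
    have ht := (ENNReal.Tendsto.const_mul (a := ENNReal.ofReal (4 * C1 ^ 2 * CD ^ 2)) (tendsto_measure_thickening_of_isClosed (μ := μ) ⟨1, one_pos, measure_ne_top _ _⟩ hK.isClosed)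
      (Or.inr ofReal_ne_top))
    rw [← ht.liminf_eq]
    refine liminf_le_liminf ?_
    filter_upwards [h0] with r hr
    calc ∑ i : ↥(s r), ediam (e '' Metric.ball (i : X) r) ^ (2:ℝ)
        ≤ ∑ i : ↥(s r), ENNReal.ofReal (4 * C1 ^ 2 * mb μ i r) := Finset.sum_le_sum fun i _ => by
          refine (ENNReal.rpow_le_rpow (hdiam r hr.1 hr.2 i (hsK r hr.1 i.2)) (by norm_num)).trans (le_of_eq ?_)
          rw [ENNReal.rpow_two, ← ENNReal.ofReal_pow (by positivity)]
          congr 1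
          rw [mul_pow, mul_pow, Real.sq_sqrt (mb_nonneg _ _ _)]; ring
      _ = ENNReal.ofReal (4 * C1 ^ 2 * ∑ i ∈ s r, mb μ i r) := by
          rw [← ENNReal.ofReal_sum_of_nonneg (fun i _ => by have := mb_nonneg μ i.1 r; positivity), Finset.mul_sum]
          congr 1
          exact Finset.sum_coe_sort (s r) (fun i => 4 * C1 ^ 2 * mb μ i r)
      _ ≤ ENNReal.ofReal (4 * C1 ^ 2 * (CD ^ 2 * μ.real (thickening r K))) := by
          gcongr
          exact H.net_sum hr.1 (fun x hx => ball_subset_thickening (hsK r hr.1 hx) r) (hs2 r hr.1)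
      _ = _ := by
          rw [← mul_assoc, ENNReal.ofReal_mul (by positivity), ofReal_measureReal]
  · refine ENNReal.tendsto_nhds_zero.2 fun ε hε => ?_
    rcases eq_or_ne ε ⊤ with rfl | hε'
    · simp
    lift ε to ℝ≥0 using hε'
    have hε : 0 < (ε : ℝ) := by simpa using hε
    obtain ⟨r1, hr1, h1⟩ := H.mb_unif hK (η := (ε / (2 * C1)) ^ 2) (by positivity)
    filter_upwards [h0, Ioc_mem_nhdsGT hr1] with r hr hr'
    refine iSup_le fun i => (hdiam r hr.1 hr.2 i (hsK r hr.1 i.2)).trans ?_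
    rw [ENNReal.ofReal_le_iff_le_toReal (by simp)]
    have : √(mb μ i r) ≤ ε / (2 * C1) := Real.sqrt_le_iff.2 ⟨by positivity, ((H.mb_mono _ hr'.2).trans_lt (h1 i (hsK r hr.1 i.2))).le⟩
    rw [le_div_iff₀ (by positivity)] at this
    simp; linarith
  · filter_upwards [h0] with r hr
    rintro _ ⟨a, ha, rfl⟩
    obtain ⟨x, hx, hd⟩ := hs1 r hr.1 a ha
    exact mem_iUnion.2 ⟨⟨x, hx⟩, mem_image_of_mem _ hd⟩

theorem haus_le (E : Set X) : μH[2] (e '' E) ≤ ENNReal.ofReal (4 * C1 ^ 2 * CD ^ 2) * μ E := by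
  have := H.fin; have := H.bor; have := H.lc; have := H.sc
  obtain ⟨hc1, hc2⟩ := H.homeo hq hC1 hloc
  let eh : X ≃ₜ Y := ⟨e, hc1, hc2⟩
  set c := ENNReal.ofReal (4 * C1 ^ 2 * CD ^ 2)
  have hmap : ∀ A : Set X, (μH[2] : Measure Y).map eh.symm A = μH[2] (e '' A) := fun A => by
    have := (eh.symm.toMeasurableEquiv).map_apply (μ := (μH[2] : Measure Y)) A
    refine this.trans ?_
    congr 1
    exact (e.image_eq_preimage_symm A).symm
  have hopen : ∀ U : Set X, IsOpen U → μH[2] (e '' U) ≤ c * μ U := by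
    intro U hU
    refine le_of_forall_lt fun r hr => ?_
    obtain ⟨K, hKU, hK, hr'⟩ := ((Measure.InnerRegularWRT.isCompact_isClosed ((μH[2] : Measure Y).map eh.symm)).trans
      (Measure.InnerRegularWRT.of_pseudoMetrizableSpace _)) hU r (by rwa [hmap])
    rw [hmap] at hr'
    exact hr'.trans_le ((H.haus_compact hq hC1 hloc hK).trans (by gcongr))
  rw [E.measure_eq_iInf_isOpen μ]
  have hc : c ≠ ⊤ := ofReal_ne_top
  simp only [ENNReal.mul_iInf_of_ne (a := c) (by simp [c]; have := H.CD_pos; positivity) hc]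
  exact le_iInf fun U => le_iInf fun hE => le_iInf fun hU => (measure_mono (image_mono hE)).trans (hopen U hU)

end Hyp

end

section
set_option linter.unusedSectionVars false

theorem qDelta_le_qmu {X : Type*} [MetricSpace X] [MeasurableSpace X] (μ : Measure X) {δ : ℝ} (hδ : 0 < δ) (x y : X) :
    qDelta μ 2 δ x y ≤ qmu μ 2 x y :=
  le_limsup_of_frequently_le (Eventually.frequently (by
    filter_upwards [Ioc_mem_nhdsGT hδ] with r hr using qDelta_anti μ hr.2 x y)) 

theorem mkHyp {X : Type*} [MetricSpace X] [MeasurableSpace X] [BorelSpace X]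
    {lam : ℝ} {CD CW : ℝ≥0} {μ : Measure X} (hlam : 1 ≤ lam) (hLLC : IsLLC X lam)
    (hhom : ∃ Ω₀ : Set ↥Sphere2, IsCircleDomainS2 Ω₀ ∧ Nonempty (X ≃ₜ ↥Ω₀))
    (hcpt : CompactSpace (Completion X)) (hdbl : IsDoublingWith μ CD) (hw : IsWMDM μ 2 CW)
    {Y : Type*} [MetricSpace Y] {e : X ≃ Y} (hq : ∀ x y : X, edist (e x) (e y) = qmu μ 2 x y) :
    Hyp μ lam CD CW (fun x y => dist (e x) (e y)) := by
  obtain ⟨Ω, hΩ, ⟨φ⟩⟩ := hhom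
  have hne : Nonempty X := hΩ.2.1.nonempty.to_subtype.map φ.symm
  have hqt : ∀ x y, qmu μ 2 x y ≠ ⊤ := fun x y => hq x y ▸ edist_ne_top _ _
  have hqr : ∀ x y, dist (e x) (e y) = (qmu μ 2 x y).toReal := fun x y => by rw [← hq, edist_dist, ENNReal.toReal_ofReal dist_nonneg]
  have hfin : IsFiniteMeasure μ := by
    have hb : Bornology.IsBounded (univ : Set X) := by
      have h := (isCompact_univ (X := Completion X)).isBounded
      obtain ⟨C, hC⟩ := Metric.isBounded_iff.1 h
      exact Metric.isBounded_iff.2 ⟨C, fun x _ y _ => by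
        have := hC (mem_univ (x : Completion X)) (mem_univ (y : Completion X))
        rwa [Completion.dist_eq] at this⟩
    obtain ⟨r, hr, h⟩ := hb.subset_ball_lt 0 hne.some
    exact ⟨(measure_mono h).trans_lt (hdbl.1 _ r hr).2⟩
  refine ⟨‹_›, hfin, hlam, hLLC, ⟨Ω, hΩ.1, ⟨φ⟩⟩, ?_, ?_, ?_, ?_, ?_, ?_, ?_, ?_, ?_, ?_, ?_, ?_, ?_⟩
  · have : LocallyCompactSpace Ω := hΩ.1.locallyCompactSpace
    exact φ.isOpenEmbedding.locallyCompactSpace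
  · have : PreconnectedSpace Ω := isPreconnected_iff_preconnectedSpace.1 hΩ.2.1.isPreconnected
    exact φ.symm.surjective.denseRange.preconnectedSpace φ.symm.continuous
  · by_contra hn
    rw [not_nontrivial_iff_subsingleton] at hn
    have hΩs : Ω.Subsingleton := fun a ha b hb => by
      have := φ.symm.injective (Subsingleton.elim (φ.symm ⟨a, ha⟩) (φ.symm ⟨b, hb⟩))
      simpa using this
    obtain ⟨p, hp⟩ := hΩ.2.1.nonempty
    have hps : PreconnectedSpace ↥Sphere2 := isPreconnected_iff_preconnectedSpace.1
      (isConnected_sphere (by rw [rank_eq_card_basis (EuclideanSpace.basisFun (Fin 3) ℝ).toBasis]; simp) 0 zero_le_one).isPreconnected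
    have hu : Ω = univ := IsClopen.eq_univ ⟨hΩs.finite.isClosed, hΩ.1⟩ ⟨p, hp⟩
    have : -p = p := hΩs (hu ▸ mem_univ _) hp
    exact ne_neg_of_mem_unit_sphere ℝ p this.symm
  · exact φ.isEmbedding.secondCountableTopology
  · intro x r hr
    exact ENNReal.toReal_pos (hdbl.1 x r hr).1.ne' (measure_ne_top _ _)
  · intro x r hr
    have := ENNReal.toReal_mono (by finiteness) (hdbl.2 x r hr)
    simpa [mb, Measure.real] using this
  · exact fun x y => dist_comm _ _
  · exact fun x y z => dist_triangle _ _ _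
  · exact fun x y => by simp
  · exact fun δ hδ x y => ne_top_of_le_ne_top (hqt x y) (qDelta_le_qmu μ hδ x y)
  · exact fun δ hδ x y => (ENNReal.toReal_mono (hqt x y) (qDelta_le_qmu μ hδ x y)).trans_eq (hqr x y).symm
  · intro x y c hc
    have hf : ∀ δ > 0, qDelta μ 2 δ x y ≠ ⊤ := fun δ hδ => ne_top_of_le_ne_top (hqt x y) (qDelta_le_qmu μ hδ x y)
    rcases lt_or_ge c 0 with h | h
    · exact ⟨1, one_pos, h.trans_le (qd_nonneg _ _ _ _)⟩
    have h1 : ENNReal.ofReal c < qmu μ 2 x y := by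
      rw [ENNReal.ofReal_lt_iff_lt_toReal h (hqt x y), ← hqr]; exact hc
    obtain ⟨δ, h2, hδ⟩ := ((frequently_lt_of_lt_limsup (by isBoundedDefault) h1).and_eventually self_mem_nhdsWithin).exists
    exact ⟨δ, hδ, (ENNReal.ofReal_lt_iff_lt_toReal h (hf δ hδ)).1 h2⟩
  · intro x y
    have := ENNReal.toReal_mono (by have := hqt x y; finiteness) (hw x y)
    rw [frE, ENNReal.toReal_ofReal (fr_nonneg _ _ _), ENNReal.toReal_mul] at this
    simpa [hqr] using this

theorem lam_le_ell {lam : ℝ} (h : 1 ≤ lam) : lam ≤ 2 ^ ellOf lam := by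
  have h1 : Real.logb 2 lam ≤ (ellOf lam : ℝ) := by
    refine (Int.le_ceil _).trans ?_
    exact_mod_cast Int.self_le_toNat _
  rwa [Real.logb_le_iff_le_rpow (by norm_num) (by linarith), Real.rpow_natCast] at h1

end

section
set_option linter.unusedSectionVars false

namespace Hyp
variable {X : Type*} [MetricSpace X] [MeasurableSpace X]
variable {μ : Measure X} {lam CD CW : ℝ} {Q : X → X → ℝ} (H : Hyp μ lam CD CW Q)
include H
variable {Y : Type*} [MetricSpace Y] {e : X ≃ Y} (hq : ∀ x y, dist (e x) (e y) = Q x y) {C1 : ℝ}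
  (hC1 : 0 < C1) (hloc : ∀ p : X, ∃ R > 0, IsCompact (closedBall p R) ∧
    ∀ x ∈ Metric.ball p R, ∀ y ∈ Metric.ball p R, Q x y ≤ C1 * √(mb μ x (dist x y)))
include hq hloc hC1

theorem lowA (p : X) : ∃ r0 > 0, ∀ x, Q p x < r0 → ∀ r, 0 < r → r < r0 →
    r ^ 2 ≤ C1 ^ 2 * CD * μ.real {y | Q x y < r} := by
  have := H.fin
  obtain ⟨R, hR, -, hl⟩ := hloc p
  obtain ⟨D0, hD0, hfar⟩ := H.exists_far
  obtain ⟨y0, hy0⟩ := hfar p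
  have hm : 0 < min (R / 4) D0 := by positivity
  obtain ⟨y1, hy1⟩ := H.exists_dist hm.le ((min_le_right _ _).trans hy0)
  have ha : 0 < Q p y1 := (H.qnn _ _).lt_of_ne fun h => by
    rw [← (H.qzero _ _).1 h.symm, dist_self] at hy1; linarith
  obtain ⟨r1, hr1, h1⟩ := H.symm_cont hq p (ε := R / 8) (by positivity)
  refine ⟨min r1 (Q p y1 / 2), by positivity, fun x hx r hr hrr => ?_⟩
  have hxp := h1 x (hx.trans_le (min_le_left _ _))
  have hx2 := hx.trans_le (min_le_right _ _)
  have hr2 := hrr.trans_le (min_le_right _ _)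
  have hA : r ≤ Q x y1 := by linarith [H.qtri p x y1]
  have hyR : dist p y1 ≤ R / 4 := hy1 ▸ min_le_left _ _
  set A := {y | r ≤ Q x y}
  have hne : A.Nonempty := ⟨y1, hA⟩
  obtain ⟨σ, hσ, hσ'⟩ := H.q_cont hq hC1 hloc x hr
  have hs : σ ≤ infDist x A := (le_infDist hne).2 fun y hy => by
    by_contra! hc
    exact absurd (hσ' y hc) (not_lt.2 hy)
  set s := infDist x A
  have hs1 : s ≤ dist x y1 := infDist_le_dist_of_mem hA
  obtain ⟨y, hy, hys⟩ := (infDist_lt_iff hne (r := 2 * s)).1 (by linarith)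
  have hd1 : dist x y1 < 3 * R / 8 := by linarith [dist_triangle x p y1, dist_comm x p]
  have h2 := hl x (by rw [Metric.mem_ball, dist_comm]; linarith) y
    (by rw [Metric.mem_ball, dist_comm]; linarith [dist_triangle p x y])
  have h3 : r ^ 2 ≤ (C1 * √(mb μ x (dist x y))) ^ 2 := pow_le_pow_left₀ hr.le (le_trans hy h2) 2
  rw [mul_pow, Real.sq_sqrt (mb_nonneg _ _ _)] at h3
  have h4 : mb μ x s ≤ μ.real {y | Q x y < r} := measureReal_mono fun z hz => by
    by_contra hc
    have := infDist_le_dist_of_mem (s := A) (x := x) (y := z) (show r ≤ Q x z from not_lt.1 hc)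
    rw [Metric.mem_ball, dist_comm] at hz; linarith
  have h5 := (H.mb_mono x hys.le).trans (H.dbl x s (by linarith))
  have := H.CD_pos
  calc r ^ 2 ≤ C1 ^ 2 * (CD * μ.real {y | Q x y < r}) := h3.trans (by gcongr; exact h5.trans (by gcongr))
    _ = _ := by ring

theorem upA (p : X) : ∃ r0 > 0, ∀ x, Q p x < r0 → ∀ r, 0 < r → r < r0 →
    μ.real {y | Q x y < r} ≤ CD ^ 2 * CW ^ 2 * r ^ 2 := by
  have := H.fin
  obtain ⟨r1, hr1, h1⟩ := H.symm_cont hq p (ε := 1) one_pos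
  have hCD := H.CD_pos; have hCW := H.CW_pos
  refine ⟨r1 / 2, by positivity, fun x hx r hr hrr => ?_⟩
  have hbd : BddAbove (dist x '' {y | Q x y < r}) := ⟨2, by
    rintro _ ⟨y, hy, rfl⟩
    have hy : Q x y < r := hy
    linarith [h1 x (by linarith), h1 y (by linarith [H.qtri p x y]), dist_triangle_left x y p]⟩
  set S := sSup (dist x '' {y | Q x y < r})
  have hS : 0 < S := by
    obtain ⟨σ, hσ, hσ'⟩ := H.q_cont hq hC1 hloc x hr
    obtain ⟨D0, hD0, hfar⟩ := H.exists_far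
    obtain ⟨y0, hy0⟩ := hfar x
    have hm : 0 < min (σ / 2) D0 := by positivity
    obtain ⟨y1, hy1⟩ := H.exists_dist hm.le ((min_le_right _ _).trans hy0)
    refine lt_of_lt_of_le hm (hy1 ▸ le_csSup hbd (mem_image_of_mem _ (hσ' y1 ?_)))
    rw [hy1]; exact (min_le_left _ _).trans_lt (by linarith)
  obtain ⟨_, ⟨y, hy, rfl⟩, hyS⟩ := exists_lt_of_lt_csSup (s := dist x '' {y | Q x y < r}) (b := S / 2)
    ⟨_, mem_image_of_mem _ (show Q x x < r by rwa [(H.qzero _ _).2 rfl])⟩ (by linarith)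
  have h4 : μ.real {y | Q x y < r} ≤ mb μ x (2 ^ 2 * dist x y) := measureReal_mono fun z hz => by
    have := le_csSup hbd (mem_image_of_mem (dist x) hz)
    rw [Metric.mem_ball, dist_comm]; linarith
  have h5 := H.dbl_pow x (r := dist x y) (by linarith) 2
  have h6 := (H.mb_le_fr x y).trans (pow_le_pow_left₀ (fr_nonneg _ _ _) (H.wm x y) 2)
  have h7 : (CW * Q x y) ^ 2 ≤ CW ^ 2 * r ^ 2 := by rw [mul_pow]; gcongr; exacts [H.qnn _ _, le_of_lt hy]
  calc _ ≤ CD ^ 2 * (CW ^ 2 * r ^ 2) := h4.trans (h5.trans (by gcongr; exact h6.trans h7))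
    _ = _ := by ring

theorem upR (x : X) {r0 : ℝ} (hr0 : 0 < r0) : ∃ r, 0 < r ∧ r < r0 ∧ μ.real {y | Q x y < r} ≤ CW ^ 2 * r ^ 2 := by
  have := H.fin
  have hCD := H.CD_pos; have hCW := H.CW_pos
  obtain ⟨σ, hσ, hσ'⟩ := H.q_cont hq hC1 hloc x hr0
  obtain ⟨D0, hD0, hfar⟩ := H.exists_far
  obtain ⟨y0, hy0⟩ := hfar x
  have hm : 0 < min (σ / 2) D0 := by positivity
  obtain ⟨y1, hy1⟩ := H.exists_dist hm.le ((min_le_right _ _).trans hy0)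
  set m := min (σ / 2) D0
  set S := m / 2
  set I := (Q x) '' {z | S < dist x z}
  have hy1I : Q x y1 ∈ I := mem_image_of_mem _ (show S < dist x y1 by rw [hy1]; simp only [S]; linarith)
  have hbd : BddBelow I := ⟨0, by rintro _ ⟨z, -, rfl⟩; exact H.qnn _ _⟩
  have hcb : √(μ.real (closedBall x S)) / CW ≤ sInf I := le_csInf ⟨_, hy1I⟩ (by
    rintro _ ⟨z, hz, rfl⟩
    rw [div_le_iff₀' hCW]
    refine le_trans (Real.sqrt_le_sqrt ?_) (H.sqrt_mb_le_q x z le_rfl)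
    exact measureReal_mono (closedBall_subset_ball hz))
  have hpos : 0 < μ.real (closedBall x S) := (H.pos x S (by positivity)).trans_le (measureReal_mono ball_subset_closedBall)
  have hI : 0 < sInf I := lt_of_lt_of_le (by positivity) hcb
  refine ⟨sInf I, hI, (csInf_le hbd hy1I).trans_lt (hσ' _ ?_), ?_⟩
  · rw [hy1]; exact (min_le_left _ _).trans_lt (by linarith)
  · have h1 : μ.real {y | Q x y < sInf I} ≤ μ.real (closedBall x S) := measureReal_mono fun z hz => by
      rw [mem_closedBall, dist_comm]
      by_contra! hc
      exact absurd (csInf_le hbd (mem_image_of_mem (Q x) (show S < dist x z from hc))) (not_le.2 hz)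
    rw [div_le_iff₀ hCW] at hcb
    have := (Real.sqrt_le_left (by positivity)).1 hcb
    linarith [mul_pow (sInf I) CW 2]

theorem llc2Q {l : ℕ} (hl : lam ≤ 2 ^ l) (p : X) : ∃ r0 > 0, ∀ x y z, Q p x < r0 → Q p y < r0 → Q p z < r0 → ∀ r > 0,
    r ≤ Q x y → r ≤ Q x z → ∃ K : Set X, IsPreconnected K ∧ y ∈ K ∧ z ∈ K ∧ ∀ a ∈ K, r ≤ C1 * CD ^ l * CW * Q x a := by
  obtain ⟨R, hR, -, hloc⟩ := hloc p
  obtain ⟨r1, hr1, h1⟩ := H.symm_cont hq p hR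
  have hCD := H.CD_pos; have hCW := H.CW_pos; have hlam := H.hlam
  refine ⟨r1, hr1, fun x y z hx hy hz r hr hxy hxz => ?_⟩
  have hb : ∀ a, Q p a < r1 → a ∈ Metric.ball p R := fun a ha => by
    rw [Metric.mem_ball, dist_comm]; exact h1 a ha
  obtain ⟨D, hD, hDy, hDz, w, hw, hwD⟩ : ∃ D, 0 < D ∧ D ≤ dist x y ∧ D ≤ dist x z ∧ ∃ w, r ≤ C1 * √(mb μ x w) ∧ w = D := by
    have hy' := hloc x (hb x hx) y (hb y hy)
    have hz' := hloc x (hb x hx) z (hb z hz)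
    have hp : ∀ a, r ≤ Q x a → 0 < dist x a := fun a ha => dist_pos.2 fun h => by
      rw [h, (H.qzero _ _).2 rfl] at ha; linarith
    rcases le_total (dist x y) (dist x z) with h | h
    · exact ⟨_, hp y hxy, le_rfl, h, _, hxy.trans hy', rfl⟩
    · exact ⟨_, hp z hxz, h, le_rfl, _, hxz.trans hz', rfl⟩
  subst hwD
  obtain ⟨K, hK, hKb, hyK, hzK⟩ := (H.llc x w hD).2 y z (by rw [Metric.mem_ball, dist_comm]; linarith)
    (by rw [Metric.mem_ball, dist_comm]; linarith)
  refine ⟨K, hK.2.isPreconnected, hyK, hzK, fun a ha => ?_⟩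
  have h2 : w / lam ≤ dist x a := by have := hKb ha; rwa [mem_compl_iff, Metric.mem_ball, dist_comm, not_lt] at this
  have h3 := H.sqrt_mb_le_q x a h2
  have h4 := H.sqrt_mb_le (x := x) (z := x) (r := w) (s := w / lam) (by positivity) l (by
    rw [dist_self, add_zero, mul_div_assoc', le_div_iff₀ (by positivity), mul_comm]
    refine mul_le_mul_of_nonneg_right (hl.trans (pow_le_pow_right₀ one_le_two (by omega))) hD.le)
  calc r ≤ C1 * (CD ^ l * (CW * Q x a)) := hw.trans (by gcongr; exact h4.trans (by gcongr))
    _ = _ := by ring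

theorem udini {K : Set X} (hK : IsCompact K) {ε : ℝ} (hε : 0 < ε) : ∃ δ0 > 0, ∀ δ, 0 < δ → δ ≤ δ0 →
    ∀ a ∈ K, ∀ b ∈ K, Q a b ≤ qd μ δ a b + ε := by
  have hE : ∀ x : X × X, ∃ δ > 0, Q x.1 x.2 - ε / 8 < qd μ δ x.1 x.2 := fun x => H.qsup x.1 x.2 _ (by linarith)
  choose δ hδ hd using hE
  choose r hr h using fun x => H.q_cont hq hC1 hloc x (ε := ε / 8) (by positivity)
  choose s hs h' using fun x => H.fr_small x (η := ε / 8) (by positivity)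
  let ρ : X × X → X → ℝ := fun x a => min (δ x) (min (r a) (s a))
  have hρ : ∀ x a, 0 < ρ x a := fun x a => lt_min (hδ x) (lt_min (hr a) (hs a))
  obtain ⟨t, -, ht⟩ := (hK.prod hK).elim_nhds_subcover (fun x => Metric.ball x.1 (ρ x x.1) ×ˢ Metric.ball x.2 (ρ x x.2))
    (fun x _ => prod_mem_nhds (ball_mem_nhds _ (hρ _ _)) (ball_mem_nhds _ (hρ _ _)))
  obtain ⟨δ0, hδ0, hmin⟩ : ∃ δ0 > 0, ∀ x ∈ t, δ0 ≤ δ x := by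
    rcases t.eq_empty_or_nonempty with rfl | hne
    · exact ⟨1, one_pos, by simp⟩
    · obtain ⟨x, hx, hm⟩ := t.exists_min_image δ hne
      exact ⟨δ x, hδ x, hm⟩
  refine ⟨δ0, hδ0, fun δ' hδ' hle a ha b hb => ?_⟩
  obtain ⟨x, hx, hxa, hxb⟩ : ∃ x ∈ t, a ∈ Metric.ball x.1 (ρ x x.1) ∧ b ∈ Metric.ball x.2 (ρ x x.2) := by
    obtain ⟨x, hx, h⟩ := mem_iUnion₂.1 (ht (show (a, b) ∈ K ×ˢ K from ⟨ha, hb⟩))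
    exact ⟨x, hx, h⟩
  rw [Metric.mem_ball] at hxa hxb
  have e1 := H.qd_anti hδ' (hle.trans (hmin x hx)) a b
  have k1 : ∀ a i, dist a i < ρ x i → Q i a < ε / 8 ∧ qd μ (δ x) i a < ε / 8 := fun a i hai => by
    have ha1 := hai.trans_le (min_le_left _ _)
    have ha2 := (hai.trans_le (min_le_right _ _)).trans_le (min_le_left _ _)
    have ha3 := (hai.trans_le (min_le_right _ _)).trans_le (min_le_right _ _)
    exact ⟨h i a (by rwa [dist_comm]), (H.qd_le_fr (by rw [dist_comm]; exact ha1.le)).trans_lt (h' i a ha3)⟩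
  obtain ⟨a1, a2⟩ := k1 a _ hxa
  obtain ⟨b1, b2⟩ := k1 b _ hxb
  have := hd x
  linarith [H.qtri a x.1 b, H.qtri x.1 x.2 b, H.qsymm a x.1, H.qd_tri (hδ x) x.1 a x.2, H.qd_tri (hδ x) a b x.2, qd_comm μ (δ x) b x.2]

theorem lenQ (p : X) : ∃ r0 > 0, ∀ x y, Q p x < r0 → Q p y < r0 → ∀ ε > 0, ∃ L : Set X, IsPreconnected L ∧
    x ∈ L ∧ y ∈ L ∧ ∀ z ∈ L, Q x z ≤ Q x y + ε ∧ ∀ z' ∈ L, Q z z' ≤ |Q x z - Q x z'| + ε := by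
  have hlam := H.hlam
  obtain ⟨R, hR, hK, hl⟩ := hloc p
  obtain ⟨r1, hr1, h1⟩ := H.symm_cont hq p (ε := R / 2) (by positivity)
  refine ⟨r1 / 4, by positivity, fun x y hx hy ε' hε' => ?_⟩
  obtain ⟨ε, hε, hε1, hε2⟩ : ∃ ε > 0, 10 * ε ≤ ε' ∧ 10 * ε ≤ r1 := ⟨min ε' r1 / 10, by positivity,
    by linarith [min_le_left ε' r1], by linarith [min_le_right ε' r1]⟩
  obtain ⟨δ0, hδ0, hd⟩ := H.udini hq hC1 hloc hK hε
  obtain ⟨r2, hr2, h2⟩ := H.mb_unif hK (η := (ε / C1) ^ 2) (by positivity)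
  obtain ⟨δ, hδ, hδ1, hδ2, hδ3⟩ : ∃ δ > 0, δ ≤ δ0 ∧ lam * (2 * δ) < r2 ∧ lam * (2 * δ) < R / 2 :=
    ⟨min δ0 (min r2 (R / 2) / (4 * lam)), by positivity, min_le_left _ _, by
      have : lam * (2 * min δ0 (min r2 (R / 2) / (4 * lam))) ≤ lam * (2 * (min r2 (R / 2) / (4 * lam))) := by
        gcongr; exact min_le_right _ _
      refine this.trans_lt ?_
      rw [show lam * (2 * (min r2 (R / 2) / (4 * lam))) = min r2 (R / 2) / 2 by field_simp; norm_num]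
      linarith [min_le_left r2 (R / 2)], by
      have : lam * (2 * min δ0 (min r2 (R / 2) / (4 * lam))) ≤ lam * (2 * (min r2 (R / 2) / (4 * lam))) := by
        gcongr; exact min_le_right _ _
      refine this.trans_lt ?_
      rw [show lam * (2 * (min r2 (R / 2) / (4 * lam))) = min r2 (R / 2) / 2 by field_simp; norm_num]
      linarith [min_le_right r2 (R / 2)]⟩
  have hdl : 2 * δ ≤ lam * (2 * δ) := le_mul_of_one_le_left (by positivity) hlam
  obtain ⟨z, m, ⟨hz0, hzm, hzs⟩, hsum⟩ := H.exists_chain hδ (x := x) (y := y) (c := Q x y + ε) (by linarith [H.qle δ hδ x y])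
  have hseg : ∀ i j, i ≤ j → j ≤ m → qd μ δ (z i) (z j) ≤
      ∑ k ∈ Finset.range j, fr μ (z k) (z (k + 1)) - ∑ k ∈ Finset.range i, fr μ (z k) (z (k + 1)) := by
    intro i j hij hjm
    induction j, hij using Nat.le_induction with
    | base => simp [H.qd_self hδ]
    | succ j hij ih =>
      rw [Finset.sum_range_succ]
      linarith [ih (by omega), H.qd_tri hδ (z i) (z j) (z (j + 1)), H.qd_le_fr (hzs j (by omega))]
  have hmono : ∀ j ≤ m, ∑ k ∈ Finset.range j, fr μ (z k) (z (k + 1)) < Q x y + ε := fun j hj =>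
    (Finset.sum_le_sum_of_subset_of_nonneg (Finset.range_mono hj) fun _ _ _ => fr_nonneg _ _ _).trans_lt hsum
  have hQxy : Q x y < r1 / 2 := by linarith [H.qtri x p y, H.qsymm x p]
  have hxR : dist p x < R / 2 := h1 x (by linarith)
  have hin : ∀ j ≤ m, dist p (z j) < R / 2 := by
    intro j
    induction j with
    | zero => intro _; rwa [hz0]
    | succ j ih =>
      intro hj
      have a1 := ih (by omega)
      have a2 := hd δ hδ hδ1 x (by rw [mem_closedBall, dist_comm]; linarith) (z (j + 1))
        (by rw [mem_closedBall, dist_comm]; linarith [dist_triangle p (z j) (z (j + 1)), hzs j (by omega)])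
      have a3 := hseg 0 (j + 1) (by omega) hj
      rw [hz0, Finset.range_zero, Finset.sum_empty, sub_zero] at a3
      exact h1 _ (by linarith [hmono _ hj, H.qtri p x (z (j + 1))])
  have hzK : ∀ j ≤ m, z j ∈ closedBall p R := fun j hj => by rw [mem_closedBall, dist_comm]; linarith [hin j hj]
  set S : ℕ → ℝ := fun j => ∑ k ∈ Finset.range j, fr μ (z k) (z (k + 1))
  have hQs : ∀ i j, i ≤ j → j ≤ m → Q (z i) (z j) ≤ S j - S i + ε := fun i j hij hjm => by
    linarith [hseg i j hij hjm, hd δ hδ hδ1 _ (hzK i (hij.trans hjm)) _ (hzK j hjm)]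
  have hS0 : S 0 = 0 := by simp [S]
  have hup : ∀ j ≤ m, Q x (z j) ≤ S j + ε := fun j hj => by
    have := hQs 0 j (by omega) hj; rw [hz0, hS0] at this; linarith
  have hlo : ∀ j ≤ m, S j - 2 * ε ≤ Q x (z j) := fun j hj => by
    have := hQs j m hj le_rfl
    rw [hzm] at this
    have := hmono m le_rfl
    linarith [H.qtri x (z j) y]
  have hpair' : ∀ i j, i ≤ j → j ≤ m → Q (z i) (z j) ≤ |Q x (z i) - Q x (z j)| + 4 * ε := fun i j hij hj => by
    have := neg_abs_le (Q x (z i) - Q x (z j))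
    linarith [hQs i j hij hj, hup i (hij.trans hj), hlo j hj]
  have hpair : ∀ i j, i ≤ m → j ≤ m → Q (z i) (z j) ≤ |Q x (z i) - Q x (z j)| + 4 * ε := fun i j hi hj => by
    rcases le_total i j with h | h
    · exact hpair' i j h hj
    · rw [abs_sub_comm, H.qsymm]; exact hpair' j i h hi
  have hKs : ∀ j, ∃ K : Set X, j ≤ m → IsPreconnected K ∧ z j ∈ K ∧ (j < m → z (j + 1) ∈ K) ∧ ∀ a ∈ K, Q (z j) a ≤ ε := by
    intro j
    by_cases hj : j < m
    · obtain ⟨K, hK, hKb, k1, k2⟩ := H.llc1 (z j) (r := 2 * δ) (by positivity) (y := z j) (z := z (j + 1)) (by simpa using hδ)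
        (by rw [dist_comm]; linarith [hzs j hj])
      refine ⟨K, fun _ => ⟨hK.2.isPreconnected, k1, fun _ => k2, fun a ha => ?_⟩⟩
      have := hKb a ha
      have b1 := hin j hj.le
      refine (hl (z j) (by rw [Metric.mem_ball, dist_comm]; linarith) a
        (by rw [Metric.mem_ball, dist_comm]; linarith [dist_triangle p (z j) a, dist_comm a (z j)])).trans ?_
      have : √(mb μ (z j) (dist (z j) a)) ≤ ε / C1 := Real.sqrt_le_iff.2 ⟨by positivity,
        ((H.mb_mono _ (by rw [dist_comm]; linarith)).trans_lt (h2 _ (hzK j hj.le))).le⟩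
      rw [le_div_iff₀ hC1] at this; linarith
    · exact ⟨{z j}, fun _ => ⟨isPreconnected_singleton, rfl, fun h => absurd h hj, fun a ha => by
        rw [mem_singleton_iff.1 ha, (H.qzero _ _).2 rfl]; exact hε.le⟩⟩
  choose K hKK using hKs
  have hpre : ∀ n ≤ m, IsPreconnected (⋃ j ∈ Iic n, K j) := fun n hn => by
    refine IsPreconnected.biUnion_of_chain ordConnected_Iic (fun j hj => (hKK j (le_trans hj hn)).1) ?_
    intro j hj hj'
    have hj' : j + 1 ≤ n := hj'
    exact ⟨z (j + 1), (hKK j (by omega)).2.2.1 (by omega), (hKK (j + 1) (by omega)).2.1⟩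
  refine ⟨⋃ j ∈ Iic m, K j, hpre m le_rfl, mem_biUnion (mem_Iic.2 (Nat.zero_le m)) (hz0 ▸ (hKK 0 (by omega)).2.1),
    mem_biUnion (mem_Iic.2 le_rfl) (hzm ▸ (hKK m le_rfl).2.1), fun a ha => ?_⟩
  simp only [mem_iUnion, mem_Iic] at ha
  obtain ⟨i, hi, hai⟩ := ha
  have ai := (hKK i hi).2.2.2 a hai
  have a1 := H.qtri x (z i) a
  have a2 := H.qtri x a (z i)
  have a3 := H.qsymm a (z i)
  refine ⟨by linarith [hup i hi, hmono i hi], fun b hb => ?_⟩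
  simp only [mem_iUnion, mem_Iic] at hb
  obtain ⟨j, hj, hbj⟩ := hb
  have bj := (hKK j hj).2.2.2 b hbj
  have b1 := H.qtri x (z j) b
  have b2 := H.qtri x b (z j)
  have b3 := H.qsymm b (z j)
  have := hpair i j hi hj
  have c1 := H.qtri a (z i) b
  have c2 := H.qtri (z i) (z j) b
  have : |Q x (z i) - Q x (z j)| ≤ |Q x a - Q x b| + 2 * ε := by
    rw [abs_le]
    have := neg_abs_le (Q x a - Q x b)
    have := le_abs_self (Q x a - Q x b)
    constructor <;> linarith
  linarith
end Hyp

end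

section
set_option linter.unusedSectionVars false

structure HypY {Y : Type*} [MetricSpace Y] [MeasurableSpace Y] (ν : Measure Y) (κ c : ℝ) : Prop where
  bor : BorelSpace Y
  fin : IsFiniteMeasure ν
  hom : ∃ Ω₀ : Set ↥Sphere2, IsOpen Ω₀ ∧ Nonempty (Y ≃ₜ ↥Ω₀)
  lc : LocallyCompactSpace Y
  conn : PreconnectedSpace Y
  nontriv : Nontrivial Y
  sc : SecondCountableTopology Y
  hκ : 1 ≤ κ
  hc : 0 < c
  lowA : ∀ p, ∃ r0 > 0, ∀ x, dist p x < r0 → ∀ r, 0 < r → r < r0 → r ^ 2 ≤ κ * ν.real (Metric.ball x r)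
  upA : ∀ p, ∃ r0 > 0, ∀ x, dist p x < r0 → ∀ r, 0 < r → r < r0 → ν.real (Metric.ball x r) ≤ κ * r ^ 2
  up : ∀ x, ∀ r0 > 0, ∃ r, 0 < r ∧ r < r0 ∧ ν.real (Metric.ball x r) ≤ c * r ^ 2
  haus : ∀ E, (@Measure.hausdorffMeasure Y _ _ bor 2) E ≤ ENNReal.ofReal κ * ν E
  llc2 : ∀ p, ∃ r0 > 0, ∀ x y z, dist p x < r0 → dist p y < r0 → dist p z < r0 → ∀ r > 0,
    r ≤ dist x y → r ≤ dist x z → ∃ K : Set Y, IsPreconnected K ∧ y ∈ K ∧ z ∈ K ∧ ∀ a ∈ K, r ≤ κ * dist x a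
  len : ∀ p, ∃ r0 > 0, ∀ x y, dist p x < r0 → dist p y < r0 → ∀ ε > 0, ∃ L : Set Y, IsPreconnected L ∧
    x ∈ L ∧ y ∈ L ∧ ∀ z ∈ L, dist x z ≤ dist x y + ε ∧ ∀ z' ∈ L, dist z z' ≤ |dist x z - dist x z'| + ε

theorem Hyp.mkY {X : Type*} [MetricSpace X] [MeasurableSpace X]
    {μ : Measure X} {lam CD CW : ℝ} {Q : X → X → ℝ} (H : Hyp μ lam CD CW Q)
    {Y : Type*} [MetricSpace Y] {e : X ≃ Y} (hq : ∀ x y, dist (e x) (e y) = Q x y) {C1 : ℝ}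
    (hC1 : 0 < C1) (hloc : ∀ p : X, ∃ R > 0, IsCompact (closedBall p R) ∧
    ∀ x ∈ Metric.ball p R, ∀ y ∈ Metric.ball p R, Q x y ≤ C1 * √(mb μ x (dist x y))) 
    [MeasurableSpace Y] [BorelSpace Y] {l : ℕ} (hl : lam ≤ 2 ^ l) :
    ∃ κ, HypY (μ.map e) κ (CW ^ 2) := by
  have := H.fin; have := H.bor; have := H.lc; have := H.conn; have := H.nontriv; have := H.sc
  have hCD := H.CD_pos; have hCW := H.CW_pos
  obtain ⟨hc1, hc2⟩ := H.homeo hq hC1 hloc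
  let eh : X ≃ₜ Y := ⟨e, hc1, hc2⟩
  obtain ⟨Ω, hΩ, ⟨φ⟩⟩ := H.hom
  have hmap : ∀ A : Set Y, (μ.map e) A = μ (e ⁻¹' A) := fun A => (eh.toMeasurableEquiv).map_apply (μ := μ) A
  have hball : ∀ x r, (μ.map e).real (Metric.ball (e x) r) = μ.real {y | Q x y < r} := fun x r => by
    rw [Measure.real, hmap]
    congr 2; ext y
    simp [← hq, dist_comm]
  obtain ⟨κ, k0, k1, k2, k3, k4⟩ : ∃ κ, 1 ≤ κ ∧ C1 ^ 2 * CD ≤ κ ∧ CD ^ 2 * CW ^ 2 ≤ κ ∧ 4 * C1 ^ 2 * CD ^ 2 ≤ κ ∧ C1 * CD ^ l * CW ≤ κ := by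
    refine ⟨1 + C1 ^ 2 * CD + CD ^ 2 * CW ^ 2 + 4 * C1 ^ 2 * CD ^ 2 + C1 * CD ^ l * CW, ?_, ?_, ?_, ?_, ?_⟩
    all_goals
      have h1 : 0 < C1 ^ 2 * CD := by positivity
      have h2 : 0 < CD ^ 2 * CW ^ 2 := by positivity
      have h3 : 0 < 4 * C1 ^ 2 * CD ^ 2 := by positivity
      have h4 : 0 < C1 * CD ^ l * CW := by positivity
      linarith
  refine ⟨κ, ⟨‹_›, inferInstance, ⟨Ω, hΩ, ⟨eh.symm.trans φ⟩⟩, eh.symm.isOpenEmbedding.locallyCompactSpace, 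
    e.surjective.denseRange.preconnectedSpace hc1, e.symm.nontrivial, eh.symm.isEmbedding.secondCountableTopology,
    k0, by positivity, ?_, ?_, ?_, ?_, ?_, ?_⟩⟩
  · refine e.surjective.forall.2 fun p => ?_
    obtain ⟨r0, h0, h⟩ := H.lowA hq hC1 hloc p
    refine ⟨r0, h0, e.surjective.forall.2 fun x hx r hr hr' => ?_⟩
    rw [hball]
    exact (h x (by rwa [← hq]) r hr hr').trans (mul_le_mul_of_nonneg_right k1 measureReal_nonneg)
  · refine e.surjective.forall.2 fun p => ?_
    obtain ⟨r0, h0, h⟩ := H.upA hq hC1 hloc p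
    refine ⟨r0, h0, e.surjective.forall.2 fun x hx r hr hr' => ?_⟩
    rw [hball]
    exact (h x (by rwa [← hq]) r hr hr').trans (mul_le_mul_of_nonneg_right k2 (by positivity))
  · refine e.surjective.forall.2 fun x r0 hr0 => ?_
    obtain ⟨r, h1, h2, h⟩ := H.upR hq hC1 hloc x hr0
    exact ⟨r, h1, h2, by rwa [hball]⟩
  · intro E
    have := H.haus_le hq hC1 hloc (e ⁻¹' E)
    rw [e.image_preimage, ← hmap] at this
    exact this.trans (by gcongr)
  · refine e.surjective.forall.2 fun p => ?_
    obtain ⟨r0, h0, h⟩ := H.llc2Q hq hC1 hloc hl p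
    refine ⟨r0, h0, e.surjective.forall.2 fun x => e.surjective.forall.2 fun y => e.surjective.forall.2 fun z => ?_⟩
    simp only [hq]
    intro hx hy hz r hr h1 h2
    obtain ⟨K, k1, k2, k3, k5⟩ := h x y z hx hy hz r hr h1 h2
    refine ⟨e '' K, k1.image _ hc1.continuousOn, mem_image_of_mem _ k2, mem_image_of_mem _ k3, ?_⟩
    rintro _ ⟨a, ha, rfl⟩
    rw [hq]
    exact (k5 a ha).trans (mul_le_mul_of_nonneg_right k4 (H.qnn _ _))
  · refine e.surjective.forall.2 fun p => ?_
    obtain ⟨r0, h0, h⟩ := H.lenQ hq hC1 hloc p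
    refine ⟨r0, h0, e.surjective.forall.2 fun x => e.surjective.forall.2 fun y => ?_⟩
    simp only [hq]
    intro hx hy ε hε
    obtain ⟨K, k1, k2, k3, k5⟩ := h x y hx hy ε hε
    refine ⟨e '' K, k1.image _ hc1.continuousOn, mem_image_of_mem _ k2, mem_image_of_mem _ k3, ?_⟩
    rintro _ ⟨a, ha, rfl⟩
    refine ⟨by rw [hq]; exact (k5 a ha).1, ?_⟩
    rintro _ ⟨b, hb, rfl⟩
    simp only [hq]
    exact (k5 a ha).2 b hb

end

section
set_option linter.unusedSectionVars false

namespace HypY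
variable {Y : Type*} [MetricSpace Y] [MeasurableSpace Y] {ν : Measure Y} {κ c : ℝ} (H : HypY ν κ c)
include H

theorem exists_far (p : Y) : ∃ D0 > 0, ∀ r, 0 ≤ r → r ≤ D0 → ∃ y, dist p y = r := by
  have := H.nontriv
  obtain ⟨y, hy⟩ := exists_ne p
  have := H.conn
  refine ⟨dist p y, dist_pos.2 hy.symm, fun r h0 hr => ?_⟩
  obtain ⟨z, -, hz⟩ := isPreconnected_univ.intermediate_value (mem_univ p) (mem_univ y)
    (f := fun z => dist p z) (by fun_prop) (show r ∈ Icc _ _ from ⟨by simpa using h0, hr⟩)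
  exact ⟨z, hz⟩

theorem cball (p : Y) : ∃ r0 > 0, ∀ r ≤ r0, IsCompact (closedBall p r) := by
  have := H.lc
  obtain ⟨R1, hR1, hc⟩ := (nhds_basis_closedBall.mem_iff).1 (exists_compact_mem_nhds p).choose_spec.2
  exact ⟨R1, hR1, fun r hr => (exists_compact_mem_nhds p).choose_spec.1.of_isClosed_subset isClosed_closedBall
    ((closedBall_subset_closedBall hr).trans hc)⟩

theorem stab (p : Y) : ∃ r0 > 0, ∀ R, 0 < R → R < r0 → ∃ w, dist p w = R / 2 ∧ ∀ c0, c0 = R / (2 * κ) →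
    ∀ f g : Y → ℝ, Continuous f → Continuous g → (∀ a, |f a - dist w a| ≤ c0 / 100) → (∀ a, |g a - dist p a| ≤ c0 / 100) →
    ∀ t s, c0 / 2 < t → t < 3 * c0 / 4 → |s - R / 2| < c0 / 100 → ∃ a, f a = t ∧ g a = s := by
  obtain ⟨r1, hr1, h1⟩ := H.exists_far p
  obtain ⟨r2, hr2, h2⟩ := H.cball p
  obtain ⟨r3, hr3, h3⟩ := H.llc2 p
  obtain ⟨r4, hr4, h4⟩ := H.len p
  have hκ := H.hκ
  refine ⟨min (min r1 r2) (min r3 r4), by positivity, fun R hR hRr => ?_⟩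
  simp only [lt_min_iff] at hRr
  obtain ⟨⟨hR1, hR2⟩, hR3, hR4⟩ := hRr
  obtain ⟨y, hy⟩ := h1 R hR.le hR1.le
  have hc0 : 0 < R / (2 * κ) := by positivity
  have hc0R : R / (2 * κ) ≤ R / 2 := by gcongr; linarith
  have hcκ : R / (2 * κ) * κ = R / 2 := by field_simp
  generalize hcd : R / (2 * κ) = c0 at hc0 hc0R hcκ
  obtain ⟨L, hL, hpL, hyL, hLL⟩ := h4 p y (by simpa using hr4) (by linarith) (c0 / 1000) (by positivity)
  obtain ⟨w, hwL, hw⟩ := hL.intermediate_value hpL hyL (f := fun z => dist p z) (by fun_prop)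
    (show R / 2 ∈ Icc _ _ from ⟨by rw [dist_self]; positivity, by rw [hy]; linarith⟩)
  dsimp only at hw
  refine ⟨w, hw, ?_⟩
  rintro c0 rfl f g hf hg hfu hgv t s ht1 ht2 hs
  obtain ⟨K, hK, hpK, hyK, hKK⟩ := h3 w p y (by linarith) (by simpa using hr3) (by linarith) (R / 2) (by positivity)
    (by rw [dist_comm, hw]) (by linarith [dist_triangle p w y])
  have hK0 : ∀ a ∈ K, c0 ≤ dist w a := fun a ha => by
    have := hKK a ha
    rw [← hcκ] at this
    exact le_of_mul_le_mul_right (by linarith) (show 0 < κ by linarith)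
  by_contra! hno
  have e1 : ∀ a, dist w a - c0 / 100 ≤ f a ∧ f a ≤ dist w a + c0 / 100 := fun a => by
    have := abs_le.1 (hfu a); constructor <;> linarith
  have e2 : ∀ a, dist p a - c0 / 100 ≤ g a ∧ g a ≤ dist p a + c0 / 100 := fun a => by
    have := abs_le.1 (hgv a); constructor <;> linarith
  have hs' := abs_lt.1 hs
  have z1 : IsCompact {a | g a = s ∧ f a ≤ t} := by
    refine (h2 r2 le_rfl).of_isClosed_subset ((isClosed_eq hg continuous_const).inter (isClosed_le hf continuous_const)) ?_
    rintro a ⟨-, ha⟩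
    rw [mem_closedBall, dist_comm]
    linarith [dist_triangle p w a, (e1 a).1]
  have z2 : IsClosed {a | g a = s ∧ t ≤ f a} := (isClosed_eq hg continuous_const).inter (isClosed_le continuous_const hf)
  have z3 : Disjoint {a | g a = s ∧ f a ≤ t} {a | g a = s ∧ t ≤ f a} :=
    disjoint_left.2 fun a ha hb => hno a (le_antisymm ha.2 hb.2) ha.1
  have z4 : Disjoint K {a | g a = s ∧ f a ≤ t} := by
    refine disjoint_left.2 fun a ha hb => ?_
    linarith [hK0 a ha, (e1 a).1, hb.2]
  have z5 : Disjoint L {a | g a = s ∧ t ≤ f a} := by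
    refine disjoint_left.2 fun a ha hb => ?_
    have k1 := (hLL a ha).2 w hwL
    have k2 : |dist p a - dist p w| ≤ c0 / 50 := by
      rw [abs_le, hw]; have := e2 a; have := hb.1; constructor <;> linarith
    linarith [(e1 a).2, hb.2, dist_comm a w]
  obtain ⟨K', hK', hpK', hyK', hd⟩ := jan H.hom z1 z2 z3 hK hL z4 z5 hpK hpL hyK hyL
  obtain ⟨a, ha, has⟩ := hK'.intermediate_value hpK' hyK' (f := g) hg.continuousOn
      (show s ∈ Icc _ _ from ⟨by have := (e2 p).2; rw [dist_self] at this; linarith, by have := (e2 y).1; rw [hy] at this; linarith⟩)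
  refine disjoint_left.1 hd ha ?_
  rcases le_total (f a) t with h | h
  · exact Or.inl ⟨has, h⟩
  · exact Or.inr ⟨has, h⟩
end HypY

end

section
set_option linter.unusedSectionVars false

namespace HypY
variable {Y : Type*} [MetricSpace Y] [MeasurableSpace Y] {ν : Measure Y} {κ c : ℝ} (H : HypY ν κ c)
include H

theorem lconn : LocallyConnectedSpace Y := by
  obtain ⟨Ω, hΩ, ⟨φ⟩⟩ := H.hom
  have := hΩ.locallyConnectedSpace
  exact φ.isOpenEmbedding.locallyConnectedSpace

theorem density {E : Set Y} (hE : MeasurableSet E) (h0 : ν E ≠ 0) : ∃ p ∈ E, ∀ η > 0, ∃ R0 > 0, ∀ R, 0 < R → R < R0 →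
    ν (Metric.ball p R \ E) ≤ ENNReal.ofReal (η * R ^ 2) := by
  have := H.fin; have := H.bor; have := H.sc
  have hκ := H.hκ
  have hk0 : 0 < κ := by linarith
  have hd : ∀ x, ∀ᶠ r in 𝓝[>] (0 : ℝ), ν (closedBall x (3 * r)) ≤ ((16 * κ ^ 2).toNNReal : ℝ≥0) * ν (closedBall x r) := by
    intro x
    obtain ⟨r1, hr1, h1⟩ := H.lowA x
    obtain ⟨r2, hr2, h2⟩ := H.upA x
    have : Ioo 0 (min r1 (r2 / 4)) ∈ 𝓝[>] (0 : ℝ) := Ioo_mem_nhdsGT (by positivity)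
    filter_upwards [this] with r hr
    have hrr := lt_min_iff.1 hr.2
    have a1 := h1 x (by simpa using hr1) r hr.1 hrr.1
    have a2 := h2 x (by simpa using hr2) (4 * r) (by linarith [hr.1]) (by linarith)
    have a3 : ν.real (closedBall x (3 * r)) ≤ 16 * κ ^ 2 * ν.real (closedBall x r) := by
      have b1 : ν.real (closedBall x (3 * r)) ≤ ν.real (Metric.ball x (4 * r)) :=
        measureReal_mono (closedBall_subset_ball (by linarith [hr.1]))
      have b2 : ν.real (Metric.ball x r) ≤ ν.real (closedBall x r) := measureReal_mono ball_subset_closedBall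
      have b3 : κ * (4 * r) ^ 2 ≤ 16 * κ * (κ * ν.real (closedBall x r)) := by
        have : κ * (4 * r) ^ 2 = 16 * κ * r ^ 2 := by ring
        rw [this]
        exact mul_le_mul_of_nonneg_left (a1.trans (mul_le_mul_of_nonneg_left b2 hk0.le)) (by positivity)
      linarith
    have := ENNReal.ofReal_le_ofReal a3
    rw [ofReal_mul (by positivity), ofReal_measureReal, ofReal_measureReal] at this
    exact this
  let v := Vitali.vitaliFamily ν _ fun x => (hd x).frequently
  have h1 := v.ae_tendsto_measure_inter_div_of_measurableSet hE.compl
  have h2 : ∃ p ∈ E, Tendsto (fun a => ν (Eᶜ ∩ a) / ν a) (v.filterAt p) (𝓝 (Eᶜ.indicator 1 p)) := by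
    by_contra! hno
    exact h0 (measure_mono_null (fun p hp => hno p hp) h1)
  obtain ⟨p, hp, h⟩ := h2
  have h3 : Tendsto (fun r => closedBall p r) (𝓝[>] (0 : ℝ)) (v.filterAt p) := by
    refine v.tendsto_filterAt_iff.2 ⟨?_, fun ε hε => ?_⟩
    · filter_upwards [hd p, self_mem_nhdsWithin] with r hr hr0
      exact ⟨isClosed_closedBall, (nonempty_ball.2 hr0).mono ball_subset_interior_closedBall, r, Subset.rfl, hr⟩
    · filter_upwards [Ioo_mem_nhdsGT hε] with r hr
      exact closedBall_subset_closedBall hr.2.le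
  have h4 := h.comp h3
  rw [indicator_of_notMem (by simpa using hp)] at h4
  refine ⟨p, hp, fun η hη => ?_⟩
  obtain ⟨r2, hr2, h5⟩ := H.upA p
  have h6 : ∀ᶠ r in 𝓝[>] (0 : ℝ), ν (Eᶜ ∩ closedBall p r) / ν (closedBall p r) < ENNReal.ofReal (η / (4 * κ)) :=
    h4.eventually (gt_mem_nhds (by simp; positivity))
  obtain ⟨r3, hr3, h7⟩ := mem_nhdsGT_iff_exists_Ioo_subset.1 h6
  have hr3 : 0 < r3 := hr3
  refine ⟨min (r2 / 2) r3, by positivity, fun R hR hRr => ?_⟩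
  have hRr := lt_min_iff.1 hRr
  have h8 : ν (Eᶜ ∩ closedBall p R) / ν (closedBall p R) < _ := h7 ⟨hR, hRr.2⟩
  have h9 : ν (Eᶜ ∩ closedBall p R) ≤ ENNReal.ofReal (η / (4 * κ)) * ν (closedBall p R) :=
    (ENNReal.div_le_iff_le_mul (Or.inr (by simp)) (Or.inl (measure_ne_top _ _))).1 h8.le
  have h10 := h5 p (by simpa using hr2) (2 * R) (by linarith) (by linarith)
  have h11 : ν (closedBall p R) ≤ ENNReal.ofReal (κ * (2 * R) ^ 2) := by
    rw [← ofReal_measureReal (μ := ν)]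
    exact ENNReal.ofReal_le_ofReal ((measureReal_mono (closedBall_subset_ball (by linarith))).trans h10)
  calc ν (Metric.ball p R \ E) ≤ ν (Eᶜ ∩ closedBall p R) := measure_mono fun a ha => ⟨ha.2, ball_subset_closedBall ha.1⟩
    _ ≤ ENNReal.ofReal (η / (4 * κ)) * ENNReal.ofReal (κ * (2 * R) ^ 2) := h9.trans (by gcongr)
    _ = _ := by rw [← ofReal_mul (by positivity)]; congr 1; field_simp; ring

end HypY

end

section
set_option linter.unusedSectionVars false

theorem sep_finite {Y : Type*} [MetricSpace Y] {S : Set Y} (hS : S.Finite) :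
    ∃ δ > 0, ∀ x ∈ S, ∀ y ∈ S, x ≠ y → δ ≤ dist x y := by
  have : ∀ᶠ δ in 𝓝[>] (0 : ℝ), ∀ x ∈ S, ∀ y ∈ S, x ≠ y → δ ≤ dist x y := by
    refine (eventually_all_finite hS).2 fun x _ => (eventually_all_finite hS).2 fun y _ => ?_
    by_cases h : x = y
    · exact Eventually.of_forall fun _ h' => (h' h).elim
    · filter_upwards [Ioo_mem_nhdsGT (dist_pos.2 h)] with δ hδ _ using hδ.2.le
  obtain ⟨δ, h1, h2⟩ := (this.and self_mem_nhdsWithin).exists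
  exact ⟨δ, h2, h1⟩

def VF {Y : Type*} [MetricSpace Y] (F : Y → ℝ × ℝ) (s : ℝ) (x : Y) : Set Y :=
  connectedComponentIn (F ⁻¹' Metric.ball (F x) s) x

def GoodF {Y : Type*} [MetricSpace Y] (F : Y → ℝ × ℝ) (k : ℝ) (x : Y) : Prop :=
  (∀ a ∈ VF F (1 / k) x, F a = F x → a = x) ∧ ∀ s, 0 < s → s ≤ 1 / k →
    VF F s x ⊆ closedBall x (k * s) ∧ Metric.ball (F x) (s / 2) ⊆ F '' VF F s x

theorem frontier_VF {Y : Type*} [MetricSpace Y] [LocallyConnectedSpace Y] {F : Y → ℝ × ℝ} (hF : Continuous F) (s : ℝ) (x a : Y)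
    (ha : a ∈ frontier (VF F s x)) : s ≤ dist (F a) (F x) := by
  by_contra! h
  have hU : IsOpen (F ⁻¹' Metric.ball (F x) s) := isOpen_ball.preimage hF
  have hV : IsOpen (VF F s x) := hU.connectedComponentIn
  have haU : a ∈ F ⁻¹' Metric.ball (F x) s := h
  rw [hV.frontier_eq] at ha
  obtain ⟨b, hb1, hb2⟩ := mem_closure_iff.1 ha.1 _ (hU.connectedComponentIn (x := a)) (mem_connectedComponentIn haU)
  have := connectedComponentIn_eq hb1
  have h2 := connectedComponentIn_eq hb2
  apply ha.2
  rw [VF, h2, ← this]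
  exact mem_connectedComponentIn haU

theorem perturb {Y : Type*} [MetricSpace Y] [LocallyConnectedSpace Y] {F : Y → ℝ × ℝ} (hF : Continuous F) {z : ℝ × ℝ} {s0 : ℝ}
    (S : Finset Y) (hS : ∀ a, F a = z ↔ a ∈ S) (s : Y → ℝ) (w : Y → ℝ × ℝ)
    (hs : ∀ x ∈ S, 0 < s x ∧ s x < s0) (hw : ∀ x ∈ S, dist (w x) z < s x / 2)
    (hwV : ∀ x ∈ S, ∀ a ∈ VF F (s x) x, F a ≠ w x)
    (hdis : ∀ x ∈ S, ∀ y ∈ S, x ≠ y → Disjoint (VF F (s x) x) (VF F (s y) y)) (hs0 : 0 ≤ s0) :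
    ∃ G : Y → ℝ × ℝ, Continuous G ∧ (∀ a, ‖G a - F a‖ ≤ s0) ∧ ∀ a, G a ≠ z := by
  classical
  let φ : Y → Y → ℝ × ℝ := fun x a => max 0 (1 - dist (F a) (w x) / (s x / 2)) • (z - w x)
  have hc : ∀ x ∈ S, Continuous ((VF F (s x) x).indicator (φ x)) := by
    intro x hx
    refine continuous_indicator (fun a ha => ?_) (by fun_prop)
    have h1 := frontier_VF hF _ _ _ ha
    rw [(hS x).2 hx] at h1
    have h2 := hw x hx
    have h3 : s x / 2 ≤ dist (F a) (w x) := by linarith [dist_triangle (F a) (w x) z]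
    have h4 : 1 ≤ dist (F a) (w x) / (s x / 2) := by
      rw [le_div_iff₀ (by linarith [(hs x hx).1])]; linarith
    show max 0 (1 - dist (F a) (w x) / (s x / 2)) • (z - w x) = 0
    rw [max_eq_left (by linarith), zero_smul]
  refine ⟨fun a => F a + ∑ x ∈ S, (VF F (s x) x).indicator (φ x) a, hF.add (continuous_finsetSum _ fun x hx => hc x hx), ?_⟩
  have hall : ∀ a, (∀ x ∈ S, a ∉ VF F (s x) x) ∧ F a + ∑ x ∈ S, (VF F (s x) x).indicator (φ x) a = F a ∨
      ∃ x ∈ S, a ∈ VF F (s x) x ∧ F a + ∑ x ∈ S, (VF F (s x) x).indicator (φ x) a = F a + φ x a := by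
    intro a
    by_cases h : ∃ x ∈ S, a ∈ VF F (s x) x
    · obtain ⟨x, hx, hax⟩ := h
      refine Or.inr ⟨x, hx, hax, ?_⟩
      rw [Finset.sum_eq_single x, indicator_of_mem hax]
      · intro y hy hyx
        exact indicator_of_notMem (fun h => disjoint_left.1 (hdis y hy x hx hyx) h hax) _
      · exact fun h => (h hx).elim
    · push Not at h
      refine Or.inl ⟨h, ?_⟩
      rw [Finset.sum_eq_zero fun x hx => indicator_of_notMem (h x hx) _, add_zero]
  have hmul : ∀ x ∈ S, ∀ a, 0 ≤ max 0 (1 - dist (F a) (w x) / (s x / 2)) ∧ max 0 (1 - dist (F a) (w x) / (s x / 2)) ≤ 1 := by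
    intro x hx a
    refine ⟨le_max_left _ _, max_le zero_le_one ?_⟩
    have := (hs x hx).1
    have : 0 ≤ dist (F a) (w x) / (s x / 2) := by positivity
    linarith
  refine ⟨fun a => ?_, fun a => ?_⟩ <;> dsimp only
  · rcases hall a with ⟨-, h⟩ | ⟨x, hx, -, h⟩
    · simpa [h] using hs0
    · rw [h, add_sub_cancel_left, norm_smul, Real.norm_of_nonneg (hmul x hx a).1, ← dist_eq_norm, dist_comm z]
      calc _ ≤ 1 * dist (w x) z := by gcongr; exact (hmul x hx a).2
        _ ≤ s0 := by linarith [hw x hx, hs x hx]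
  · rcases hall a with ⟨h1, h⟩ | ⟨x, hx, hax, h⟩
    · rw [h]
      intro h2
      have := (hS a).1 h2
      refine h1 a this (mem_connectedComponentIn ?_)
      simp [(hs a this).1]
    · rw [h]
      intro h2
      obtain ⟨hp, hp'⟩ := hmul x hx a
      have hsx := hs x hx
      have hlt : 1 - max 0 (1 - dist (F a) (w x) / (s x / 2)) ≤ dist (F a) (w x) / (s x / 2) := by
        linarith [le_max_right 0 (1 - dist (F a) (w x) / (s x / 2))]
      have h2 : F a + max 0 (1 - dist (F a) (w x) / (s x / 2)) • (z - w x) = z := h2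
      generalize max 0 (1 - dist (F a) (w x) / (s x / 2)) = t at h2 hp hp' hlt
      have h3 : F a - w x = (1 - t) • (z - w x) := by
        rw [sub_smul, one_smul, eq_sub_of_add_eq h2]; abel
      have h4 : dist (F a) (w x) = (1 - t) * dist (w x) z := by
        rw [dist_eq_norm, h3, norm_smul, Real.norm_of_nonneg (by linarith), ← dist_eq_norm, dist_comm]
      have h5 : 0 < dist (F a) (w x) := dist_pos.2 (hwV x hx a hax)
      have h6 : (1 - t) * (s x / 2) ≤ dist (F a) (w x) := by
        rwa [le_div_iff₀ (by linarith)] at hlt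
      have h7 : 0 < 1 - t := by
        by_contra! h8
        have : (1 - t) * dist (w x) z ≤ 0 := mul_nonpos_of_nonpos_of_nonneg h8 dist_nonneg
        linarith
      have := mul_lt_mul_of_pos_left (hw x hx) h7
      linarith

namespace HypY
variable {Y : Type*} [MetricSpace Y] [MeasurableSpace Y] {ν : Measure Y} {κ c : ℝ} (H : HypY ν κ c)
include H

theorem fibre {F : Y → ℝ × ℝ} (hF : LipschitzWith 1 F) {z : ℝ × ℝ} {s0 k : ℝ} (hs0 : 0 < s0)
    (hlow : ∀ x, dist (F x) z < s0 → ∀ r, 0 < r → r < s0 → r ^ 2 ≤ κ * ν.real (Metric.ball x r))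
    (hm : ∀ s, 0 < s → s < s0 → ν.real (F ⁻¹' Metric.ball z s) ≤ k * s ^ 2)
    (hst : ∀ G : Y → ℝ × ℝ, Continuous G → (∀ a, ‖G a - F a‖ ≤ s0) → ∃ a, G a = z) :
    ∃ x, F x = z ∧ ∃ K : ℕ, 0 < (K : ℝ) ∧ GoodF F K x := by
  have := H.fin; have := H.bor; have := H.lconn
  have hκ := H.hκ
  have hk0 : 0 < κ := by linarith
  have hFd : ∀ a b, dist (F a) (F b) ≤ dist a b := fun a b => by simpa using hF.dist_le_mul a b
  have count : ∀ (t : Finset Y) (s : ℝ), 0 < s → 2 * s < s0 → (∀ x ∈ t, dist (F x) z < s) →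
      (∀ x ∈ t, ∀ y ∈ t, x ≠ y → 2 * s ≤ dist x y) → (t.card : ℝ) ≤ 4 * κ * k := by
    intro t s hs hs2 h1 h2
    have e1 : ν.real (⋃ x ∈ t, Metric.ball x s) = ∑ x ∈ t, ν.real (Metric.ball x s) := by
      refine measureReal_biUnion_finset ?_ fun x _ => isOpen_ball.measurableSet
      intro x hx y hy hxy
      exact ball_disjoint_ball (by linarith [h2 x hx y hy hxy])
    have e2 : ν.real (⋃ x ∈ t, Metric.ball x s) ≤ k * (2 * s) ^ 2 := by
      refine (measureReal_mono ?_).trans (hm (2 * s) (by linarith) hs2)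
      refine iUnion₂_subset fun x hx a ha => ?_
      show dist (F a) z < 2 * s
      have := mem_ball.1 ha
      linarith [dist_triangle (F a) (F x) z, hFd a x, h1 x hx]
    have e3 : (t.card : ℝ) * s ^ 2 ≤ κ * ∑ x ∈ t, ν.real (Metric.ball x s) := by
      rw [Finset.mul_sum, ← nsmul_eq_mul]
      exact Finset.card_nsmul_le_sum _ _ _ fun x hx => hlow x (by linarith [h1 x hx]) s hs (by linarith)
    have e4 : (t.card : ℝ) * s ^ 2 ≤ (4 * κ * k) * s ^ 2 := by
      calc _ ≤ κ * (k * (2 * s) ^ 2) := e3.trans (by rw [← e1]; gcongr)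
        _ = _ := by ring
    exact le_of_mul_le_mul_right e4 (by positivity)
  obtain ⟨n, hn⟩ := exists_nat_gt (4 * κ * k)
  have hn0 : (0 : ℝ) ≤ n := n.cast_nonneg
  have hfin : (F ⁻¹' {z}).Finite := by
    by_contra hinf
    obtain ⟨t, ht, hcard⟩ := Set.Infinite.exists_subset_card_eq hinf n
    obtain ⟨δ, hδ, hsep⟩ := sep_finite t.finite_toSet
    have := count t (min (δ / 2) (s0 / 4)) (by positivity) (by linarith [min_le_right (δ / 2) (s0 / 4)])
      (fun x hx => by rw [show F x = z from ht hx, dist_self]; positivity)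
      (fun x hx y hy hxy => by linarith [hsep x hx y hy hxy, min_le_left (δ / 2) (s0 / 4)])
    rw [hcard] at this
    linarith
  have hV : ∀ x, F x = z → ∀ s, 0 < s → 2 * s < s0 → VF F s x ⊆ closedBall x (2 * n * s) := by
    intro x hx s hs hs2 y hy
    have hxV : x ∈ VF F s x := mem_connectedComponentIn (by simp [hs])
    have hc : IsPreconnected (VF F s x) := isPreconnected_connectedComponentIn
    by_contra! hfar
    rw [mem_closedBall, dist_comm, not_le] at hfar
    have hex : ∀ j : ℕ, j ≤ n → ∃ a ∈ VF F s x, dist x a = 2 * j * s := by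
      intro j hj
      have hj : (j : ℝ) ≤ n := by exact_mod_cast hj
      refine hc.intermediate_value hxV hy (f := fun a => dist x a) (by fun_prop) ⟨?_, ?_⟩
      · rw [dist_self]; positivity
      · refine le_trans ?_ hfar.le; gcongr
    have : Nonempty Y := ⟨x⟩
    choose! a ha1 ha2 using hex
    classical
    have hle : ∀ j ∈ Finset.range (n + 1), j ≤ n := fun j hj => Nat.lt_succ_iff.1 (Finset.mem_range.1 hj)
    have hdist : ∀ i ≤ n, ∀ j ≤ n, i ≠ j → 2 * s ≤ dist (a i) (a j) := by
      intro i hi j hj hij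
      have h1 : |dist x (a i) - dist x (a j)| ≤ dist (a i) (a j) := by
        rw [dist_comm x, dist_comm x]; exact abs_dist_sub_le _ _ _
      refine le_trans ?_ h1
      rw [ha2 i hi, ha2 j hj, show 2 * (i : ℝ) * s - 2 * j * s = (2 * s) * ((i : ℝ) - j) by ring, abs_mul, abs_of_pos (by linarith)]
      have : (1 : ℝ) ≤ |(i : ℝ) - j| := by
        have : (1 : ℤ) ≤ |(i : ℤ) - j| := Int.one_le_abs (by omega)
        exact_mod_cast this
      nlinarith
    have hinj : Set.InjOn a (Finset.range (n + 1) : Set ℕ) := by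
      intro i hi j hj hij
      by_contra h
      have := hdist i (hle i (Finset.mem_coe.1 hi)) j (hle j (Finset.mem_coe.1 hj)) h
      rw [hij, dist_self] at this
      linarith
    have h1 := count ((Finset.range (n + 1)).image a) s hs hs2 (by
      intro b hb
      obtain ⟨j, hj, rfl⟩ := Finset.mem_image.1 hb
      have := connectedComponentIn_subset _ _ (ha1 j (hle j hj))
      rw [← hx]; exact this) (by
      intro b hb b' hb' hbb
      obtain ⟨j, hj, rfl⟩ := Finset.mem_image.1 hb
      obtain ⟨i, hi, rfl⟩ := Finset.mem_image.1 hb'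
      exact hdist j (hle j hj) i (hle i hi) (fun h => hbb (by rw [h])))
    rw [Finset.card_image_of_injOn hinj, Finset.card_range] at h1
    push_cast at h1
    linarith
  obtain ⟨δ, hδ, hsep⟩ := sep_finite hfin
  have honto : ∃ x, F x = z ∧ ∃ s1 > 0, ∀ s, 0 < s → s < s1 → Metric.ball z (s / 2) ⊆ F '' VF F s x := by
    by_contra! hno
    have hd : 0 < min (s0 / 2) (δ / (4 * n + 4)) := by positivity
    have hno' : ∀ x, F x = z → ∃ s w, (0 < s ∧ s < min (s0 / 2) (δ / (4 * n + 4))) ∧ dist w z < s / 2 ∧ ∀ a ∈ VF F s x, F a ≠ w := by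
      intro x hx
      obtain ⟨s, hs, hs', h⟩ := hno x hx _ hd
      obtain ⟨w, hw, hw'⟩ := not_subset.1 h
      exact ⟨s, w, ⟨hs, hs'⟩, hw, fun a ha haw => hw' ⟨a, ha, haw⟩⟩
    choose! s w h1 h2 h3 using hno'
    have hmem : ∀ a, a ∈ hfin.toFinset ↔ F a = z := fun a => by simp
    obtain ⟨G, hG, hGF, hGz⟩ := perturb hF.continuous hfin.toFinset (fun a => (hmem a).symm) s w (s0 := s0)
      (fun x hx => ⟨(h1 x ((hmem x).1 hx)).1, by
        linarith [(lt_min_iff.1 (h1 x ((hmem x).1 hx)).2).1]⟩)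
      (fun x hx => h2 x ((hmem x).1 hx)) (fun x hx => h3 x ((hmem x).1 hx)) (by
      intro x hx y hy hxy
      have hx := (hmem x).1 hx
      have hy := (hmem y).1 hy
      have hb : ∀ x, F x = z → 2 * n * s x < δ / 2 ∧ 2 * s x < s0 := by
        intro x hx
        obtain ⟨a1, a2⟩ := h1 x hx
        obtain ⟨a2, a3⟩ := lt_min_iff.1 a2
        rw [lt_div_iff₀ (by positivity)] at a3
        constructor <;> linarith
      refine disjoint_left.2 fun a ha hb' => ?_
      have b1 := mem_closedBall.1 (hV x hx _ (h1 x hx).1 (hb x hx).2 ha)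
      have b2 := mem_closedBall.1 (hV y hy _ (h1 y hy).1 (hb y hy).2 hb')
      linarith [hsep x hx y hy hxy, dist_triangle_left x y a, hb x hx, hb y hy]) hs0.le
    obtain ⟨a, ha⟩ := hst G hG hGF
    exact hGz a ha
  obtain ⟨x, hx, s1, hs1, hon⟩ := honto
  refine ⟨x, hx, ?_⟩
  obtain ⟨K, hK⟩ := exists_nat_gt (max (max (2 / s0) (1 / s1)) (max (2 * n) (2 * n / δ)))
  simp only [max_lt_iff] at hK
  obtain ⟨⟨k1, k2⟩, k3, k4⟩ := hK
  have hKp : (0 : ℝ) < K := by linarith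
  rw [div_lt_iff₀ (by positivity)] at k1 k2 k4
  have k5 : 2 * (1 / (K : ℝ)) < s0 := by rw [mul_one_div, div_lt_iff₀ hKp]; linarith
  have k6 : 1 / (K : ℝ) < s1 := by rw [div_lt_iff₀ hKp]; linarith
  have k7 : 2 * n * (1 / (K : ℝ)) < δ := by rw [mul_one_div, div_lt_iff₀ hKp]; linarith
  have hKi : 0 < 1 / (K : ℝ) := by positivity
  refine ⟨K, hKp, fun a ha hax => ?_, fun s hs hsK => ⟨?_, ?_⟩⟩
  · by_contra hne
    have := mem_closedBall.1 (hV x hx _ hKi k5 ha)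
    linarith [hsep a (hax.trans hx) x hx hne]
  · refine (hV x hx s hs (by linarith)).trans (closedBall_subset_closedBall ?_)
    gcongr
  · rw [hx]
    exact hon s hs (by linarith)
end HypY

end

section
set_option linter.unusedSectionVars false

theorem vol_cb (z : ℝ × ℝ) {s : ℝ} (hs : 0 ≤ s) : volume (closedBall z s) = ENNReal.ofReal (4 * s ^ 2) := by
  rw [← Prod.mk.eta (p := z), ← closedBall_prod_same, Measure.volume_eq_prod, Measure.prod_prod, Real.volume_closedBall, Real.volume_closedBall,
    ← ofReal_mul (by positivity)]
  congr 1; ring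

namespace HypY
variable {Y : Type*} [MetricSpace Y] [MeasurableSpace Y] {ν : Measure Y} {κ c : ℝ} (H : HypY ν κ c)

theorem good_bilip {F : Y → ℝ × ℝ} (hF : LipschitzWith 1 F) {K ρ : ℝ} (hK : 0 < K) (hρ0 : 0 < ρ) (hρ : 10 * ρ < 1 / K) {x x' : Y}
    (hx : GoodF F K x) (hx' : GoodF F K x') (hd : dist x x' < 2 * ρ)
    (hlen : ∃ L : Set Y, IsPreconnected L ∧ x ∈ L ∧ x' ∈ L ∧ ∀ z ∈ L, dist x z ≤ dist x x' + ρ) :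
    dist x x' ≤ 3 * K * dist (F x) (F x') := by
  obtain ⟨L, hL, hxL, hx'L, hLd⟩ := hlen
  have hFd : ∀ a b, dist (F a) (F b) ≤ dist a b := fun a b => by simpa using hF.dist_le_mul a b
  have hLU : L ⊆ F ⁻¹' Metric.ball (F x') (1 / K) := fun a ha => by
    show dist (F a) (F x') < 1 / K
    linarith [hFd a x', dist_triangle_left a x' x, hLd a ha]
  have hxx : x ∈ VF F (1 / K) x' := hL.subset_connectedComponentIn hx'L hLU hxL
  rcases (dist_nonneg (x := F x) (y := F x')).eq_or_lt with h | h
  · have := hx'.1 x hxx (dist_eq_zero.1 h.symm)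
    rw [this]; simp
  · set d := dist (F x) (F x') with hdd
    have hd2 := hFd x x'
    obtain ⟨h1, h2⟩ := hx.2 (3 * d) (by linarith) (by linarith)
    obtain ⟨a, ha, hax⟩ := h2 (show F x' ∈ _ by rw [mem_ball, dist_comm]; linarith)
    have hVs : VF F (3 * d) x ⊆ F ⁻¹' Metric.ball (F x') (1 / K) := fun b hb => by
      have hb : dist (F b) (F x) < 3 * d := by
        have := connectedComponentIn_subset _ _ hb
        exact this
      show dist (F b) (F x') < 1 / K
      linarith [dist_triangle (F b) (F x) (F x')]
    have hxV : x ∈ VF F (3 * d) x := mem_connectedComponentIn (by simp [h])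
    have haV : a ∈ VF F (1 / K) x' := by
      rw [VF, connectedComponentIn_eq hxx]
      exact isPreconnected_connectedComponentIn.subset_connectedComponentIn hxV hVs ha
    have := hx'.1 a haV hax
    rw [← this, dist_comm]
    have := mem_closedBall.1 (h1 ha)
    linarith

include H
theorem rect {E : Set Y} (hE : IsCompact E) (h0 : ν E ≠ 0) : ∃ T ⊆ E, IsCompact T ∧ ∃ F : Y → ℝ × ℝ, LipschitzWith 1 F ∧
    ∃ k > 0, (∀ a ∈ T, ∀ b ∈ T, dist a b ≤ k * dist (F a) (F b)) ∧ volume (F '' T) ≠ 0 := by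
  have := H.fin; have := H.bor; have := H.sc
  have hκ := H.hκ
  have hk0 : 0 < κ := by linarith
  obtain ⟨p, hpE, hden⟩ := H.density hE.measurableSet h0
  obtain ⟨r1, hr1, hst⟩ := H.stab p
  obtain ⟨r2, hr2, hlow⟩ := H.lowA p
  obtain ⟨r3, hr3, hdn⟩ := hden (1 / (1600 * κ ^ 3)) (by positivity)
  obtain ⟨R, hR, hRr⟩ := exists_between (show 0 < min r1 (min r2 r3) by positivity)
  simp only [lt_min_iff] at hRr
  obtain ⟨hR1, hR2, hR3⟩ := hRr
  obtain ⟨w, hw, hst⟩ := hst R hR hR1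
  replace hdn := hdn R hR hR3
  have hst := hst _ rfl
  have hc0 : 0 < R / (2 * κ) := by positivity
  have hc0R : R / (2 * κ) ≤ R / 2 := by gcongr; linarith
  have hRc : R = 2 * κ * (R / (2 * κ)) := by field_simp
  generalize R / (2 * κ) = c0 at *
  let F : Y → ℝ × ℝ := fun a => (dist w a, dist p a)
  have hF : LipschitzWith 1 F := by
    have := (LipschitzWith.dist_right w).prodMk (LipschitzWith.dist_right p)
    simpa using this
  let Rt : Set (ℝ × ℝ) := Ioo (c0 / 2) (3 * c0 / 4) ×ˢ Ioo (R / 2 - c0 / 100) (R / 2 + c0 / 100)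
  have hRt : IsOpen Rt := isOpen_Ioo.prod isOpen_Ioo
  have hRB : ∀ a, F a ∈ Rt → dist p a < R := fun a ha => by
    have : dist w a < 3 * c0 / 4 := ha.1.2
    linarith [dist_triangle p w a]
  let A := F '' (Metric.ball p R \ E)
  have hvR : volume Rt = ENNReal.ofReal (c0 ^ 2 / 200) := by
    rw [Measure.volume_eq_prod, Measure.prod_prod, Real.volume_Ioo, Real.volume_Ioo, ← ofReal_mul (by linarith)]
    congr 1; ring
  have hvA : volume A < volume Rt := by
    have h1 : volume A ≤ μH[2] (Metric.ball p R \ E) := by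
      have := hF.hausdorffMeasure_image_le (d := 2) (by norm_num) (Metric.ball p R \ E)
      rw [hausdorffMeasure_prod_real] at this
      simpa using this
    refine (h1.trans (H.haus _)).trans_lt ?_
    refine lt_of_le_of_lt (mul_le_mul_right hdn _) ?_
    rw [← ofReal_mul hk0.le, hvR]
    refine (ENNReal.ofReal_lt_ofReal_iff (by positivity)).2 ?_
    rw [hRc]
    have : κ * (1 / (1600 * κ ^ 3) * (2 * κ * c0) ^ 2) = c0 ^ 2 / 400 := by field_simp; ring
    rw [this]
    have : 0 < c0 ^ 2 := by positivity
    linarith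
  have hP : volume (Rt \ A) ≠ 0 := by
    intro h
    have := le_measure_sdiff (μ := (volume : Measure (ℝ × ℝ))) (s₁ := Rt) (s₂ := A)
    rw [h, nonpos_iff_eq_zero, tsub_eq_zero_iff_le] at this
    exact absurd hvA this.not_gt
  let m := (ν.restrict (Metric.ball p R)).map F
  have hm : ∀ᵐ z, ∃ k : ℝ, ∃ s1 > 0, ∀ s, 0 < s → s < s1 → m (closedBall z s) ≤ ENNReal.ofReal (k * s ^ 2) := by
    filter_upwards [Besicovitch.ae_tendsto_rnDeriv m volume, Measure.rnDeriv_lt_top m volume] with z hz hz2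
    obtain ⟨k, hk⟩ := ENNReal.lt_iff_exists_nnreal_btwn.1 hz2
    obtain ⟨s1, hs1, h⟩ := mem_nhdsGT_iff_exists_Ioo_subset.1 (hz.eventually (gt_mem_nhds hk.1))
    refine ⟨4 * k, s1, hs1, fun s hs hs' => ?_⟩
    have h : m (closedBall z s) / volume (closedBall z s) < k := h ⟨hs, hs'⟩
    have h' : volume (closedBall z s) ≠ 0 := by rw [vol_cb z hs.le]; exact (ofReal_pos.2 (by positivity)).ne'
    have h'' : volume (closedBall z s) ≠ ⊤ := by rw [vol_cb z hs.le]; exact ofReal_ne_top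
    have h2 := (ENNReal.div_le_iff_le_mul (Or.inl h') (Or.inl h'')).1 h.le
    rw [vol_cb z hs.le, ← ENNReal.ofReal_coe_nnreal, ← ofReal_mul (by positivity)] at h2
    convert h2 using 2
    ring
  have hcov : Rt \ A ⊆ {z | ¬ ∃ k : ℝ, ∃ s1 > 0, ∀ s, 0 < s → s < s1 → m (closedBall z s) ≤ ENNReal.ofReal (k * s ^ 2)} ∪
      ⋃ K : ℕ, F '' {x | x ∈ E ∧ 0 < (K : ℝ) ∧ GoodF F K x} := by
    rintro z ⟨hzR, hzA⟩
    by_cases hz : ∃ k : ℝ, ∃ s1 > 0, ∀ s, 0 < s → s < s1 → m (closedBall z s) ≤ ENNReal.ofReal (k * s ^ 2)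
    swap
    · exact Or.inl hz
    right
    obtain ⟨k, s1, hs1, hk⟩ := hz
    obtain ⟨s2, hs2, hsR⟩ := Metric.isOpen_iff.1 hRt z hzR
    have hs0 : 0 < min (min s1 s2) (min r2 (c0 / 100)) := by positivity
    have l1 : min (min s1 s2) (min r2 (c0 / 100)) ≤ s1 := (min_le_left _ _).trans (min_le_left _ _)
    have l2 : min (min s1 s2) (min r2 (c0 / 100)) ≤ s2 := (min_le_left _ _).trans (min_le_right _ _)
    have l3 : min (min s1 s2) (min r2 (c0 / 100)) ≤ r2 := (min_le_right _ _).trans (min_le_left _ _)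
    have l4 : min (min s1 s2) (min r2 (c0 / 100)) ≤ c0 / 100 := (min_le_right _ _).trans (min_le_right _ _)
    generalize min (min s1 s2) (min r2 (c0 / 100)) = s0 at hs0 l1 l2 l3 l4
    obtain ⟨x, hx, K, hK0, hK⟩ := H.fibre hF (z := z) (s0 := s0) (k := |k|) hs0 (fun x hx r hr hr' =>
        hlow x ((hRB x (hsR (by rw [mem_ball]; linarith))).trans hR2) r hr (by linarith)) (fun s hs hs' => by
        have h1 : ν (F ⁻¹' Metric.ball z s) ≤ m (closedBall z s) := by
          rw [Measure.map_apply hF.continuous.measurable isClosed_closedBall.measurableSet,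
            Measure.restrict_apply (hF.continuous.measurable isClosed_closedBall.measurableSet)]
          refine measure_mono fun a ha => ⟨ball_subset_closedBall ha, ?_⟩
          rw [mem_ball, dist_comm]
          exact hRB a (hsR (ball_subset_ball (by linarith) ha))
        have h2 := h1.trans ((hk s hs (by linarith)).trans (ofReal_le_ofReal (show _ ≤ |k| * s ^ 2 by gcongr; exact le_abs_self k)))
        exact toReal_le_of_le_ofReal (by positivity) h2) (fun G hG hGF => by
        obtain ⟨a, h1, h2⟩ := hst (fun a => (G a).1) (fun a => (G a).2) hG.fst hG.snd
          (fun a => ((norm_fst_le (G a - F a)).trans (hGF a)).trans l4)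
          (fun a => ((norm_snd_le (G a - F a)).trans (hGF a)).trans l4) z.1 z.2 hzR.1.1 hzR.1.2
          (by have := hzR.2; rw [abs_lt]; constructor <;> linarith [this.1, this.2])
        exact ⟨a, Prod.ext h1 h2⟩)
    refine mem_iUnion.2 ⟨K, x, ⟨?_, hK0, hK⟩, hx⟩
    by_contra hxE
    refine hzA ⟨x, ⟨?_, hxE⟩, hx⟩
    rw [mem_ball, dist_comm]
    exact hRB x (by rw [hx]; exact hzR)
  have hK : ∃ K : ℕ, volume (F '' {x | x ∈ E ∧ 0 < (K : ℝ) ∧ GoodF F K x}) ≠ 0 := by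
    by_contra! hno
    exact hP (measure_mono_null hcov (measure_union_null hm (measure_iUnion_null hno)))
  obtain ⟨K, hK⟩ := hK
  have hKp : (0 : ℝ) < K := by
    obtain ⟨_, x, hx, -⟩ := nonempty_of_measure_ne_zero hK
    exact hx.2.1
  have hloc : ∀ y : Y, ∃ ρ > 0, 10 * ρ < 1 / (K : ℝ) ∧ ∀ x ∈ Metric.ball y ρ, ∀ x' ∈ Metric.ball y ρ,
      ∃ L : Set Y, IsPreconnected L ∧ x ∈ L ∧ x' ∈ L ∧ ∀ z ∈ L, dist x z ≤ dist x x' + ρ := by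
    intro y
    obtain ⟨r4, hr4, h4⟩ := H.len y
    have hρ : 0 < min r4 (1 / (20 * K : ℝ)) := by positivity
    refine ⟨_, hρ, ?_, fun x hx x' hx' => ?_⟩
    · have : 0 < 1 / (20 * K : ℝ) := by positivity
      have e : 1 / (K : ℝ) = 20 * (1 / (20 * K : ℝ)) := by field_simp
      rw [e]; linarith [min_le_right r4 (1 / (20 * K : ℝ))]
    · have l := min_le_left r4 (1 / (20 * K : ℝ))
      rw [mem_ball, dist_comm] at hx hx'
      obtain ⟨L, a1, a2, a3, a4⟩ := h4 x x' (by linarith) (by linarith) _ hρ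
      exact ⟨L, a1, a2, a3, fun z hz => (a4 z hz).1⟩
  choose ρ hρ0 hρ hL using hloc
  obtain ⟨D, hDc, hD⟩ := TopologicalSpace.countable_cover_nhds (fun y => ball_mem_nhds y (hρ0 y))
  have hy : ∃ y ∈ D, volume (F '' ({x | x ∈ E ∧ 0 < (K : ℝ) ∧ GoodF F K x} ∩ Metric.ball y (ρ y))) ≠ 0 := by
    by_contra! hno
    refine hK (measure_mono_null ?_ ((measure_biUnion_null_iff hDc).2 hno))
    rintro _ ⟨x, hx, rfl⟩
    have : x ∈ ⋃ y ∈ D, Metric.ball y (ρ y) := by rw [hD]; trivial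
    obtain ⟨y, hy, hxy⟩ := mem_iUnion₂.1 this
    exact mem_iUnion₂.2 ⟨y, hy, x, ⟨hx, hxy⟩, rfl⟩
  obtain ⟨y, -, hy⟩ := hy
  set T0 := {x | x ∈ E ∧ 0 < (K : ℝ) ∧ GoodF F K x} ∩ Metric.ball y (ρ y)
  have hT0E : T0 ⊆ E := fun x hx => hx.1.1
  have hTE : closure T0 ⊆ E := closure_minimal hT0E hE.isClosed
  refine ⟨closure T0, hTE, hE.of_isClosed_subset isClosed_closure hTE, F, hF, 3 * K, by positivity, ?_, ?_⟩
  · have hb : ∀ a ∈ T0, ∀ b ∈ T0, dist a b ≤ 3 * K * dist (F a) (F b) := by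
      intro a ha b hb
      refine good_bilip hF hKp (hρ0 y) (hρ y) ha.1.2.2 hb.1.2.2 ?_ (hL y a ha.2 b hb.2)
      have h1 := mem_ball.1 ha.2
      have h2 := mem_ball.1 hb.2
      linarith [dist_triangle_right a b y]
    have hFc := hF.continuous
    have hcl : IsClosed {q : Y × Y | dist q.1 q.2 ≤ 3 * K * dist (F q.1) (F q.2)} := by
      exact isClosed_le (by fun_prop) (by fun_prop)
    intro a ha b hb'
    have hab : (a, b) ∈ closure (T0 ×ˢ T0) := by rw [closure_prod_eq]; exact ⟨ha, hb'⟩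
    exact closure_minimal (fun q hq => hb _ hq.1 _ hq.2) hcl hab
  · exact fun h => hy (measure_mono_null (image_mono subset_closure) h)
end HypY

end

section
set_option linter.unusedSectionVars false

theorem one_d {P Q : Set ℝ} (hP : IsCompact P) (hQ : IsCompact Q) (hP0 : P.Nonempty) (hQ0 : Q.Nonempty) {D : Set ℝ}
    (hD : ∀ a ∈ P, ∀ b ∈ Q, a - b ∈ D) : volume P + volume Q ≤ volume D := by
  obtain ⟨p, hp, hp'⟩ := hP.exists_isGreatest hP0
  obtain ⟨q, hq, hq'⟩ := hQ.exists_isGreatest hQ0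
  have h1 : volume ((fun x => x - q) '' P) = volume P := by
    have : (fun x => x - q) '' P = (fun x => x + q) ⁻¹' P := by
      ext x; constructor
      · rintro ⟨y, hy, rfl⟩; simpa using hy
      · intro hx; exact ⟨x + q, hx, by simp⟩
    rw [this, measure_preimage_add_right]
  have h2 : volume ((fun x => p - x) '' Q) = volume Q := by
    have : (fun x => p - x) '' Q = (fun x => p - x) ⁻¹' Q := by
      ext x; constructor
      · rintro ⟨y, hy, rfl⟩; simpa using hy
      · intro hx; exact ⟨p - x, hx, by simp⟩
    rw [this, (Measure.measurePreserving_sub_left volume p).measure_preimage hQ.measurableSet.nullMeasurableSet]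
  have h3 : AEDisjoint volume ((fun x => x - q) '' P) ((fun x => p - x) '' Q) := by
    refine measure_mono_null (t := {p - q}) ?_ (by simp)
    rintro _ ⟨⟨x, hx, rfl⟩, ⟨y, hy, hxy⟩⟩
    have a1 := hp' hx
    have a2 := hq' hy
    dsimp only at hxy
    simp only [mem_singleton_iff]; linarith
  rw [← h1, ← h2, ← measure_union₀ ((hQ.image (by fun_prop)).measurableSet.nullMeasurableSet) h3]
  refine measure_mono (union_subset ?_ ?_)
  · rintro _ ⟨x, hx, rfl⟩; exact hD x hx q hq
  · rintro _ ⟨x, hx, rfl⟩; exact hD p hp x hx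

theorem two_d {A D : Set (ℝ × ℝ)} (hA : IsCompact A) (hDc : IsCompact D) (hD : ∀ a ∈ A, ∀ b ∈ A, a - b ∈ D) : 4 * volume A ≤ volume D := by
  have hs : ∀ {A : Set (ℝ × ℝ)} (_ : IsCompact A) t, IsCompact (Prod.mk t ⁻¹' A) := fun {A} hA t => by
    refine (hA.image continuous_snd).of_isClosed_subset (hA.isClosed.preimage (by fun_prop)) ?_
    exact fun s hs => ⟨(t, s), hs, rfl⟩
  have hint : ∀ {A : Set (ℝ × ℝ)} (_ : IsCompact A), volume A = ∫⁻ t, ENNReal.ofReal ((volume (Prod.mk t ⁻¹' A)).toReal) := fun {A} hA => by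
    rw [Measure.volume_eq_prod, Measure.prod_apply hA.measurableSet]
    refine lintegral_congr fun t => (ofReal_toReal (hs hA t).measure_lt_top.ne).symm
  have hmeas : ∀ {A : Set (ℝ × ℝ)} (_ : IsCompact A), Measurable fun t : ℝ => ((volume : Measure ℝ) (Prod.mk t ⁻¹' A)).toReal :=
    fun {A} hA => (measurable_measure_prodMk_left hA.measurableSet).ennreal_toReal
  set f : ℝ → ℝ := fun t => ((volume : Measure ℝ) (Prod.mk t ⁻¹' A)).toReal with hf
  set h : ℝ → ℝ := fun t => ((volume : Measure ℝ) (Prod.mk t ⁻¹' D)).toReal with hh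
  have key : ∀ l > 0, 2 * volume {t | l < f t} ≤ volume {t | l < h t / 2} := by
    intro l hl
    have hm : MeasurableSet {t | l < f t} := measurableSet_lt measurable_const (hmeas hA)
    rw [hm.measure_eq_iSup_isCompact, ENNReal.mul_iSup]
    refine iSup_le fun K => ?_
    rw [ENNReal.mul_iSup]
    refine iSup_le fun hK => ?_
    rw [ENNReal.mul_iSup]
    refine iSup_le fun hKc => ?_
    rcases K.eq_empty_or_nonempty with rfl | hK0
    · simp
    rw [two_mul]
    refine one_d hKc hKc hK0 hK0 fun a ha b hb => ?_
    have ha : l < f a := hK ha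
    have hb : l < f b := hK hb
    have hne : ∀ c, l < f c → (Prod.mk c ⁻¹' A).Nonempty := fun c hc =>
      nonempty_of_measure_ne_zero fun h0 => by
        have : f c = 0 := by rw [hf]; dsimp only; rw [h0]; rfl
        linarith
    have h1 := one_d (hs hA a) (hs hA b) (hne a ha) (hne b hb) (D := Prod.mk (a - b) ⁻¹' D) fun s hs' t ht => hD _ hs' _ ht
    have h2 := toReal_mono (hs hDc (a - b)).measure_lt_top.ne h1
    rw [toReal_add (hs hA a).measure_lt_top.ne (hs hA b).measure_lt_top.ne] at h2
    have h2 : f a + f b ≤ h (a - b) := h2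
    show l < h (a - b) / 2
    linarith
  have e1 : volume D = 2 * ∫⁻ t, ENNReal.ofReal (h t / 2) := by
    rw [hint hDc, ← lintegral_const_mul _ (((hmeas hDc).div_const 2).ennreal_ofReal)]
    refine lintegral_congr fun t => ?_
    rw [← ENNReal.ofReal_ofNat 2, ← ofReal_mul (by norm_num)]
    congr 1; show h t = _; ring
  rw [e1, hint hA, lintegral_eq_lintegral_meas_lt _ (.of_forall fun t => div_nonneg toReal_nonneg zero_le_two) ((hmeas hDc).div_const 2).aemeasurable,
    lintegral_eq_lintegral_meas_lt _ (.of_forall fun t => toReal_nonneg) (hmeas hA).aemeasurable]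
  rw [show (4 : ℝ≥0∞) = 2 * 2 by norm_num, mul_assoc]
  refine mul_le_mul_right ?_ _
  rw [← lintegral_const_mul' _ _ (by simp)]
  exact setLIntegral_mono' measurableSet_Ioi fun l hl => key l hl

end

section
set_option linter.unusedSectionVars false

theorem avg_bound {g : ℝ × ℝ → ℝ} {k : ℝ≥0} (hg : LipschitzWith k g) {W : Set (ℝ × ℝ)} (hW : MeasurableSet W)
    {a s β : ℝ} (ha : 0 ≤ a) (hs : 0 < s) (hβ : 0 ≤ β) {z v : ℝ × ℝ} (hWa : ∀ x ∈ W, |fderiv ℝ g x v| ≤ a)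
    (hvol : ∀ t ∈ Icc (0:ℝ) 1, volume (closedBall (z + t • v) s \ W) ≤ ENNReal.ofReal β) :
    4 * s^2 * |g (z + v) - g z| ≤ 4 * s^2 * (a + 2 * k * s) + k * ‖v‖ * β := by
  set B := closedBall (0 : ℝ × ℝ) s with hB
  have hBm : MeasurableSet B := isClosed_closedBall.measurableSet
  have hBc : IsCompact B := isCompact_closedBall _ _
  have hBr : volume.real B = 4 * s^2 := by
    rw [Measure.real, vol_cb _ hs.le, ENNReal.toReal_ofReal (by positivity)]
  haveI : IsFiniteMeasure (volume.restrict B) := ⟨by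
    rw [Measure.restrict_apply_univ]; exact hBc.measure_lt_top⟩
  let φ : ℝ → ℝ := fun t => ∫ y in B, g (z + t • v + y)
  have hcont : ∀ t : ℝ, Continuous (fun y => g (z + t • v + y)) := fun t => hg.continuous.comp (by fun_prop)
  have hint : ∀ t : ℝ, IntegrableOn (fun y => g (z + t • v + y)) B := fun t =>
    (hcont t).continuousOn.integrableOn_compact hBc
  have hder : ∀ t : ℝ, Integrable (fun y => fderiv ℝ g (z + t • v + y) v) (volume.restrict B) ∧
      HasDerivAt φ (∫ y in B, fderiv ℝ g (z + t • v + y) v) t := by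
    intro t
    refine hasDerivAt_integral_of_dominated_loc_of_lip (s := univ) (bound := fun _ => k * ‖v‖) univ_mem
      (Eventually.of_forall fun t => (hcont t).aestronglyMeasurable) (hint t) ?_ ?_ (integrable_const _) ?_
    · exact ((measurable_fderiv_apply_const ℝ g v).comp (by fun_prop : Measurable fun y => z + t • v + y)).aestronglyMeasurable
    · refine Eventually.of_forall fun y => LipschitzOnWith.of_dist_le_mul fun p _ q _ => ?_
      refine (hg.dist_le_mul _ _).trans ?_
      rw [Real.coe_nnabs, abs_of_nonneg (by positivity), dist_add_right, dist_add_left, dist_eq_norm, ← sub_smul, norm_smul,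
        ← dist_eq_norm]
      apply le_of_eq; ring
    · refine ae_restrict_of_ae ?_
      have h1 := hg.ae_differentiableAt (μ := volume)
      have h2 : ∀ᵐ y : ℝ × ℝ, DifferentiableAt ℝ g (z + t • v + y) :=
        (measurePreserving_add_left volume (z + t • v)).quasiMeasurePreserving.ae h1
      filter_upwards [h2] with y hy
      have h3 : HasDerivAt (fun t : ℝ => z + t • v + y) v t := by
        simpa using (((hasDerivAt_id t).smul_const v).const_add z).add_const y
      exact hy.hasFDerivAt.comp_hasDerivAt t h3
  have hbd : ∀ t ∈ Icc (0:ℝ) 1, |∫ y in B, fderiv ℝ g (z + t • v + y) v| ≤ 4 * s^2 * a + k * ‖v‖ * β := by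
    intro t ht
    let U := (fun y => z + t • v + y) ⁻¹' Wᶜ
    have hU : MeasurableSet U := hW.compl.preimage (by fun_prop)
    have h1 : |∫ y in B, fderiv ℝ g (z + t • v + y) v| ≤ ∫ y in B, (a + U.indicator (fun _ => k * ‖v‖) y) := by
      rw [← Real.norm_eq_abs]
      refine norm_integral_le_of_norm_le ((integrable_const _).add ((integrable_const _).indicator hU)) ?_
      refine Eventually.of_forall fun y => ?_
      by_cases hy : y ∈ U
      · rw [indicator_of_mem hy]
        have := (fderiv ℝ g (z + t • v + y)).le_of_opNorm_le (norm_fderiv_le_of_lipschitz ℝ hg) v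
        linarith
      · rw [indicator_of_notMem hy, add_zero]
        exact hWa _ (by simpa [U] using hy)
    refine h1.trans ?_
    rw [integral_add (integrable_const _) ((integrable_const _).indicator hU), integral_indicator hU]
    simp only [integral_const, smul_eq_mul, Measure.restrict_restrict hU]
    have h2 : volume (U ∩ B) ≤ ENNReal.ofReal β := by
      have : U ∩ B = (fun y => z + t • v + y) ⁻¹' (closedBall (z + t • v) s \ W) := by
        ext y; simp [U, hB, dist_eq_norm, and_comm]
      rw [this, measure_preimage_add]; exact hvol t ht
    have h3 : (volume.restrict (U ∩ B)).real univ ≤ β := by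
      rw [Measure.real, Measure.restrict_apply_univ]
      exact ENNReal.toReal_le_of_le_ofReal hβ h2
    have h4 : (volume.restrict B).real univ = 4 * s^2 := by
      rw [← hBr, Measure.real, Measure.restrict_apply_univ]; rfl
    rw [h4]
    have : 0 ≤ (k:ℝ) * ‖v‖ := by positivity
    nlinarith
  have hmv := norm_image_sub_le_of_norm_deriv_le_segment_01' (f := φ) (fun t _ => (hder t).2.hasDerivWithinAt)
    (C := 4 * s^2 * a + k * ‖v‖ * β) (fun t ht => by rw [Real.norm_eq_abs]; exact hbd t ⟨ht.1, ht.2.le⟩)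
  have happ : ∀ t : ℝ, |φ t - 4 * s^2 * g (z + t • v)| ≤ 4 * s^2 * (k * s) := by
    intro t
    have h1 : 4 * s^2 * g (z + t • v) = ∫ y in B, g (z + t • v) := by
      rw [setIntegral_const, hBr, smul_eq_mul]
    rw [h1, ← integral_sub (hint t) (integrable_const _), ← Real.norm_eq_abs]
    have := norm_setIntegral_le_of_norm_le_const (μ := volume) (s := B) (f := fun y => g (z + t • v + y) - g (z + t • v))
      (C := k * s) hBc.measure_lt_top (fun y hy => by
        rw [← dist_eq_norm]
        refine (hg.dist_le_mul _ _).trans ?_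
        gcongr
        simpa [hB] using hy)
    rw [hBr] at this; linarith
  have e1 := happ 1
  have e0 := happ 0
  rw [Real.norm_eq_abs] at hmv
  simp only [one_smul, zero_smul, add_zero] at e0 e1
  have h5 : |4 * s^2 * (g (z + v) - g z)| ≤ 4 * s ^ 2 * (a + 2 * k * s) + k * ‖v‖ * β := by
    rw [abs_le] at *
    constructor <;> nlinarith [e0.1, e0.2, e1.1, e1.2, hmv.1, hmv.2]
  rwa [abs_mul, abs_of_pos (by positivity : 0 < 4 * s^2)] at h5

end

section
set_option linter.unusedSectionVars false

theorem pick_pos {ι : Type*} [Countable ι] {S : Set (ℝ × ℝ)} (hS : volume S ≠ 0) (P : ι → ℝ × ℝ → Prop)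
    (h : ∀ᵐ z : ℝ × ℝ, z ∈ S → ∃ i, P i z) : ∃ i, volume {z | z ∈ S ∧ P i z} ≠ 0 := by
  by_contra hc
  push Not at hc
  apply hS
  have h1 : volume (⋃ i, {z | z ∈ S ∧ P i z}) = 0 := measure_iUnion_null hc
  refine measure_mono_null ?_ (measure_union_null h1 (ae_iff.1 h))
  intro z hz
  by_cases hp : ∃ i, P i z
  · obtain ⟨i, hi⟩ := hp
    exact Or.inl (mem_iUnion.2 ⟨i, hz, hi⟩)
  · exact Or.inr (fun hh => hp (hh hz))

theorem md_fam {g : ℕ → ℝ × ℝ → ℝ} {k : ℝ≥0} (hk : 1 ≤ k) (hg : ∀ i, LipschitzWith k (g i)) {S : Set (ℝ × ℝ)}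
    (hS : volume S ≠ 0) {ε : ℝ} (hε : 0 < ε) :
    ∃ S1 ⊆ S, volume S1 ≠ 0 ∧ ∃ N : ℝ × ℝ → ℝ, Continuous N ∧ (∀ (t : ℝ) v, N (t • v) = |t| * N v) ∧
      ∃ ρ > 0, ∀ z ∈ S1, ∀ z', dist z' z < ρ →
        (∀ i, |g i z' - g i z| ≤ N (z' - z) + 5 * ε * ‖z' - z‖) ∧
        ∃ i, N (z' - z) - 5 * ε * ‖z' - z‖ ≤ |g i z' - g i z| := by
  have hk0 : (0:ℝ) < k := lt_of_lt_of_le one_pos (by exact_mod_cast hk)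
  let n : ℝ × ℝ → ℝ × ℝ → ℝ := fun z v => ⨆ i, |fderiv ℝ (g i) z v|
  have hD : ∀ i z v, |fderiv ℝ (g i) z v| ≤ k * ‖v‖ := fun i z v =>
    (fderiv ℝ (g i) z).le_of_opNorm_le (norm_fderiv_le_of_lipschitz ℝ (hg i)) v
  have hbdd : ∀ z v, BddAbove (range fun i => |fderiv ℝ (g i) z v|) := fun z v =>
    ⟨k * ‖v‖, by rintro _ ⟨i, rfl⟩; exact hD i z v⟩
  have hle : ∀ i z v, |fderiv ℝ (g i) z v| ≤ n z v := fun i z v => le_ciSup (hbdd z v) i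
  have hn0 : ∀ z v, 0 ≤ n z v := fun z v => (abs_nonneg _).trans (hle 0 z v)
  have hnL : ∀ z, LipschitzWith k (n z) := by
    intro z
    refine LipschitzWith.of_le_add_mul k fun v w => ciSup_le fun i => ?_
    have h1 : fderiv ℝ (g i) z v = fderiv ℝ (g i) z w + fderiv ℝ (g i) z (v - w) := by rw [map_sub]; ring
    rw [h1, dist_eq_norm]
    exact (abs_add_le _ _).trans (add_le_add (hle i z w) (hD i z _))
  have hnh : ∀ z (t : ℝ) v, n z (t • v) = |t| * n z v := by
    intro z t v
    simp only [n, map_smul, smul_eq_mul, abs_mul]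
    rw [Real.mul_iSup_of_nonneg (abs_nonneg t)]
  have : CompactSpace (closedBall (0:ℝ×ℝ) 1) := isCompact_iff_compactSpace.1 (isCompact_closedBall _ _)
  let r : ℝ × ℝ → C(closedBall (0:ℝ×ℝ) 1, ℝ) := fun z => ⟨fun v => n z v, (hnL z).continuous.comp continuous_subtype_val⟩
  obtain ⟨j, hj⟩ := pick_pos hS (fun j z => dist (r z) (TopologicalSpace.denseSeq C(closedBall (0:ℝ×ℝ) 1, ℝ) j) < ε)
    (Eventually.of_forall fun z _ => (TopologicalSpace.denseRange_denseSeq _).exists_dist_lt (r z) hε)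
  set S2 := {z | z ∈ S ∧ dist (r z) (TopologicalSpace.denseSeq C(closedBall (0:ℝ×ℝ) 1, ℝ) j) < ε} with hS2
  obtain ⟨z0, hz0⟩ : S2.Nonempty := nonempty_of_measure_ne_zero hj
  have hcl : ∀ z ∈ S2, ∀ v, |n z v - n z0 v| ≤ 2 * ε * ‖v‖ := by
    intro z hz v
    have h1 : ∀ w : ℝ × ℝ, ‖w‖ ≤ 1 → |n z w - n z0 w| ≤ 2 * ε := by
      intro w hw
      have h2 : dist (r z) (r z0) ≤ 2 * ε := by
        have := dist_triangle_right (r z) (r z0) (TopologicalSpace.denseSeq C(closedBall (0:ℝ×ℝ) 1, ℝ) j)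
        linarith [hz.2, hz0.2]
      exact (ContinuousMap.dist_apply_le_dist (f := r z) (g := r z0) ⟨w, by simpa using hw⟩).trans h2
    rcases eq_or_ne v 0 with rfl | hv
    · have := hnh z 0 0
      have h3 := hnh z0 0 0
      simp at this h3
      simp [this, h3]
    · have hv' : 0 < ‖v‖ := norm_pos_iff.2 hv
      have h2 := h1 (‖v‖⁻¹ • v) (by rw [norm_smul, norm_inv, norm_norm, inv_mul_cancel₀ hv'.ne'])
      rw [hnh, hnh, abs_of_pos (inv_pos.2 hv'), ← mul_sub, abs_mul, abs_of_pos (inv_pos.2 hv'),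
        inv_mul_le_iff₀ hv'] at h2
      linarith
  let W : Set (ℝ × ℝ) := ⋂ i, fderiv ℝ (g i) ⁻¹' {L | ∀ v, |L v| ≤ n z0 v + 2 * ε * ‖v‖}
  have hW : MeasurableSet W := by
    refine MeasurableSet.iInter fun i => (measurable_fderiv ℝ (g i)) (IsClosed.measurableSet ?_)
    simp only [ofPred_forall]
    refine isClosed_iInter fun v => isClosed_le ?_ continuous_const
    exact continuous_abs.comp (ContinuousLinearMap.apply ℝ ℝ v).continuous
  have hS2W : S2 ⊆ W := by
    intro z hz
    refine mem_iInter.2 fun i => ?_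
    show ∀ v, |fderiv ℝ (g i) z v| ≤ n z0 v + 2 * ε * ‖v‖
    intro v
    have := abs_le.1 (hcl z hz v)
    linarith [hle i z v]
  have hdiff : ∀ᵐ z : ℝ × ℝ, ∀ i, DifferentiableAt ℝ (g i) z := ae_all_iff.2 fun i => (hg i).ae_differentiableAt
  have hdens := Besicovitch.ae_tendsto_measure_inter_div_of_measurableSet volume hW
  let τ : ℝ := min 1 (ε / k)
  have hτ0 : 0 < τ := lt_min one_pos (by positivity)
  have hτ1 : τ ≤ 1 := min_le_left _ _
  have hτk : k * τ ≤ ε := by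
    have : τ ≤ ε / k := min_le_right _ _
    calc k * τ ≤ k * (ε / k) := by gcongr
      _ = ε := by field_simp
  let η : ℝ := min (1/2) (ε * τ^2 / (4 * k))
  have hη0 : 0 < η := lt_min (by norm_num) (by positivity)
  have hη1 : η ≤ 1/2 := min_le_left _ _
  have hηk : 4 * k * η ≤ ε * τ^2 := by
    have : η ≤ ε * τ^2 / (4 * k) := min_le_right _ _
    calc 4 * k * η ≤ 4 * k * (ε * τ^2 / (4 * k)) := by gcongr
      _ = ε * τ^2 := by field_simp
  let P : ℕ → ℝ × ℝ → Prop := fun m z => ∀ z', dist z' z < 1 / ((m:ℝ) + 1) →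
        (∀ i, |g i z' - g i z| ≤ n z0 (z' - z) + 5 * ε * ‖z' - z‖) ∧
        ∃ i, n z0 (z' - z) - 5 * ε * ‖z' - z‖ ≤ |g i z' - g i z|
  have hmain : ∀ᵐ z : ℝ × ℝ, z ∈ S2 → ∃ m, P m z := by
    filter_upwards [hdiff, hdens] with z hdz hdn hz
    rw [indicator_of_mem (hS2W hz), Pi.one_apply] at hdn
    -- upper
    have hup : ∃ r0 > 0, ∀ z', dist z' z < r0 → ∀ i, |g i z' - g i z| ≤ n z0 (z' - z) + 5 * ε * ‖z' - z‖ := by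
      have h1 : ∀ᶠ r in 𝓝[>] (0:ℝ), 1 - ENNReal.ofReal η < volume (W ∩ closedBall z r) / volume (closedBall z r) := by
        refine hdn.eventually (lt_mem_nhds ?_)
        exact ENNReal.sub_lt_self one_ne_top one_ne_zero (by simpa using hη0)
      obtain ⟨r0, hr0, hr⟩ := mem_nhdsGT_iff_exists_Ioo_subset.1 h1
      have hr0' : 0 < r0 := hr0
      have h2 : ∀ r, 0 < r → r < r0 → volume (closedBall z r \ W) ≤ ENNReal.ofReal (η * (4 * r^2)) := by
        intro r h0 h1
        have h3 : 1 - ENNReal.ofReal η < volume (W ∩ closedBall z r) / volume (closedBall z r) := hr ⟨h0, h1⟩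
        have hv0 : volume (closedBall z r) ≠ 0 := by
          rw [vol_cb z h0.le]; simp; positivity
        have hvt : volume (closedBall z r) ≠ ⊤ := by rw [vol_cb z h0.le]; exact ofReal_ne_top
        have h4 := (ENNReal.lt_div_iff_mul_lt (Or.inl hv0) (Or.inl hvt)).1 h3
        have h5 := measure_inter_add_sdiff (μ := volume) (closedBall z r) hW
        rw [inter_comm] at h5
        have h6 : volume (closedBall z r) ≤ (1 - ENNReal.ofReal η) * volume (closedBall z r) + ENNReal.ofReal η * volume (closedBall z r) := by
          rw [← add_mul]
          exact (one_mul (volume (closedBall z r))).symm.le.trans (mul_le_mul_left (by exact le_tsub_add) _)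
        have h7 : volume (W ∩ closedBall z r) ≠ ⊤ := ((measure_mono inter_subset_right).trans_lt hvt.lt_top).ne
        rw [ENNReal.ofReal_mul hη0.le, ← vol_cb z h0.le]
        by_contra hc
        push Not at hc
        have h8 : volume (closedBall z r) < volume (closedBall z r) := by
          calc _ ≤ (1 - ENNReal.ofReal η) * volume (closedBall z r) + ENNReal.ofReal η * volume (closedBall z r) := h6
            _ < _ := ENNReal.add_lt_add h4 hc
            _ = _ := h5
        exact lt_irrefl _ h8
      refine ⟨r0 / 2, by positivity, fun z' hz' i => ?_⟩
      rcases eq_or_ne z' z with rfl | hne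
      · simpa using hn0 z0 0
      set v := z' - z with hv
      have hv0 : 0 < ‖v‖ := norm_pos_iff.2 (sub_ne_zero.2 hne)
      have hvr : ‖v‖ < r0 / 2 := by rw [hv, ← dist_eq_norm]; exact hz'
      have hs0 : 0 < τ * ‖v‖ := by positivity
      have key := avg_bound (hg i) hW (a := n z0 v + 2 * ε * ‖v‖) (s := τ * ‖v‖) (β := η * (4 * (2 * ‖v‖)^2)) (z := z) (v := v)
        (by have := hn0 z0 v; positivity) hs0 (by positivity) (fun x hx => (mem_iInter.1 hx i) v) (fun t ht => by
          refine (measure_mono (sdiff_subset_sdiff_left ?_)).trans (h2 (2 * ‖v‖) (by positivity) (by linarith))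
          refine closedBall_subset_closedBall' ?_
          rw [dist_eq_norm, add_sub_cancel_left, norm_smul, Real.norm_eq_abs, abs_of_nonneg ht.1]
          nlinarith [ht.2])
      have hzv : z + v = z' := by rw [hv]; abel
      rw [hzv] at key
      have hq : 0 < 4 * (τ * ‖v‖)^2 := by positivity
      refine le_of_mul_le_mul_left (key.trans ?_) hq
      have e1 : (k:ℝ) * ‖v‖ * (η * (4 * (2 * ‖v‖)^2)) = 4 * k * η * (4 * ‖v‖^3) := by ring
      have e2 : 4 * k * η * (4 * ‖v‖^3) ≤ ε * τ^2 * (4 * ‖v‖^3) := by gcongr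
      have e3 : 4 * (τ * ‖v‖)^2 * (n z0 v + 2 * ε * ‖v‖ + 2 * k * (τ * ‖v‖)) ≤
          4 * (τ * ‖v‖)^2 * (n z0 v + 2 * ε * ‖v‖ + 2 * ε * ‖v‖) := by
        have := mul_le_mul_of_nonneg_right hτk hv0.le
        refine mul_le_mul_of_nonneg_left ?_ hq.le
        linarith
      rw [e1]
      nlinarith
    have hlo : ∃ r0 > 0, ∀ z', dist z' z < r0 → ∃ i, n z0 (z' - z) - 5 * ε * ‖z' - z‖ ≤ |g i z' - g i z| := by
      obtain ⟨t, ht⟩ := (isCompact_closedBall (0:ℝ×ℝ) 1).elim_finite_subcover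
        (fun i => {v | n z v - ε < |fderiv ℝ (g i) z v|}) (fun i => isOpen_lt ((hnL z).continuous.sub continuous_const)
          (continuous_abs.comp (fderiv ℝ (g i) z).continuous)) (fun v _ => by
          obtain ⟨i, hi⟩ := exists_lt_of_lt_ciSup (show n z v - ε < ⨆ i, |fderiv ℝ (g i) z v| by
            show n z v - ε < n z v; linarith)
          exact mem_iUnion.2 ⟨i, hi⟩)
      have h1 : ∀ᶠ z' in 𝓝 z, ∀ i ∈ t, ‖g i z' - g i z - fderiv ℝ (g i) z (z' - z)‖ ≤ ε * ‖z' - z‖ :=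
        (Finset.eventually_all t).2 fun i _ => (hdz i).hasFDerivAt.isLittleO.def hε
      obtain ⟨r0, hr0, hr⟩ := Metric.eventually_nhds_iff.1 h1
      refine ⟨r0, hr0, fun z' hz' => ?_⟩
      rcases eq_or_ne z' z with rfl | hne
      · have h3 := hnh z0 0 0
        simp at h3
        exact ⟨0, by simp [h3]⟩
      have h2 := hr hz'
      set v := z' - z with hv
      have hv0 : 0 < ‖v‖ := norm_pos_iff.2 (sub_ne_zero.2 hne)
      have h3 := ht (show ‖v‖⁻¹ • v ∈ closedBall (0:ℝ×ℝ) 1 by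
        rw [mem_closedBall_zero_iff, norm_smul, norm_inv, norm_norm, inv_mul_cancel₀ hv0.ne'])
      simp only [mem_iUnion] at h3
      obtain ⟨i, hi, h4⟩ := h3
      have h5 : n z (‖v‖⁻¹ • v) - ε < |fderiv ℝ (g i) z (‖v‖⁻¹ • v)| := h4
      rw [hnh, map_smul, smul_eq_mul, abs_mul, abs_of_pos (inv_pos.2 hv0)] at h5
      have h6 : n z v - ε * ‖v‖ < |fderiv ℝ (g i) z v| := by
        have := mul_lt_mul_of_pos_right h5 hv0
        have e : ‖v‖⁻¹ * ‖v‖ = 1 := inv_mul_cancel₀ hv0.ne'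
        calc n z v - ε * ‖v‖ = (‖v‖⁻¹ * ‖v‖) * n z v - ε * ‖v‖ := by rw [e, one_mul]
          _ = (‖v‖⁻¹ * n z v - ε) * ‖v‖ := by ring
          _ < _ := this
          _ = (‖v‖⁻¹ * ‖v‖) * |fderiv ℝ (g i) z v| := by ring
          _ = _ := by rw [e, one_mul]
      refine ⟨i, ?_⟩
      have h7 := h2 i hi
      rw [Real.norm_eq_abs, abs_sub_comm] at h7
      have h8 := abs_sub_abs_le_abs_sub (fderiv ℝ (g i) z v) (g i z' - g i z)
      have h9 := abs_le.1 (hcl z hz v)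
      nlinarith
    obtain ⟨r1, hr1, hu⟩ := hup
    obtain ⟨r2, hr2, hl⟩ := hlo
    obtain ⟨m, hm⟩ := exists_nat_one_div_lt (lt_min hr1 hr2)
    refine ⟨m, fun z' hz' => ⟨hu z' (hz'.trans (hm.trans_le (min_le_left _ _))), hl z' (hz'.trans (hm.trans_le (min_le_right _ _)))⟩⟩
  obtain ⟨m, hm⟩ := pick_pos hj P hmain
  exact ⟨_, fun z hz => hz.1.1, hm, n z0, (hnL z0).continuous, hnh z0, 1 / ((m:ℝ)+1), by positivity, fun z hz => hz.2⟩

end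

section
set_option linter.unusedSectionVars false

theorem metric_diff {Y : Type*} [MetricSpace Y] [TopologicalSpace.SeparableSpace Y] [Nonempty Y] {S : Set (ℝ × ℝ)}
    (hS : IsCompact S) (h0 : volume S ≠ 0) {G : ℝ × ℝ → Y} {k : ℝ≥0} (hk : 1 ≤ k)
    (hlo : ∀ z ∈ S, ∀ z' ∈ S, dist z z' ≤ dist (G z) (G z'))
    (hup : ∀ z ∈ S, ∀ z' ∈ S, dist (G z) (G z') ≤ k * dist z z') {ε : ℝ} (hε : 0 < ε) :
    ∃ S' ⊆ S, IsCompact S' ∧ volume S' ≠ 0 ∧ ∃ N : ℝ × ℝ → ℝ, Continuous N ∧ (∀ (t : ℝ) v, N (t • v) = |t| * N v) ∧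
      (∀ v, ‖v‖ ≤ N v) ∧ ∃ ρ > 0, ∀ z ∈ S', ∀ z' ∈ S', dist z z' < ρ →
        (1 - ε) * N (z - z') ≤ dist (G z) (G z') ∧ dist (G z) (G z') ≤ (1 + ε) * N (z - z') := by
  have hGL : LipschitzOnWith k G S := LipschitzOnWith.of_dist_le_mul hup
  let y := TopologicalSpace.denseSeq Y
  have hL : ∀ i, LipschitzOnWith k (fun z => dist (G z) (y i)) S := fun i => by
    have := (LipschitzWith.dist_left (y i)).comp_lipschitzOnWith hGL
    simpa [Function.comp_def] using this
  choose g hg hgS using fun i => (hL i).extend_real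
  obtain ⟨S1, hS1, hS1v, N, hNc, hNh, ρ, hρ, hmd⟩ := md_fam hk hg h0 (ε := ε / 5) (by positivity)
  have hNs : ∀ v, N (-v) = N v := fun v => by simpa using hNh (-1) v
  have e5 : 5 * (ε / 5) = ε := by ring
  rw [e5] at hmd
  have hd1 : ∀ z ∈ S1, ∀ z' ∈ S, dist z z' < ρ → (1 - ε) * max (N (z - z')) ‖z - z'‖ ≤ dist (G z) (G z') ∧
      dist (G z) (G z') ≤ (1 + ε) * max (N (z - z')) ‖z - z'‖ := by
    intro z hz z' hz' hd
    obtain ⟨h1, i, h2⟩ := hmd z hz z' (by rwa [dist_comm])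
    rw [← neg_sub z z', hNs, norm_neg] at h1 h2
    have hr : ‖z - z'‖ ≤ dist (G z) (G z') := by rw [← dist_eq_norm]; exact hlo z (hS1 hz) z' hz'
    have hm1 := le_max_left (N (z - z')) ‖z - z'‖
    have hm2 := le_max_right (N (z - z')) ‖z - z'‖
    have hge : ∀ i, g i z = dist (G z) (y i) := fun i => (hgS i (hS1 hz)).symm
    have hge' : ∀ i, g i z' = dist (G z') (y i) := fun i => (hgS i hz').symm
    constructor
    · rw [hge, hge'] at h2
      have h3 := abs_dist_sub_le (G z') (G z) (y i)
      rw [dist_comm (G z') (G z)] at h3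
      rcases max_cases (N (z - z')) ‖z - z'‖ with ⟨e, _⟩ | ⟨e, _⟩ <;> rw [e] at hm2 ⊢ <;> nlinarith [norm_nonneg (z - z')]
    · refine le_of_forall_pos_le_add fun δ hδ => ?_
      obtain ⟨i, hi⟩ := (TopologicalSpace.denseRange_denseSeq Y).exists_dist_lt (G z) (half_pos hδ)
      have h3 := h1 i
      rw [hge, hge'] at h3
      have h4 := (abs_le.1 h3).2
      have h5 := dist_triangle_right (G z) (G z') (y i)
      have h6 : dist (G z) (y i) < δ / 2 := hi
      nlinarith [norm_nonneg (z - z')]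
  have hcl : closure S1 ⊆ S := hS.isClosed.closure_subset_iff.2 hS1
  refine ⟨closure S1, hcl, hS.of_isClosed_subset isClosed_closure hcl,
    fun h => hS1v (measure_mono_null subset_closure h), fun v => max (N v) ‖v‖, hNc.max continuous_norm, ?_,
    fun v => le_max_right _ _, ρ, hρ, ?_⟩
  · intro t v
    show max (N (t • v)) ‖t • v‖ = |t| * max (N v) ‖v‖
    rw [hNh, norm_smul, Real.norm_eq_abs, mul_max_of_nonneg _ _ (abs_nonneg t)]
  · intro z hz z' hz' hd
    dsimp only
    obtain ⟨x, hx, hxz⟩ := mem_closure_iff_seq_limit.1 hz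
    have hG : Tendsto (fun n => G (x n)) atTop (𝓝 (G z)) :=
      ((hGL.continuousOn z (hcl hz)).tendsto).comp (tendsto_nhdsWithin_iff.2 ⟨hxz, Eventually.of_forall fun n => hS1 (hx n)⟩)
    have hG' := hG.dist (tendsto_const_nhds (x := G z'))
    have hM : Tendsto (fun n => max (N (x n - z')) ‖x n - z'‖) atTop (𝓝 (max (N (z - z')) ‖z - z'‖)) :=
      (((hNc.max continuous_norm).comp (continuous_id.sub continuous_const)).tendsto z).comp hxz
    have hev : ∀ᶠ n in atTop, dist (x n) z' < ρ :=
      (hxz.dist (tendsto_const_nhds (x := z'))).eventually (gt_mem_nhds hd)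
    constructor
    · exact le_of_tendsto_of_tendsto (hM.const_mul _) hG' (hev.mono fun n hn => (hd1 _ (hx n) z' (hcl hz') hn).1)
    · exact le_of_tendsto_of_tendsto hG' (hM.const_mul _) (hev.mono fun n hn => (hd1 _ (hx n) z' (hcl hz') hn).2)

end

section
open scoped Pointwise
set_option linter.unusedSectionVars false

section nrm
variable {N : ℝ × ℝ → ℝ}

theorem nrm_compact (hNc : Continuous N) (hNn : ∀ v, ‖v‖ ≤ N v) (D : ℝ) : IsCompact {v | N v ≤ D} :=
  (isCompact_closedBall (0:ℝ×ℝ) D).of_isClosed_subset (isClosed_le hNc continuous_const)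
    (fun v hv => mem_closedBall_zero_iff.2 ((hNn v).trans hv))

theorem nrm_smul (hNh : ∀ (t : ℝ) v, N (t • v) = |t| * N v) {D : ℝ} (hD : 0 < D) :
    {v | N v ≤ D} = D • {v | N v ≤ 1} := by
  ext v
  rw [mem_smul_set_iff_inv_smul_mem₀ hD.ne']
  show N v ≤ D ↔ N (D⁻¹ • v) ≤ 1
  rw [hNh, abs_of_pos (inv_pos.2 hD), inv_mul_le_iff₀ hD, mul_one]

theorem vol_smul2 {D : ℝ} (K : Set (ℝ × ℝ)) : volume (D • K) = ENNReal.ofReal (D^2) * volume K := by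
  rw [Measure.addHaar_smul]; simp [Module.finrank_prod]

theorem nrm_vol (hNh : ∀ (t : ℝ) v, N (t • v) = |t| * N v) (hNn : ∀ v, ‖v‖ ≤ N v) {D : ℝ} (hD : 0 ≤ D) :
    volume {v | N v ≤ D} ≤ ENNReal.ofReal (D^2) * volume {v | N v ≤ 1} := by
  rcases hD.eq_or_lt with rfl | hD
  · have : {v | N v ≤ 0} ⊆ {(0:ℝ×ℝ)} := fun v hv => norm_le_zero_iff.1 ((hNn v).trans hv)
    rw [measure_mono_null this (by simp)]; exact zero_le
  · rw [nrm_smul hNh hD, vol_smul2]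

theorem nrm_pos (hNc : Continuous N) (hNh : ∀ (t : ℝ) v, N (t • v) = |t| * N v) : volume {v | N v ≤ 1} ≠ 0 := by
  have h0 : N 0 = 0 := by simpa using hNh 0 0
  have h1 : IsOpen {v | N v < 1} := isOpen_lt hNc continuous_const
  have h2 := h1.measure_pos volume ⟨0, by show N 0 < 1; rw [h0]; exact one_pos⟩
  exact (h2.trans_le (measure_mono fun v (hv : N v < 1) => hv.le)).ne'
end nrm

theorem haus_lower {Y : Type*} [MetricSpace Y] [MeasurableSpace Y] [BorelSpace Y] {S : Set (ℝ × ℝ)} (hS : IsCompact S)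
    {G : ℝ × ℝ → Y} (hG : ContinuousOn G S) {N : ℝ × ℝ → ℝ} (hNc : Continuous N)
    (hNh : ∀ (t : ℝ) v, N (t • v) = |t| * N v) (hNn : ∀ v, ‖v‖ ≤ N v) {ρ ε : ℝ} (hρ : 0 < ρ) (hε : ε < 1)
    (hlo : ∀ z ∈ S, ∀ z' ∈ S, dist z z' ≤ dist (G z) (G z'))
    (hmd : ∀ z ∈ S, ∀ z' ∈ S, dist z z' < ρ → (1 - ε) * N (z - z') ≤ dist (G z) (G z')) {B : Set Y} (hB : MeasurableSet B) :
    ENNReal.ofReal (4 * (1 - ε)^2 / volume.real {v | N v ≤ 1}) * volume (S ∩ G ⁻¹' B) ≤ μH[2] B := by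
  set K := {v | N v ≤ 1} with hK
  set b := 4 * (1 - ε)^2 / volume.real K with hb
  have hK0 : volume K ≠ 0 := nrm_pos hNc hNh
  have hKt : volume K ≠ ⊤ := (nrm_compact hNc hNn 1).measure_lt_top.ne
  have hKp : 0 < volume.real K := ENNReal.toReal_pos hK0 hKt
  have he : 0 < 1 - ε := by linarith
  have hGm : AEMeasurable G (volume.restrict S) := hG.aemeasurable hS.measurableSet
  let m : Measure Y := ENNReal.ofReal b • ((volume.restrict S).map G)
  have hm : ∀ {B : Set Y}, MeasurableSet B → m B = ENNReal.ofReal b * volume (S ∩ G ⁻¹' B) := by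
    intro B hB
    rw [Measure.smul_apply, Measure.map_apply_of_aemeasurable hGm hB, Measure.restrict_apply' hS.measurableSet, inter_comm,
      smul_eq_mul]
  rw [← hm hB]
  refine Measure.le_hausdorffMeasure 2 m (ENNReal.ofReal (ρ/2)) (by simpa using hρ) (fun s hs => ?_) B
  refine (measure_mono subset_closure).trans ?_
  rw [hm isClosed_closure.measurableSet, ← ediam_closure]
  rw [← ediam_closure] at hs
  set C := closure s
  have hCb : ediam C ≠ ⊤ := (hs.trans_lt ofReal_lt_top).ne
  set D := Metric.diam C with hD
  have hDe : ediam C = ENNReal.ofReal D := by rw [hD, Metric.diam, ENNReal.ofReal_toReal hCb]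
  have hDρ : D ≤ ρ / 2 := ENNReal.toReal_le_of_le_ofReal (by positivity) hs
  have hD0 : 0 ≤ D := Metric.diam_nonneg
  have hA : IsCompact (S ∩ G ⁻¹' C) :=
    hS.of_isClosed_subset (hG.preimage_isClosed_of_isClosed hS.isClosed isClosed_closure) inter_subset_left
  have h2 := two_d hA (nrm_compact hNc hNn (D / (1 - ε))) (fun z hz z' hz' => by
    have h1 : dist (G z) (G z') ≤ D := Metric.dist_le_diam_of_mem (Metric.isBounded_iff_ediam_ne_top.2 hCb) hz.2 hz'.2
    show N (z - z') ≤ D / (1 - ε)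
    rw [le_div_iff₀ he, mul_comm]
    exact (hmd z hz.1 z' hz'.1 (((hlo z hz.1 z' hz'.1).trans h1).trans_lt (by linarith))).trans h1)
  have h3 := h2.trans (nrm_vol hNh hNn (div_nonneg hD0 he.le))
  have hKe : volume K = ENNReal.ofReal (volume.real K) := (ENNReal.ofReal_toReal hKt).symm
  rw [← hK, hKe, ← ENNReal.ofReal_mul (by positivity)] at h3
  have hAt := hA.measure_lt_top (μ := volume).ne
  rw [← ENNReal.ofReal_toReal hAt] at h3 ⊢
  rw [show (4:ℝ≥0∞) = ENNReal.ofReal 4 by simp, ← ENNReal.ofReal_mul (by norm_num), ENNReal.ofReal_le_ofReal_iff (by positivity)] at h3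
  rw [hDe, ← ENNReal.ofReal_mul (by positivity), show (2:ℝ) = ((2:ℕ):ℝ) by norm_num, ENNReal.rpow_natCast, ← ENNReal.ofReal_pow hD0]
  refine ENNReal.ofReal_le_ofReal ?_
  rw [hb]
  have h4 : 4 * (1 - ε)^2 / volume.real K * (volume (S ∩ G ⁻¹' C)).toReal = (1 - ε)^2 / volume.real K * (4 * (volume (S ∩ G ⁻¹' C)).toReal) := by ring
  rw [h4]
  calc _ ≤ (1 - ε)^2 / volume.real K * ((D / (1 - ε))^2 * volume.real K) := by gcongr
    _ = D^2 := by field_simp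

end

section
open scoped Pointwise
set_option linter.unusedSectionVars false

theorem HypY.core {Y : Type*} [MetricSpace Y] [MeasurableSpace Y] [BorelSpace Y] {ν : Measure Y} {κ c : ℝ} (H : HypY ν κ c)
    {θ : ℝ} (hθ : 1 < θ) {E : Set Y} (hE : IsCompact E) (h0 : ν E ≠ 0)
    (hν : ∀ B ⊆ E, MeasurableSet B → ENNReal.ofReal (θ * c / 4) * μH[2] B ≤ ν B) : False := by
  have := H.sc; have := H.fin; have := H.nontriv
  have hc := H.hc
  obtain ⟨T, hTE, hT, F, hF, k, hk, hFk, hFT⟩ := H.rect hE h0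
  obtain ⟨ε, hε0, hε1, hεθ⟩ : ∃ ε : ℝ, 0 < ε ∧ ε < 1 ∧ (1 + 2 * ε)^2 < θ * (1 - ε)^3 := by
    have h1 : Tendsto (fun ε : ℝ => θ * (1 - ε)^3 - (1 + 2 * ε)^2) (𝓝[>] 0) (𝓝 (θ * (1 - 0)^3 - (1 + 2 * 0)^2)) :=
      (Continuous.tendsto (by fun_prop) 0).mono_left nhdsWithin_le_nhds
    have h2 := h1.eventually (lt_mem_nhds (show (0:ℝ) < _ by norm_num; exact hθ))
    obtain ⟨ε, h3, h4⟩ := (h2.and (Ioo_mem_nhdsGT one_pos)).exists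
    exact ⟨ε, h4.1, h4.2, by linarith⟩
  have hFinj : InjOn F T := fun a ha b hb hab => by
    have := hFk a ha b hb
    rw [hab, dist_self, mul_zero] at this
    exact dist_le_zero.1 this
  let G := Function.invFunOn F T
  have hG : ∀ z ∈ F '' T, G z ∈ T ∧ F (G z) = z := fun z hz => ⟨Function.invFunOn_mem hz, Function.invFunOn_eq hz⟩
  have hlo : ∀ z ∈ F '' T, ∀ z' ∈ F '' T, dist z z' ≤ dist (G z) (G z') := fun z hz z' hz' => by
    have := hF.dist_le_mul (G z) (G z')
    rwa [(hG z hz).2, (hG z' hz').2, NNReal.coe_one, one_mul] at this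
  let k' : ℝ≥0 := max 1 k.toNNReal
  have hup : ∀ z ∈ F '' T, ∀ z' ∈ F '' T, dist (G z) (G z') ≤ k' * dist z z' := fun z hz z' hz' => by
    have := hFk _ (hG z hz).1 _ (hG z' hz').1
    rw [(hG z hz).2, (hG z' hz').2] at this
    refine this.trans (mul_le_mul_of_nonneg_right ?_ dist_nonneg)
    exact (Real.le_coe_toNNReal k).trans (by exact_mod_cast le_max_right _ _)
  obtain ⟨S, hST, hS, hS0, N, hNc, hNh, hNn, ρ, hρ, hmd⟩ :=
    metric_diff (hT.image hF.continuous) hFT (G := G) (k := k') (le_max_left _ _) hlo hup hε0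
  have hGc : ContinuousOn G S := (LipschitzOnWith.of_dist_le_mul fun z hz z' hz' => hup z (hST hz) z' (hST hz')).continuousOn
  have hHL := fun {B : Set Y} (hB : MeasurableSet B) => haus_lower hS hGc hNc hNh hNn hρ hε1
    (fun z hz z' hz' => hlo z (hST hz) z' (hST hz')) (fun z hz z' hz' hd => (hmd z hz z' hz' hd).1) hB
  set K := {v | N v ≤ 1} with hK
  have hK0 : volume K ≠ 0 := nrm_pos hNc hNh
  have hKc : IsCompact K := nrm_compact hNc hNn 1
  have hKt : volume K ≠ ⊤ := hKc.measure_lt_top.ne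
  have hKp : 0 < volume.real K := ENNReal.toReal_pos hK0 hKt
  have hKe : volume K = ENNReal.ofReal (volume.real K) := (ENNReal.ofReal_toReal hKt).symm
  -- density point
  obtain ⟨z, hz, hzd⟩ : ∃ z ∈ S, Tendsto (fun r => volume (S ∩ closedBall z r) / volume (closedBall z r)) (𝓝[>] 0) (𝓝 1) := by
    have h1 := Besicovitch.ae_tendsto_measure_inter_div_of_measurableSet volume hS.measurableSet
    by_contra hcon
    push Not at hcon
    apply hS0
    refine measure_mono_null ?_ (ae_iff.1 h1)
    intro z hz h2
    rw [indicator_of_mem hz] at h2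
    exact hcon z hz h2
  have hd := Measure.tendsto_addHaar_inter_smul_one_of_density_one volume S z hzd K hKc.measurableSet hK0 hKt
  have hd1 : ∀ᶠ t in 𝓝[>] (0:ℝ), ENNReal.ofReal (1 - ε) < volume (S ∩ ({z} + t • K)) / volume ({z} + t • K) :=
    hd.eventually (lt_mem_nhds (by rw [← ENNReal.ofReal_one, ENNReal.ofReal_lt_ofReal_iff one_pos]; linarith))
  obtain ⟨t0, ht0, htt⟩ := mem_nhdsGT_iff_exists_Ioo_subset.1 hd1
  have ht0' : 0 < t0 := ht0
  obtain ⟨r, hr0, hr1, hr2⟩ := H.up (G z) (min t0 ρ) (lt_min ht0' hρ)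
  set t := r / (1 + 2 * ε) with ht
  have htp : 0 < t := by positivity
  have htr : t ≤ r := div_le_self hr0.le (by linarith)
  have hrt : r = (1 + 2 * ε) * t := by rw [ht]; field_simp
  have hv : ENNReal.ofReal (1 - ε) < volume (S ∩ ({z} + t • K)) / volume ({z} + t • K) :=
    htt ⟨htp, htr.trans_lt (hr1.trans_le (min_le_left _ _))⟩
  have hvK : volume ({z} + t • K) = ENNReal.ofReal (t^2 * volume.real K) := by
    rw [singleton_add, image_add_left, measure_preimage_add, vol_smul2, ENNReal.ofReal_mul (by positivity), ← hKe]
  have hv2 : ENNReal.ofReal ((1 - ε) * (t^2 * volume.real K)) ≤ volume (S ∩ ({z} + t • K)) := by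
    rw [ENNReal.ofReal_mul (by linarith), ← hvK]
    exact ((ENNReal.lt_div_iff_mul_lt (Or.inl (by rw [hvK]; simp; positivity)) (Or.inl (by rw [hvK]; exact ofReal_ne_top))).1 hv).le
  let B : Set Y := Metric.ball (G z) r ∩ G '' S
  have hBm : MeasurableSet B := isOpen_ball.measurableSet.inter (hS.image_of_continuousOn hGc).isClosed.measurableSet
  have hBE : B ⊆ E := by
    rintro _ ⟨_, w, hw, rfl⟩
    exact hTE (hG w (hST hw)).1
  have hsub : S ∩ ({z} + t • K) ⊆ S ∩ G ⁻¹' B := by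
    rintro w ⟨hw, hw2⟩
    refine ⟨hw, ?_, mem_image_of_mem _ hw⟩
    rw [singleton_add] at hw2
    obtain ⟨u, hu, rfl⟩ := hw2
    rw [← nrm_smul hNh htp] at hu
    have hu' : N u ≤ t := hu
    have h3 : dist (z + u) z < ρ := by
      rw [dist_eq_norm, add_sub_cancel_left]
      exact ((hNn u).trans hu').trans_lt (htr.trans_lt (hr1.trans_le (min_le_right _ _)))
    have h4 := (hmd _ hw _ hz h3).2
    rw [add_sub_cancel_left] at h4
    show dist (G (z + u)) (G z) < r
    have h5 : (1 + ε) * N u ≤ (1 + ε) * t := by gcongr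
    nlinarith
  have h1 : ENNReal.ofReal (θ * c / 4 * (4 * (1 - ε)^2 / volume.real K * ((1 - ε) * (t^2 * volume.real K)))) ≤ ν (Metric.ball (G z) r) := by
    have he : 0 < 1 - ε := by linarith
    rw [ENNReal.ofReal_mul (by positivity), ENNReal.ofReal_mul (by positivity)]
    calc _ ≤ ENNReal.ofReal (θ * c / 4) * (ENNReal.ofReal (4 * (1 - ε)^2 / volume.real K) * volume (S ∩ G ⁻¹' B)) :=
          mul_le_mul_right (mul_le_mul_right (hv2.trans (measure_mono hsub)) _) _
      _ ≤ ENNReal.ofReal (θ * c / 4) * μH[2] B := mul_le_mul_right (hHL hBm) _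
      _ ≤ ν B := hν B hBE hBm
      _ ≤ _ := measure_mono inter_subset_left
  have h2 := (ENNReal.ofReal_le_iff_le_toReal (measure_ne_top ν _)).1 h1
  have h3 := h2.trans hr2
  have h4 : θ * c / 4 * (4 * (1 - ε)^2 / volume.real K * ((1 - ε) * (t^2 * volume.real K))) = (c * t^2) * (θ * (1 - ε)^3) := by
    field_simp
  rw [h4, hrt] at h3
  have h5 : (c * t^2) * (1 + 2 * ε)^2 < (c * t^2) * (θ * (1 - ε)^3) := by gcongr
  nlinarith

theorem HypY.mainY {Y : Type*} [MetricSpace Y] [MeasurableSpace Y] [BorelSpace Y] {ν : Measure Y} {κ c : ℝ} (H : HypY ν κ c)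
    {E : Set Y} (hE : MeasurableSet E) : ν E ≤ ENNReal.ofReal (c / 4) * μH[2] E := by
  have := H.sc; have := H.fin; have := H.lc
  have hc := H.hc
  have hfinH : ∀ A : Set Y, μH[2] A ≠ ⊤ := fun A =>
    ((H.haus A).trans_lt (ENNReal.mul_lt_top ofReal_lt_top (measure_lt_top ν A))).ne
  have key : ∀ θ : ℝ, 1 < θ → ν E ≤ ENNReal.ofReal (θ * c / 4) * μH[2] E := by
    intro θ hθ
    have : IsFiniteMeasure (ENNReal.ofReal (θ * c / 4) • (μH[2] : Measure Y)) := ⟨by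
      rw [Measure.smul_apply, smul_eq_mul]
      exact ENNReal.mul_lt_top ofReal_lt_top (hfinH _).lt_top⟩
    obtain ⟨s, hs, h1, h2⟩ := hahn_decomposition ν (ENNReal.ofReal (θ * c / 4) • (μH[2] : Measure Y))
    have h3 : ν s = 0 := by
      by_contra hne
      obtain ⟨K, hKs, hK, hK0⟩ := hs.exists_lt_isCompact_of_ne_top (measure_ne_top ν s) (pos_iff_ne_zero.2 hne)
      exact H.core hθ hK hK0.ne' fun B hB hBm => h1 B hBm (hB.trans hKs)
    calc ν E ≤ ν s + ν (E \ s) := (measure_mono (fun x hx => by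
            by_cases h : x ∈ s
            · exact Or.inl h
            · exact Or.inr ⟨hx, h⟩)).trans (measure_union_le _ _)
      _ = ν (E \ s) := by rw [h3, zero_add]
      _ ≤ _ := h2 _ (hE.diff hs) (fun x hx => hx.2)
      _ ≤ _ := by
        rw [Measure.smul_apply, smul_eq_mul]
        exact mul_le_mul_right (measure_mono sdiff_subset) _
  have hlim : Tendsto (fun θ : ℝ => ENNReal.ofReal (θ * c / 4) * μH[2] E) (𝓝[>] 1) (𝓝 (ENNReal.ofReal (1 * c / 4) * μH[2] E)) := by
    refine ENNReal.Tendsto.mul_const ?_ (Or.inr (hfinH E))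
    exact ((ENNReal.continuous_ofReal.comp (by fun_prop : Continuous fun θ : ℝ => θ * c / 4)).tendsto 1).mono_left nhdsWithin_le_nhds
  rw [one_mul] at hlim
  exact ge_of_tendsto hlim (eventually_mem_nhdsWithin.mono fun θ hθ => key θ hθ)

end

theorem statement6
    {X : Type*} [MetricSpace X] [MeasurableSpace X] [BorelSpace X]
    (lam : ℝ) (CD CW : ℝ≥0) (M : ℕ) (μ : Measure X)
    (hlam : 1 ≤ lam) (hLLC : IsLLC X lam)
    (hhom : ∃ Ω₀ : Set ↥Sphere2, IsCircleDomainS2 Ω₀ ∧ Nonempty (X ≃ₜ ↥Ω₀))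
    (hcpt : CompactSpace (Completion X))
    (hfin : (residComps X).Finite) (hM : (residComps X).ncard = M)
    (hreg : μ.Regular) (hdbl : IsDoublingWith μ CD) (hw : IsWMDM μ 2 CW)
    {Y : Type*} [MetricSpace Y] (e : X ≃ Y)
    (hq : ∀ x y : X, edist (e x) (e y) = qmu μ 2 x y) :
    ∀ E : Set X, MeasurableSet E →
      (ENNReal.ofReal (2 * Real.pi) * CSconst lam CD CW ^ 2 * (CD : ℝ≥0∞) ^ 4)⁻¹ *
          hausdorff2 Y ((fun p => e p) '' E) ≤ μ E ∧
        μ E ≤ ((CW : ℝ≥0∞) ^ 2 / ENNReal.ofReal Real.pi) *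
          hausdorff2 Y ((fun p => e p) '' E) := by
  intro E hE
  letI : MeasurableSpace Y := borel Y
  haveI : BorelSpace Y := ⟨rfl⟩
  have H := mkHyp hlam hLLC hhom hcpt hdbl hw hq
  have hCD1 : (1:ℝ) ≤ CD := H.CD_one
  have hCW0 : (0:ℝ) < CW := H.CW_pos
  have hCD0 : (0:ℝ) < CD := one_pos.trans_le hCD1
  have hpi := Real.pi_pos
  set l := ellOf lam with hl
  have hll : lam ≤ 2 ^ l := lam_le_ell hlam
  set C1 : ℝ := 16 * CW * CD ^ (25 + 2 * l) with hC1
  have hC10 : 0 < C1 := by positivity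
  have hloc := H.q_loc hll
  have hh : hausdorff2 Y ((fun p => e p) '' E) = ENNReal.ofReal (Real.pi / 4) * μH[2] (e '' E) := rfl
  rw [hh]
  constructor
  · have h1 := H.haus_le (e := e) (fun _ _ => rfl) hC10 hloc E
    set C2 : ℝ := 16 * CW * CD ^ (28 + 16 * l) with hC2
    have hC20 : 0 < C2 := by positivity
    have hCS : CSconst lam CD CW = ENNReal.ofReal C2 := by
      rw [CSconst, hC2, ENNReal.ofReal_mul (by positivity), ENNReal.ofReal_mul (by positivity), ENNReal.ofReal_pow hCD0.le,
        ENNReal.ofReal_coe_nnreal, ENNReal.ofReal_coe_nnreal]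
      simp [hl]
    have hA : ENNReal.ofReal (2 * Real.pi) * CSconst lam CD CW ^ 2 * (CD : ℝ≥0∞) ^ 4 =
        ENNReal.ofReal (2 * Real.pi * C2 ^ 2 * CD ^ 4) := by
      rw [hCS, ENNReal.ofReal_mul (p := 2 * Real.pi * C2 ^ 2) (by positivity), ENNReal.ofReal_mul (p := 2 * Real.pi) (by positivity), ENNReal.ofReal_pow hC20.le,
        ENNReal.ofReal_pow hCD0.le, ENNReal.ofReal_coe_nnreal]
    rw [hA, ENNReal.inv_mul_le_iff (by simp; positivity) ofReal_ne_top]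
    refine (mul_le_mul_right h1 _).trans ?_
    rw [← mul_assoc, ← ENNReal.ofReal_mul (by positivity)]
    refine mul_le_mul_left (ENNReal.ofReal_le_ofReal ?_) _
    have h12 : C1 ≤ C2 := by
      rw [hC1, hC2]
      refine mul_le_mul_of_nonneg_left (pow_le_pow_right₀ hCD1 (by omega)) (by positivity)
    have h24 : (CD:ℝ)^2 ≤ CD^4 := pow_le_pow_right₀ hCD1 (by norm_num)
    calc Real.pi / 4 * (4 * C1 ^ 2 * CD ^ 2) = Real.pi * (C1 ^ 2 * CD ^ 2) := by ring
      _ ≤ Real.pi * (C2 ^ 2 * CD ^ 4) := by gcongr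
      _ ≤ 2 * (Real.pi * (C2 ^ 2 * CD ^ 4)) := by
        have : 0 ≤ Real.pi * (C2 ^ 2 * (CD:ℝ) ^ 4) := by positivity
        linarith
      _ = _ := by ring
  · obtain ⟨κ, HY⟩ := H.mkY (e := e) (fun _ _ => rfl) hC10 hloc hll
    obtain ⟨hc1, hc2⟩ := H.homeo (e := e) (fun _ _ => rfl) hC10 hloc
    let eh : X ≃ₜ Y := ⟨e, hc1, hc2⟩
    have hEm : MeasurableSet (e '' E) := eh.toMeasurableEquiv.measurableSet_image.2 hE
    have h1 := HY.mainY hEm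
    have h2 : (μ.map e) (e '' E) = μ E := by
      refine (eh.toMeasurableEquiv.map_apply (μ := μ) (e '' E)).trans ?_
      congr 1
      exact e.preimage_image E
    rw [h2] at h1
    refine h1.trans (le_of_eq ?_)
    rw [← mul_assoc]
    congr 1
    have h3 : (CW : ℝ≥0∞) ^ 2 = ENNReal.ofReal ((CW:ℝ)^2) := by
      rw [ENNReal.ofReal_pow hCW0.le, ENNReal.ofReal_coe_nnreal]
    rw [h3, ← ENNReal.ofReal_div_of_pos hpi, ← ENNReal.ofReal_mul (by positivity)]
    congr 1
    field_simp

end
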